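/- arXiv:1308.2405 — 3 statements merged into one kernel-verified Lean document; each statement's English description precedes it below -/
import Mathlib

section
/- Let L be a rank-n lattice in ℝ^m, let ε > 0, and let λ > 0 be such that L contains n linearly independent vectors each of Euclidean norm at most λ (i.e., λ ≥ λ_n(L)). Then with s = λ·√(ln(2n(1 + 1/ε))/π), we have ρ_{1/s}(L* ∖ {0}) = Σ_{y ∈ L*∖{0}} exp(−π s² ‖y‖²) ≤ ε; that is, η_ε(L) ≤ λ_n(L)·√(ln(2n(1 + 1/ε))/π). -/
open scoped BigOperators Matrix
attribute [local instance] Classical.propDecidable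

/-- Ellipsoidal Gaussian function `ρ_S(x) = exp(-π xᵀ (SᵀS)⁻¹ x)` for a (rank-`n`)
matrix `S ∈ ℝ^{m×n}` and `x ∈ ℝ^n`. -/
noncomputable def rho {m n : ℕ} (S : Matrix (Fin m) (Fin n) ℝ) (x : Fin n → ℝ) : ℝ :=
  Real.exp (-Real.pi * (x ⬝ᵥ ((Sᵀ * S)⁻¹ *ᵥ x)))

/-- Coordinatewise cast of an integer vector to a real vector. -/
def intCast' {k : ℕ} (v : Fin k → ℤ) : Fin k → ℝ := fun i => (v i : ℝ)

/-- Euclidean (ℓ2) norm of a real vector. -/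
noncomputable def enorm' {k : ℕ} (x : Fin k → ℝ) : ℝ := Real.sqrt (∑ i, (x i) ^ 2)

/-- The kernel of congruence modulo `2` is positive semidefinite. -/
theorem tsum_add_mul_sub_nonneg {G : Type*} [AddCommGroup G]
    (htor : ∀ g : G, g + g = 0 → g = 0) (h : G → ℝ) (hh : Summable h) :
    0 ≤ ∑' p : G × G, h (p.1 + p.2) * h (p.1 - p.2) := by
  let H : AddSubgroup G := (AddMonoidHom.id G + AddMonoidHom.id G).range
  let q : G → G ⧸ H := fun g => (g : G ⧸ H)
  have hq : ∀ a b : G, q (a + b) = q (a - b) := fun a b => by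
    refine QuotientAddGroup.eq.2 ⟨-b, ?_⟩
    simp only [AddMonoidHom.add_apply, AddMonoidHom.id_apply]
    abel
  let F : G × G → Σ w : G ⧸ H, {g // q g = w} × {g // q g = w} := fun p =>
    ⟨q (p.1 + p.2), ⟨p.1 + p.2, rfl⟩, ⟨p.1 - p.2, (hq p.1 p.2).symm⟩⟩
  let K : (Σ w : G ⧸ H, {g // q g = w} × {g // q g = w}) → ℝ := fun s => h s.2.1 * h s.2.2
  have hF : Function.Bijective F := by
    constructor
    · rintro ⟨a, b⟩ ⟨a', b'⟩ hab
      have h1 : a + b = a' + b' :=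
        congrArg (fun s : (Σ w : G ⧸ H, {g // q g = w} × {g // q g = w}) => (s.2.1 : G)) hab
      have h2 : a - b = a' - b' :=
        congrArg (fun s : (Σ w : G ⧸ H, {g // q g = w} × {g // q g = w}) => (s.2.2 : G)) hab
      have h3 : a = a' := by
        refine sub_eq_zero.1 (htor _ ?_)
        calc a - a' + (a - a') = (a + b) + (a - b) - ((a' + b') + (a' - b')) := by abel
          _ = 0 := by rw [h1, h2, sub_self]
      subst h3
      simpa using h1
    · rintro ⟨w, ⟨e, he⟩, ⟨d, hd⟩⟩
      obtain ⟨b, hb⟩ := QuotientAddGroup.eq.1 (hd.trans he.symm)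
      simp only [AddMonoidHom.add_apply, AddMonoidHom.id_apply] at hb
      have he' : e = d + b + b := by rw [add_assoc, hb]; abel
      subst he'
      subst he
      refine ⟨(d + b, b), ?_⟩
      simp only [F]
      congr
      exact add_sub_cancel_right d b
  have hinj : Function.Injective
      (fun s : (Σ w : G ⧸ H, {g // q g = w} × {g // q g = w}) => ((s.2.1 : G), (s.2.2 : G))) := by
    rintro ⟨w, ⟨e, he⟩, ⟨d, hd⟩⟩ ⟨w', ⟨e', he'⟩, ⟨d', hd'⟩⟩ hs
    simp only [Prod.mk.injEq] at hs
    obtain ⟨rfl, rfl⟩ := hs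
    subst he
    subst he'
    rfl
  have hK : Summable K :=
    (summable_mul_of_summable_norm hh.norm hh.norm).comp_injective hinj
  have hsum : ∑' p : G × G, h (p.1 + p.2) * h (p.1 - p.2) = ∑' s, K s :=
    (Equiv.ofBijective F hF).tsum_eq K
  rw [hsum, hK.tsum_sigma]
  refine tsum_nonneg fun w => ?_
  have hw : Summable fun g : {g // q g = w} => h g := hh.subtype _
  change 0 ≤ ∑' p : {g // q g = w} × {g // q g = w}, h p.1 * h p.2
  rw [← tsum_mul_tsum_of_summable_norm (f := fun g : {g // q g = w} => h g)
    (g := fun g : {g // q g = w} => h g) hw.norm hw.norm]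
  exact mul_self_nonneg _

section Gaussian

variable {E : Type*} [NormedAddCommGroup E] {G : Type*} [AddCommGroup G]

theorem norm_sq_le_two_mul_norm_add_sq (x y : E) : ‖y‖ ^ 2 ≤ 2 * ‖x + y‖ ^ 2 + 2 * ‖x‖ ^ 2 := by
  have h : ‖y‖ ≤ ‖x + y‖ + ‖x‖ := by
    simpa using norm_sub_le (x + y) x
  nlinarith [sq_nonneg (‖x + y‖ - ‖x‖), norm_nonneg y, norm_nonneg x, norm_nonneg (x + y)]

theorem summable_gaussian_shift (φ : G →+ E)
    (hs : ∀ c : ℝ, 0 < c → Summable fun g : G => Real.exp (-c * ‖φ g‖ ^ 2))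
    {c : ℝ} (hc : 0 < c) (x : E) : Summable fun g : G => Real.exp (-c * ‖x + φ g‖ ^ 2) := by
  refine Summable.of_nonneg_of_le (fun _ => (Real.exp_pos _).le) (fun g => ?_)
    ((hs (c / 2) (by positivity)).mul_left (Real.exp (c * ‖x‖ ^ 2)))
  rw [← Real.exp_add]
  refine Real.exp_le_exp.2 ?_
  nlinarith [norm_sq_le_two_mul_norm_add_sq x (φ g)]

theorem exists_tsum_gaussian_shift_le (φ : G →+ E)
    (hs : ∀ c : ℝ, 0 < c → Summable fun g : G => Real.exp (-c * ‖φ g‖ ^ 2))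
    {c : ℝ} (hc : 0 < c) : ∃ M : ℝ, ∀ x : E, ∑' g, Real.exp (-c * ‖x + φ g‖ ^ 2) ≤ M := by
  refine ⟨∑' g, Real.exp (c / 2) * Real.exp (-(c / 4) * ‖φ g‖ ^ 2), fun x => ?_⟩
  have hbdd : BddBelow (Set.range fun g : G => ‖x + φ g‖ ^ 2) :=
    ⟨0, by rintro _ ⟨g, rfl⟩; positivity⟩
  obtain ⟨g₀, hg₀⟩ := exists_lt_of_ciInf_lt
    (lt_add_one (⨅ g : G, ‖x + φ g‖ ^ 2))
  have hmin : ∀ g : G, ‖x + φ g₀‖ ^ 2 ≤ ‖x + φ g₀ + φ g‖ ^ 2 + 1 := fun g => by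
    have := ciInf_le hbdd (g₀ + g)
    rw [map_add, ← add_assoc] at this
    linarith
  have htrans : ∑' g, Real.exp (-c * ‖x + φ g‖ ^ 2) =
      ∑' g, Real.exp (-c * ‖x + φ g₀ + φ g‖ ^ 2) := by
    rw [← (Equiv.addLeft g₀).tsum_eq fun g => Real.exp (-c * ‖x + φ g‖ ^ 2)]
    simp [add_assoc]
  rw [htrans]
  refine (summable_gaussian_shift φ hs hc _).tsum_le_tsum (fun g => ?_)
    ((hs (c / 4) (by positivity)).mul_left _)
  rw [← Real.exp_add]
  refine Real.exp_le_exp.2 ?_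
  have h1 := norm_sq_le_two_mul_norm_add_sq (x + φ g₀) (φ g)
  have h2 := hmin g
  nlinarith

variable [InnerProductSpace ℝ E]

/-- A quadratic inequality between the Gaussian sums over the cosets of `x`, `2x` and `0`. -/
theorem two_mul_tsum_gaussian_shift_sq_le (htor : ∀ g : G, g + g = 0 → g = 0) (φ : G →+ E)
    (hs : ∀ c : ℝ, 0 < c → Summable fun g : G => Real.exp (-c * ‖φ g‖ ^ 2))
    {c : ℝ} (hc : 0 < c) (x : E) :
    2 * (∑' g, Real.exp (-c * ‖x + φ g‖ ^ 2)) ^ 2 ≤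
      (∑' g, Real.exp (-c * ‖x + x + φ g‖ ^ 2)) * (∑' g, Real.exp (-c * ‖φ g‖ ^ 2)) +
        (∑' g, Real.exp (-c * ‖φ g‖ ^ 2)) ^ 2 := by
  have hc2 : 0 < c / 2 := by positivity
  have key := tsum_add_mul_sub_nonneg htor
    (fun g => Real.exp (-(c / 2) * ‖x + x + φ g‖ ^ 2) - Real.exp (-(c / 2) * ‖φ g‖ ^ 2))
    ((summable_gaussian_shift φ hs hc2 (x + x)).sub (hs _ hc2))
  have hexp : ∀ u v a b : E, ‖u‖ ^ 2 + ‖v‖ ^ 2 = 2 * (‖a‖ ^ 2 + ‖b‖ ^ 2) →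
      Real.exp (-(c / 2) * ‖u‖ ^ 2) * Real.exp (-(c / 2) * ‖v‖ ^ 2) =
        Real.exp (-c * ‖a‖ ^ 2) * Real.exp (-c * ‖b‖ ^ 2) := fun u v a b h => by
    rw [← Real.exp_add, ← Real.exp_add]
    congr 1
    linear_combination (-(c / 2)) * h
  have hpar : ∀ a b : E, ‖a + b‖ ^ 2 + ‖a - b‖ ^ 2 = 2 * (‖a‖ ^ 2 + ‖b‖ ^ 2) := fun a b => by
    simpa [sq] using parallelogram_law_with_norm ℝ a b
  have hterm : ∀ p : G × G,
      (Real.exp (-(c / 2) * ‖x + x + φ (p.1 + p.2)‖ ^ 2) -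
          Real.exp (-(c / 2) * ‖φ (p.1 + p.2)‖ ^ 2)) *
        (Real.exp (-(c / 2) * ‖x + x + φ (p.1 - p.2)‖ ^ 2) -
          Real.exp (-(c / 2) * ‖φ (p.1 - p.2)‖ ^ 2)) =
      Real.exp (-c * ‖x + x + φ p.1‖ ^ 2) * Real.exp (-c * ‖φ p.2‖ ^ 2) -
        Real.exp (-c * ‖x + φ p.1‖ ^ 2) * Real.exp (-c * ‖x + φ p.2‖ ^ 2) -
        Real.exp (-c * ‖x + φ p.1‖ ^ 2) * Real.exp (-c * ‖x + φ (-p.2)‖ ^ 2) +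
        Real.exp (-c * ‖φ p.1‖ ^ 2) * Real.exp (-c * ‖φ p.2‖ ^ 2) := by
    rintro ⟨a, b⟩
    simp only [map_add, map_sub, map_neg]
    rw [sub_mul, mul_sub, mul_sub,
      hexp (x + x + (φ a + φ b)) (x + x + (φ a - φ b)) (x + x + φ a) (φ b)
        (by rw [← hpar]; congr 3 <;> abel),
      hexp (x + x + (φ a + φ b)) (φ a - φ b) (x + φ a) (x + φ b)
        (by rw [← hpar]; congr 3 <;> abel),
      hexp (φ a + φ b) (x + x + (φ a - φ b)) (x + φ a) (x + -φ b)
        (by rw [← hpar, add_comm]; congr 3 <;> abel_nf),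
      hexp (φ a + φ b) (φ a - φ b) (φ a) (φ b) (hpar _ _)]
    ring
  have hx := summable_gaussian_shift φ hs hc x
  have hxx := summable_gaussian_shift φ hs hc (x + x)
  have h0 := hs c hc
  have hxneg : Summable fun g : G => Real.exp (-c * ‖x + φ (-g)‖ ^ 2) :=
    (Equiv.neg G).summable_iff.2 hx
  have hxneg_tsum : ∑' g : G, Real.exp (-c * ‖x + φ (-g)‖ ^ 2) =
      ∑' g : G, Real.exp (-c * ‖x + φ g‖ ^ 2) :=
    (Equiv.neg G).tsum_eq fun g => Real.exp (-c * ‖x + φ g‖ ^ 2)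
  have hmul : ∀ u v : G → ℝ, Summable u → Summable v →
      HasSum (fun p : G × G => u p.1 * v p.2) ((∑' g, u g) * ∑' g, v g) := fun u v hu hv => by
    rw [tsum_mul_tsum_of_summable_norm hu.norm hv.norm]
    exact (summable_mul_of_summable_norm hu.norm hv.norm).hasSum
  have hall := (((hmul _ _ hxx h0).sub (hmul _ _ hx hx)).sub (hmul _ _ hx hxneg)).add
    (hmul _ _ h0 h0)
  rw [tsum_congr hterm, hall.tsum_eq, hxneg_tsum] at key
  linarith

/-- Among all translates of a lattice, the Gaussian mass is largest for the lattice itself. -/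
theorem tsum_gaussian_shift_le (htor : ∀ g : G, g + g = 0 → g = 0) (φ : G →+ E)
    (hs : ∀ c : ℝ, 0 < c → Summable fun g : G => Real.exp (-c * ‖φ g‖ ^ 2))
    {c : ℝ} (hc : 0 < c) (x : E) :
    ∑' g, Real.exp (-c * ‖x + φ g‖ ^ 2) ≤ ∑' g, Real.exp (-c * ‖φ g‖ ^ 2) := by
  obtain ⟨M, hM⟩ := exists_tsum_gaussian_shift_le φ hs hc
  have hbdd : BddAbove (Set.range fun y : E => ∑' g, Real.exp (-c * ‖y + φ g‖ ^ 2)) :=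
    ⟨M, by rintro _ ⟨y, rfl⟩; exact hM y⟩
  set S := ⨆ y : E, ∑' g, Real.exp (-c * ‖y + φ g‖ ^ 2) with hS
  set F := ∑' g, Real.exp (-c * ‖φ g‖ ^ 2) with hF
  have hFpos : 0 < F := (hs c hc).tsum_pos (fun _ => (Real.exp_pos _).le) 0 (Real.exp_pos _)
  refine (le_ciSup hbdd x).trans ?_
  by_contra! hlt
  have hle : ∀ y : E, ∑' g, Real.exp (-c * ‖y + φ g‖ ^ 2) ≤ √((S * F + F ^ 2) / 2) := fun y => by
    refine Real.le_sqrt_of_sq_le ?_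
    have h1 := two_mul_tsum_gaussian_shift_sq_le htor φ hs hc y
    have h2 := mul_le_mul_of_nonneg_right (le_ciSup hbdd (y + y)) hFpos.le
    simp only [← hF] at h1
    simp only [← hS] at h2
    linarith
  have hSle : S ≤ √((S * F + F ^ 2) / 2) := ciSup_le hle
  have hSsq : S ^ 2 ≤ (S * F + F ^ 2) / 2 := by
    have hSpos : 0 < S := hFpos.trans hlt
    exact (Real.le_sqrt' hSpos).1 hSle
  nlinarith

theorem hasSum_pow_natAbs {q : ℝ} (hq0 : 0 ≤ q) (hq1 : q < 1) :
    HasSum (fun j : ℤ => q ^ j.natAbs) ((1 + q) / (1 - q)) := by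
  have h1 := hasSum_geometric_of_lt_one hq0 hq1
  have h : HasSum (fun j : ℤ => q ^ j.natAbs) ((1 - q)⁻¹ + q * (1 - q)⁻¹) := by
    refine HasSum.of_nat_of_neg_add_one (by simpa using h1) ?_
    refine (h1.mul_left q).congr_fun fun k => ?_
    rw [← pow_succ', Int.natAbs_neg]
    rfl
  convert h using 1
  ring

theorem exp_neg_mul_sq_le_pow_natAbs {t : ℝ} (ht : 0 ≤ t) (j : ℤ) :
    Real.exp (-t * (j : ℝ) ^ 2) ≤ Real.exp (-t) ^ j.natAbs := by
  rw [← Real.exp_nat_mul]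
  refine Real.exp_le_exp.2 ?_
  have h : (j.natAbs : ℝ) ≤ (j : ℝ) ^ 2 := by
    rw [Nat.cast_natAbs]
    exact_mod_cast Int.natAbs_le_self_sq j
  nlinarith

theorem summable_prod_apply {ι : Type*} {f : ι → ℝ} (hf0 : ∀ i, 0 ≤ f i) (hf : Summable f)
    (n : ℕ) :
    Summable fun z : Fin n → ι => ∏ i, f (z i) := by
  induction n with
  | zero => exact Summable.of_finite
  | succ n ih =>
    rw [← (Fin.consEquiv fun _ => ι).summable_iff]
    have h := Summable.mul_of_nonneg hf ih hf0 fun z => Finset.prod_nonneg fun i _ => hf0 (z i)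
    refine h.congr fun p => ?_
    simp [Fin.prod_univ_succ, Fin.consEquiv]

theorem summable_gaussian_of_dual {n : ℕ} (φ : (Fin n → ℤ) →+ E) (b : Fin n → E)
    (hb : ∀ z i, inner ℝ (b i) (φ z) = (z i : ℝ)) {c : ℝ} (hc : 0 < c) :
    Summable fun z : Fin n → ℤ => Real.exp (-c * ‖φ z‖ ^ 2) := by
  set K : ℝ := ∑ i, ‖b i‖ ^ 2 with hK
  have hK0 : 0 ≤ K := Finset.sum_nonneg fun _ _ => sq_nonneg _
  set a : ℝ := c / (K + 1) with ha
  have ha0 : 0 < a := by positivity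
  have hZ : Summable fun j : ℤ => Real.exp (-a * (j : ℝ) ^ 2) :=
    Summable.of_nonneg_of_le (fun _ => (Real.exp_pos _).le)
      (exp_neg_mul_sq_le_pow_natAbs ha0.le)
      (hasSum_pow_natAbs (Real.exp_pos _).le (by simpa using ha0)).summable
  refine Summable.of_nonneg_of_le (fun _ => (Real.exp_pos _).le) (fun z => ?_)
    (summable_prod_apply (fun _ => (Real.exp_pos _).le) hZ n)
  rw [← Real.exp_sum, ← Finset.mul_sum]
  refine Real.exp_le_exp.2 ?_
  have h1 : ∑ i, (z i : ℝ) ^ 2 ≤ K * ‖φ z‖ ^ 2 := by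
    rw [hK, Finset.sum_mul]
    refine Finset.sum_le_sum fun i _ => ?_
    rw [← hb z i, ← mul_pow, ← sq_abs]
    exact pow_le_pow_left₀ (abs_nonneg _) (abs_real_inner_le_norm _ _) 2
  have h2 : a * ∑ i, (z i : ℝ) ^ 2 ≤ c * ‖φ z‖ ^ 2 := by
    rw [ha, div_mul_eq_mul_div, div_le_iff₀ (by positivity), mul_assoc]
    refine mul_le_mul_of_nonneg_left ?_ hc.le
    nlinarith [sq_nonneg ‖φ z‖]
  linarith

theorem tsum_gaussian_slice_le (htor : ∀ g : G, g + g = 0 → g = 0) (φ : G →+ E)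
    (hs : ∀ c : ℝ, 0 < c → Summable fun g : G => Real.exp (-c * ‖φ g‖ ^ 2))
    (l : G →+ ℤ) {V : E} (hV : V ≠ 0) (hl : ∀ g, inner ℝ V (φ g) = (l g : ℝ))
    {c r : ℝ} (hc : 0 < c) (hr : ‖V‖ ≤ r) (j : ℤ) :
    ∑' g : {g // l g = j}, Real.exp (-c * ‖φ g‖ ^ 2) ≤
      Real.exp (-(c / r ^ 2) * (j : ℝ) ^ 2) * ∑' g : l.ker, Real.exp (-c * ‖φ g‖ ^ 2) := by
  rcases isEmpty_or_nonempty {g // l g = j} with hemp | ⟨⟨g₀, hg₀⟩⟩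
  · rw [tsum_empty]
    exact mul_nonneg (Real.exp_pos _).le (tsum_nonneg fun _ => (Real.exp_pos _).le)
  have hVpos : 0 < ‖V‖ := norm_pos_iff.2 hV
  let e : l.ker ≃ {g // l g = j} :=
    { toFun := fun g => ⟨g₀ + g, by rw [map_add, hg₀, l.mem_ker.1 g.2, add_zero]⟩
      invFun := fun g => ⟨-g₀ + g, by rw [l.mem_ker, map_add, map_neg, hg₀, g.2, neg_add_cancel]⟩
      left_inv := fun g => by simp
      right_inv := fun g => by simp }
  set p : E := φ g₀ - ((j : ℝ) / ‖V‖ ^ 2) • V with hp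
  have hnorm : ∀ g : l.ker, ‖φ (g₀ + g)‖ ^ 2 = ‖p + φ g‖ ^ 2 + (j : ℝ) ^ 2 / ‖V‖ ^ 2 := fun g => by
    have hperp : inner ℝ (p + φ g) (((j : ℝ) / ‖V‖ ^ 2) • V) = 0 := by
      rw [real_inner_comm, inner_smul_left, inner_add_right, hp, inner_sub_right,
        inner_smul_right, hl, hl, real_inner_self_eq_norm_sq, hg₀, l.mem_ker.1 g.2,
        div_mul_cancel₀ _ (by positivity)]
      simp
    have hdec : φ (g₀ + g) = p + φ g + ((j : ℝ) / ‖V‖ ^ 2) • V := by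
      rw [map_add, hp]
      abel
    rw [hdec, norm_add_sq_real, hperp, norm_smul, Real.norm_eq_abs, mul_pow, sq_abs]
    field_simp
    ring
  have hsker : ∀ c : ℝ, 0 < c →
      Summable fun g : l.ker => Real.exp (-c * ‖(φ.comp l.ker.subtype) g‖ ^ 2) :=
    fun c hc => (hs c hc).subtype (l.ker : Set G)
  have hshift := tsum_gaussian_shift_le (fun g : l.ker => fun h => Subtype.ext
    (htor g (congrArg Subtype.val h))) (φ.comp l.ker.subtype) hsker hc p
  calc ∑' g : {g // l g = j}, Real.exp (-c * ‖φ g‖ ^ 2)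
      = ∑' g : l.ker, Real.exp (-c * ‖φ (g₀ + g)‖ ^ 2) :=
        (e.tsum_eq fun g : {g // l g = j} => Real.exp (-c * ‖φ g‖ ^ 2)).symm
    _ = Real.exp (-c * ((j : ℝ) ^ 2 / ‖V‖ ^ 2)) *
          ∑' g : l.ker, Real.exp (-c * ‖p + φ g‖ ^ 2) := by
        rw [← tsum_mul_left]
        refine tsum_congr fun g => ?_
        rw [hnorm, ← Real.exp_add]
        congr 1
        ring
    _ ≤ _ := by
        refine mul_le_mul (Real.exp_le_exp.2 ?_) hshift
          (tsum_nonneg fun _ => (Real.exp_pos _).le) (Real.exp_pos _).le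
        have h : (j : ℝ) ^ 2 / r ^ 2 ≤ (j : ℝ) ^ 2 / ‖V‖ ^ 2 := by gcongr
        have h2 := mul_le_mul_of_nonneg_left h hc.le
        calc -c * ((j : ℝ) ^ 2 / ‖V‖ ^ 2) ≤ -(c * ((j : ℝ) ^ 2 / r ^ 2)) := by linarith
          _ = _ := by ring

/-- The Gaussian mass of the part of a lattice off the hyperplane orthogonal to a dual vector. -/
theorem tsum_gaussian_off_hyperplane_le (htor : ∀ g : G, g + g = 0 → g = 0) (φ : G →+ E)
    (hs : ∀ c : ℝ, 0 < c → Summable fun g : G => Real.exp (-c * ‖φ g‖ ^ 2))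
    (l : G →+ ℤ) {V : E} (hV : V ≠ 0) (hl : ∀ g, inner ℝ V (φ g) = (l g : ℝ))
    {c r : ℝ} (hc : 0 < c) (hr : ‖V‖ ≤ r) :
    ∑' g, (l.ker : Set G)ᶜ.indicator (fun g => Real.exp (-c * ‖φ g‖ ^ 2)) g ≤
      2 * Real.exp (-(c / r ^ 2)) * ∑' g, Real.exp (-c * ‖φ g‖ ^ 2) := by
  have hr0 : 0 < r := (norm_pos_iff.2 hV).trans_le hr
  have ht : 0 < c / r ^ 2 := by positivity
  set q := Real.exp (-(c / r ^ 2)) with hq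
  have hq0 : 0 < q := Real.exp_pos _
  have hq1 : q < 1 := by simpa [hq] using ht
  set W := ∑' g, Real.exp (-c * ‖φ g‖ ^ 2) with hW
  set W₀ := ∑' g : l.ker, Real.exp (-c * ‖φ g‖ ^ 2) with hW₀
  have hW₀0 : 0 ≤ W₀ := tsum_nonneg fun _ => (Real.exp_pos _).le
  have hWle : W ≤ (1 + q) / (1 - q) * W₀ := by
    have hsig : Summable fun s : Σ j : ℤ, {g // l g = j} => Real.exp (-c * ‖φ s.2‖ ^ 2) :=
      (Equiv.sigmaFiberEquiv l).summable_iff.2 (hs c hc)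
    have hWsig : W = ∑' j : ℤ, ∑' g : {g // l g = j}, Real.exp (-c * ‖φ g‖ ^ 2) := by
      rw [← hsig.tsum_sigma]
      exact ((Equiv.sigmaFiberEquiv l).tsum_eq fun g => Real.exp (-c * ‖φ g‖ ^ 2)).symm
    have hgeo := (hasSum_pow_natAbs hq0.le hq1).mul_right W₀
    rw [hWsig, ← hgeo.tsum_eq]
    refine hsig.sigma.tsum_le_tsum (fun j => ?_) hgeo.summable
    exact (tsum_gaussian_slice_le htor φ hs l hV hl hc hr j).trans
      (mul_le_mul_of_nonneg_right (exp_neg_mul_sq_le_pow_natAbs ht.le j) hW₀0)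
  have hsplit : W₀ + ∑' g, (l.ker : Set G)ᶜ.indicator
      (fun g => Real.exp (-c * ‖φ g‖ ^ 2)) g = W := by
    rw [← tsum_subtype, hW]
    exact (hs c hc).tsum_subtype_add_tsum_subtype_compl (l.ker : Set G)
  have h1 : W * (1 - q) ≤ (1 + q) * W₀ := by
    rwa [div_mul_eq_mul_div, le_div_iff₀ (by linarith)] at hWle
  set A := ∑' g, (l.ker : Set G)ᶜ.indicator (fun g => Real.exp (-c * ‖φ g‖ ^ 2)) g
  have hA0 : 0 ≤ A := tsum_nonneg fun g => Set.indicator_nonneg (fun _ _ => (Real.exp_pos _).le) g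
  nlinarith

theorem tsum_gaussian_ne_zero_le {n : ℕ} (htor : ∀ g : G, g + g = 0 → g = 0) (φ : G →+ E)
    (hs : ∀ c : ℝ, 0 < c → Summable fun g : G => Real.exp (-c * ‖φ g‖ ^ 2))
    (l : Fin n → G →+ ℤ) {V : Fin n → E} (hV : ∀ i, V i ≠ 0)
    (hl : ∀ i g, inner ℝ (V i) (φ g) = (l i g : ℝ)) (hl0 : ∀ g, (∀ i, l i g = 0) → g = 0)
    {c r : ℝ} (hc : 0 < c) (hr : ∀ i, ‖V i‖ ≤ r) :
    ∑' g : {g : G // g ≠ 0}, Real.exp (-c * ‖φ g‖ ^ 2) ≤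
      2 * n * Real.exp (-(c / r ^ 2)) *
        (1 + ∑' g : {g : G // g ≠ 0}, Real.exp (-c * ‖φ g‖ ^ 2)) := by
  set w : G → ℝ := fun g => Real.exp (-c * ‖φ g‖ ^ 2) with hw
  have hw0 : ∀ g, 0 ≤ w g := fun g => (Real.exp_pos _).le
  have hws : Summable w := hs c hc
  have hsplit : 1 + ∑' g : {g : G // g ≠ 0}, w g = ∑' g, w g := by
    rw [← hws.tsum_subtype_add_tsum_subtype_compl {0}, tsum_singleton]
    congr 1
    simp [hw]
  have hind : ∀ i, Summable ((((l i).ker : Set G)ᶜ).indicator w) := fun i => hws.indicator _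
  calc ∑' g : {g : G // g ≠ 0}, w g = ∑' g, ({g : G | g ≠ 0}).indicator w g :=
        tsum_subtype {g : G | g ≠ 0} w
    _ ≤ ∑' g, ∑ i, (((l i).ker : Set G)ᶜ).indicator w g := by
        refine (hws.indicator _).tsum_le_tsum (fun g => ?_) (summable_sum fun i _ => hind i)
        have hnn : ∀ i, 0 ≤ (((l i).ker : Set G)ᶜ).indicator w g := fun i =>
          Set.indicator_nonneg (fun g _ => hw0 g) g
        by_cases hg : g = 0
        · rw [Set.indicator_of_notMem (by simp [hg])]
          exact Finset.sum_nonneg fun i _ => hnn i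
        · obtain ⟨i, hi⟩ : ∃ i, l i g ≠ 0 := by
            by_contra! h
            exact hg (hl0 g h)
          rw [Set.indicator_of_mem (show g ∈ {g : G | g ≠ 0} from hg)]
          refine le_trans ?_ (Finset.single_le_sum (fun i _ => hnn i) (Finset.mem_univ i))
          rw [Set.indicator_of_mem (by simpa using hi)]
    _ = ∑ i, ∑' g, (((l i).ker : Set G)ᶜ).indicator w g :=
        Summable.tsum_finsetSum fun i _ => hind i
    _ ≤ ∑ _i : Fin n, 2 * Real.exp (-(c / r ^ 2)) * ∑' g, w g :=
        Finset.sum_le_sum fun i _ =>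
          tsum_gaussian_off_hyperplane_le htor φ hs (l i) (hV i) (hl i) hc (hr i)
    _ = _ := by
        rw [hsplit, Finset.sum_const, Finset.card_univ, Fintype.card_fin, nsmul_eq_mul]
        ring

end Gaussian

open Matrix in
theorem isUnit_det_transpose_mul_self {m n : ℕ} (B : Matrix (Fin m) (Fin n) ℝ)
    (hB : LinearIndependent ℝ (fun j : Fin n => fun i : Fin m => B i j)) :
    IsUnit (Bᵀ * B).det := by
  rw [← Matrix.isUnit_iff_isUnit_det, ← Matrix.mulVec_injective_iff_isUnit]
  have hker : LinearMap.ker B.mulVecLin = ⊥ :=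
    LinearMap.ker_eq_bot.2 (Matrix.mulVec_injective_iff.2 hB)
  rw [← Matrix.ker_mulVecLin_transpose_mul_self] at hker
  exact LinearMap.ker_eq_bot.1 hker

/-- Lemma 3.4, from MR Lemma 3.3. Let `L ⊂ ℝ^m` be a rank-`n` lattice,
given as `L = Bℤ^n` for `B ∈ ℝ^{m×n}` with linearly independent columns; its dual lattice
(inside `span(L)`) is then generated by the columns of `B(BᵀB)⁻¹`.  Let `ε > 0` and suppose
`L` contains `n` linearly independent vectors of norm at most `λ` (i.e. `λ ≥ λ_n(L)`).  Then
with `s = λ·√(ln(2n(1+1/ε))/π)` one has `ρ_{1/s}(L* ∖ {0}) ≤ ε`, i.e.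
`η_ε(L) ≤ λ_n(L)·√(ln(2n(1+1/ε))/π)`. -/
theorem statement14 {m n : ℕ} (hn : 1 ≤ n)
    (B : Matrix (Fin m) (Fin n) ℝ)
    (hB : LinearIndependent ℝ (fun j : Fin n => fun i : Fin m => B i j))
    (ε : ℝ) (hε : 0 < ε) (lam : ℝ) (hlam : 0 < lam)
    (v : Fin n → Fin n → ℤ)
    (hv : LinearIndependent ℝ (fun i : Fin n => B *ᵥ intCast' (v i)))
    (hvnorm : ∀ i : Fin n, enorm' (B *ᵥ intCast' (v i)) ≤ lam) :
    (∑' z : {z : Fin n → ℤ // z ≠ 0},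
        Real.exp (-Real.pi * (lam * Real.sqrt (Real.log (2 * n * (1 + 1 / ε)) / Real.pi)) ^ 2 *
          ∑ i, (((B * (Bᵀ * B)⁻¹) *ᵥ intCast' z.1) i) ^ 2)) ≤ ε := by
  have hdet := isUnit_det_transpose_mul_self B hB
  set D := B * (Bᵀ * B)⁻¹ with hD
  have hBD : Bᵀ * D = 1 := by rw [hD, ← Matrix.mul_assoc, Matrix.mul_nonsing_inv _ hdet]
  let φ : (Fin n → ℤ) →+ EuclideanSpace ℝ (Fin m) :=
    AddMonoidHom.mk' (fun z => WithLp.toLp 2 (D *ᵥ intCast' z)) fun z w => by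
      have h : intCast' (z + w) = intCast' z + intCast' w := by
        ext i
        simp [intCast']
      rw [h, Matrix.mulVec_add, WithLp.toLp_add]
  have hinner : ∀ (x : Fin n → ℝ) (z : Fin n → ℤ),
      inner ℝ (WithLp.toLp 2 (B *ᵥ x) : EuclideanSpace ℝ (Fin m)) (φ z) = x ⬝ᵥ intCast' z := by
    intro x z
    change inner ℝ (WithLp.toLp 2 (B *ᵥ x)) (WithLp.toLp 2 (D *ᵥ intCast' z)) = _
    rw [EuclideanSpace.inner_toLp_toLp, star_trivial, dotProduct_comm, ← Matrix.vecMul_transpose,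
      ← Matrix.dotProduct_mulVec, Matrix.mulVec_mulVec, hBD, Matrix.one_mulVec]
  let b : Fin n → EuclideanSpace ℝ (Fin m) := fun i => WithLp.toLp 2 (B *ᵥ Pi.single i 1)
  have hs : ∀ c : ℝ, 0 < c → Summable fun z : Fin n → ℤ => Real.exp (-c * ‖φ z‖ ^ 2) :=
    fun c hc => summable_gaussian_of_dual φ b (fun z i => by
      rw [hinner, single_one_dotProduct]
      rfl) hc
  let l : Fin n → (Fin n → ℤ) →+ ℤ := fun i =>
    AddMonoidHom.mk' (fun z => v i ⬝ᵥ z) fun z w => dotProduct_add _ _ _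
  have hl : ∀ i z, inner ℝ (WithLp.toLp 2 (B *ᵥ intCast' (v i)) : EuclideanSpace ℝ (Fin m)) (φ z) =
      (l i z : ℝ) := by
    intro i z
    rw [hinner]
    simp [l, dotProduct, intCast']
  have hvlin : LinearIndependent ℝ fun i => intCast' (v i) :=
    LinearIndependent.of_comp B.mulVecLin hv
  have hl0 : ∀ z, (∀ i, l i z = 0) → z = 0 := by
    intro z hz
    have hunit : IsUnit (Matrix.of fun i => intCast' (v i)) :=
      Matrix.linearIndependent_rows_iff_isUnit.1 hvlin
    have h0 : intCast' z = 0 := by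
      refine Matrix.mulVec_injective_iff_isUnit.2 hunit ?_
      rw [Matrix.mulVec_zero]
      ext i
      have h := hl i z
      rw [hinner, hz i, Int.cast_zero] at h
      exact h
    ext i
    have h := congrFun h0 i
    simpa [intCast'] using h
  have hV : ∀ i, (WithLp.toLp 2 (B *ᵥ intCast' (v i)) : EuclideanSpace ℝ (Fin m)) ≠ 0 :=
    fun i h => hv.ne_zero i (congrArg WithLp.ofLp h)
  have hnorm : ∀ i, ‖(WithLp.toLp 2 (B *ᵥ intCast' (v i)) : EuclideanSpace ℝ (Fin m))‖ ≤ lam := by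
    intro i
    simpa [EuclideanSpace.norm_eq, enorm'] using hvnorm i
  have hn' : (1 : ℝ) ≤ n := by exact_mod_cast hn
  set X : ℝ := 2 * n * (1 + 1 / ε) with hX
  have hX1 : 1 < X := by
    have : 0 < 1 / ε := by positivity
    nlinarith
  have hlog : 0 < Real.log X := Real.log_pos hX1
  have hc : Real.pi * (lam * √(Real.log X / Real.pi)) ^ 2 = lam ^ 2 * Real.log X := by
    rw [mul_pow, Real.sq_sqrt (div_nonneg hlog.le Real.pi_pos.le)]
    field_simp
  have key := tsum_gaussian_ne_zero_le (c := lam ^ 2 * Real.log X) (fun z hz => by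
    ext i
    have h := congrFun hz i
    simp only [Pi.add_apply, Pi.zero_apply] at h ⊢
    omega) φ hs l hV hl hl0 (by positivity) hnorm
  have hterm : ∀ z : {z : Fin n → ℤ // z ≠ 0},
      Real.exp (-Real.pi * (lam * √(Real.log X / Real.pi)) ^ 2 *
        ∑ i, ((D *ᵥ intCast' z.1) i) ^ 2) =
      Real.exp (-(lam ^ 2 * Real.log X) * ‖φ z‖ ^ 2) := by
    intro z
    rw [neg_mul, hc, EuclideanSpace.real_norm_sq_eq]
    rfl
  rw [tsum_congr hterm]
  set S := ∑' z : {z : Fin n → ℤ // z ≠ 0}, Real.exp (-(lam ^ 2 * Real.log X) * ‖φ z‖ ^ 2)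
  have hq : 2 * n * Real.exp (-(lam ^ 2 * Real.log X / lam ^ 2)) = ε / (1 + ε) := by
    rw [mul_div_cancel_left₀ _ (by positivity), Real.exp_neg, Real.exp_log (by positivity), hX]
    field_simp
    ring
  rw [hq, div_mul_eq_mul_div, le_div_iff₀ (by positivity)] at key
  linarith
end

section
/- For every integer n ≥ 1 and every ε > 0, setting s = √(ln(2n(1 + 1/ε))/π), one has Σ_{x ∈ ℤ^n ∖ {0}} exp(−π s² ‖x‖²) ≤ ε; that is, the smoothing parameter of ℤ^n satisfies η_ε(ℤ^n) ≤ √(ln(2n(1 + 1/ε))/π). -/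
open scoped BigOperators Matrix
attribute [local instance] Classical.propDecidable

/-- A finite piece of the one-dimensional theta series is bounded by a two-sided geometric series. -/
theorem sum_pow_natAbs_sq_le {q : ℝ} (h0 : 0 ≤ q) (h1 : q < 1) (T : Finset ℤ) :
    ∑ k ∈ T, q ^ (k.natAbs ^ 2) ≤ (1 + q) / (1 - q) := by
  have hpos : HasSum (fun m : ℕ => q ^ (m : ℤ).natAbs) (1 - q)⁻¹ := by
    simpa using hasSum_geometric_of_lt_one h0 h1
  have hneg : HasSum (fun m : ℕ => q ^ (-((m : ℤ) + 1)).natAbs) (q * (1 - q)⁻¹) := by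
    have heq (m : ℕ) : q ^ (-((m : ℤ) + 1)).natAbs = q * q ^ m := by
      rw [show (-((m : ℤ) + 1)).natAbs = m + 1 by omega, pow_succ']
    simpa only [heq] using (hasSum_geometric_of_lt_one h0 h1).mul_left q
  have hsum : HasSum (fun k : ℤ => q ^ k.natAbs) ((1 - q)⁻¹ + q * (1 - q)⁻¹) :=
    HasSum.of_nat_of_neg_add_one (f := fun k : ℤ => q ^ k.natAbs) hpos hneg
  calc ∑ k ∈ T, q ^ (k.natAbs ^ 2) ≤ ∑ k ∈ T, q ^ k.natAbs :=
        Finset.sum_le_sum fun k _ =>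
          pow_le_pow_of_le_one h0 h1.le (Nat.le_self_pow two_ne_zero _)
    _ ≤ (1 - q)⁻¹ + q * (1 - q)⁻¹ :=
        sum_le_hasSum T (fun k _ => by positivity) hsum
    _ = (1 + q) / (1 - q) := by rw [div_eq_mul_inv]; ring

/-- Finite sums of `∏ i, q ^ (x i)²` over nonzero integer vectors. -/
theorem sum_prod_pow_natAbs_sq_le {n : ℕ} {q : ℝ} (h0 : 0 ≤ q) (h1 : q < 1)
    (s : Finset {x : Fin n → ℤ // x ≠ 0}) :
    ∑ x ∈ s, ∏ i, q ^ ((x.1 i).natAbs ^ 2) ≤ ((1 + q) / (1 - q)) ^ n - 1 := by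
  set f : (Fin n → ℤ) → ℝ := fun x => ∏ i, q ^ ((x i).natAbs ^ 2) with hf
  have hf0 : ∀ x, 0 ≤ f x := fun x => Finset.prod_nonneg fun i _ => by positivity
  set t : Finset (Fin n → ℤ) := s.map (Function.Embedding.subtype _) with ht
  have hzero : (0 : Fin n → ℤ) ∉ t := by simp [ht]
  set T : Fin n → Finset ℤ := fun i => (insert 0 t).image fun x => x i with hT
  have hsub : insert 0 t ⊆ Fintype.piFinset T := fun x hx =>
    Fintype.mem_piFinset.2 fun i => Finset.mem_image_of_mem (fun y : Fin n → ℤ => y i) hx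
  have hbound : ∑ x ∈ insert 0 t, f x ≤ ((1 + q) / (1 - q)) ^ n :=
    calc ∑ x ∈ insert 0 t, f x ≤ ∑ x ∈ Fintype.piFinset T, f x :=
          Finset.sum_le_sum_of_subset_of_nonneg hsub fun x _ _ => hf0 x
      _ = ∏ i, ∑ k ∈ T i, q ^ (k.natAbs ^ 2) :=
          (Finset.prod_univ_sum T fun _ k => q ^ (k.natAbs ^ 2)).symm
      _ ≤ ∏ _i : Fin n, (1 + q) / (1 - q) :=
          Finset.prod_le_prod (fun i _ => Finset.sum_nonneg fun k _ => by positivity)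
            fun i _ => sum_pow_natAbs_sq_le h0 h1 (T i)
      _ = ((1 + q) / (1 - q)) ^ n := by rw [Finset.prod_const, Finset.card_univ, Fintype.card_fin]
  rw [Finset.sum_insert hzero, show f 0 = 1 by simp [hf], ht, Finset.sum_map] at hbound
  simp only [Function.Embedding.subtype_apply] at hbound
  linarith

/-- A consequence of Bernoulli's inequality. -/
theorem div_pow_le_inv_one_sub {n : ℕ} {q : ℝ} (h0 : 0 ≤ q) (h1 : q < 1)
    (hq : 2 * n * q < 1) : ((1 + q) / (1 - q)) ^ n ≤ (1 - 2 * n * q)⁻¹ := by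
  have hle : 2 * q / (1 + q) ≤ 2 * q := div_le_self (by positivity) (by linarith)
  have hbern := one_add_mul_le_pow (a := -(2 * q / (1 + q))) (by linarith) n
  have heq : 1 + -(2 * q / (1 + q)) = ((1 + q) / (1 - q))⁻¹ := by
    rw [inv_div]; field_simp; ring
  rw [heq, inv_pow] at hbern
  have hn : (n : ℝ) * (2 * q / (1 + q)) ≤ n * (2 * q) := by gcongr
  have h : 1 - 2 * n * q ≤ (((1 + q) / (1 - q)) ^ n)⁻¹ := by linarith
  exact le_inv_of_le_inv₀ (by linarith) h

/-- second part of Lemma 3.4: for every `n ≥ 1` and `ε > 0`, with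
`s = √(ln(2n(1+1/ε))/π)` one has `ρ_{1/s}(ℤ^n ∖ {0}) ≤ ε`, i.e. (since `ℤ^n` is self-dual)
`η_ε(ℤ^n) ≤ √(ln(2n(1+1/ε))/π)`. -/
theorem statement15 {n : ℕ} (hn : 1 ≤ n) (ε : ℝ) (hε : 0 < ε) :
    (∑' x : {x : Fin n → ℤ // x ≠ 0},
        Real.exp (-Real.pi * (Real.sqrt (Real.log (2 * n * (1 + 1 / ε)) / Real.pi)) ^ 2 *
          ∑ i, ((x.1 i : ℝ)) ^ 2)) ≤ ε := by
  have hn' : (1 : ℝ) ≤ n := by exact_mod_cast hn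
  set A : ℝ := 2 * n * (1 + 1 / ε) with hA
  have hA2 : 2 < A := by
    have : 0 < 1 / ε := by positivity
    nlinarith
  have hAε : 2 * n * A⁻¹ = ε / (1 + ε) := by
    rw [hA]; field_simp; ring
  have hq0 : 0 ≤ A⁻¹ := by positivity
  have hq1 : A⁻¹ < 1 := inv_lt_one_of_one_lt₀ (by linarith)
  have hs : Real.pi * Real.sqrt (Real.log A / Real.pi) ^ 2 = Real.log A := by
    rw [Real.sq_sqrt (div_nonneg (Real.log_nonneg (by linarith)) Real.pi_pos.le)]
    field_simp
  have hterm (x : Fin n → ℤ) :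
      Real.exp (-Real.pi * (Real.sqrt (Real.log A / Real.pi)) ^ 2 * ∑ i, ((x i : ℝ)) ^ 2) =
        ∏ i, A⁻¹ ^ ((x i).natAbs ^ 2) := by
    rw [neg_mul, hs, Finset.mul_sum, Real.exp_sum]
    refine Finset.prod_congr rfl fun i _ => ?_
    have hcast : ((x i : ℝ)) ^ 2 = (((x i).natAbs ^ 2 : ℕ) : ℝ) := by
      rw [Nat.cast_pow, Nat.cast_natAbs, Int.cast_abs, sq_abs]
    rw [hcast, mul_comm, Real.exp_nat_mul, Real.exp_neg, Real.exp_log (by linarith)]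
  simp only [hterm]
  have hlt : 2 * n * A⁻¹ < 1 := by
    rw [hAε, div_lt_one (by linarith)]; linarith
  have hε' : (1 - 2 * n * A⁻¹)⁻¹ = 1 + ε := by
    rw [hAε]; field_simp; ring
  refine tsum_le_of_sum_le' hε.le fun s => ?_
  have h1 := sum_prod_pow_natAbs_sq_le hq0 hq1 s
  have h2 := div_pow_le_inv_one_sub (n := n) hq0 hq1 hlt
  linarith
end

section
/- Let m > n ≥ 100 be integers and ε ∈ (0, 1/1000). Let R ∈ ℝ^{m×m} be invertible, c ∈ ℝ^m, S ∈ ℝ^{n×n} invertible, B ∈ ℝ^{n×n} invertible, and let L = Bℤ^n be the full-rank lattice generated by the columns of B. Set M = SBᵀ and let X ∈ ℝ^{n×m} have its m columns drawn independently from D_{L,M}. If m ≥ 30·n·log₂(σ_1(S)·n), σ_m(R) ≥ 10·n·σ_1(S)·log₂(m)·√(log₂(1/ε)·log₂(n·σ_1(S))), and σ_n(S) ≥ 9·√(ln(2n(1 + 1/ε))/π), then with probability at least 1 − 2^{−n} over the choice of X, the statistical distance between E_{X,R,c} and the discrete Gaussian D_{L + Xc, RXᵀ} is at most 2ε. -/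
open scoped BigOperators Matrix
attribute [local instance] Classical.propDecidable

/-- The probability that `E_{X,R,c}` (the distribution of `X·v` for `v ← D_{ℤ^m + c, R}`)
assigns to the point `z ∈ ℝ^n`. -/
noncomputable def Edist {n m : ℕ} (X : Matrix (Fin n) (Fin m) ℝ)
    (R : Matrix (Fin m) (Fin m) ℝ) (c : Fin m → ℝ) (z : Fin n → ℝ) : ℝ :=
  (∑' v : Fin m → ℤ, if X *ᵥ (intCast' v + c) = z then rho R (intCast' v + c) else 0) /
  (∑' v : Fin m → ℤ, rho R (intCast' v + c))

/-- The statistical distance `Δ(E_{X,R,c}, D_{L + Xc, RXᵀ})` for `L = Bℤ^n` and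
`X = B·Z ∈ ℝ^{n×m}` with `Z ∈ ℤ^{n×m}` (so the columns of `X` lie in `L`): both distributions
are supported inside `L + Xc`, whose points are parametrized injectively by `w ∈ ℤ^n` (as
`Bw + Xc`, with `B` invertible). -/
noncomputable def statDistL {n m : ℕ} (B : Matrix (Fin n) (Fin n) ℝ)
    (Z : Matrix (Fin n) (Fin m) ℤ) (R : Matrix (Fin m) (Fin m) ℝ) (c : Fin m → ℝ) : ℝ :=
  (1 / 2) * ∑' w : Fin n → ℤ,
    |Edist (B * Z.map (Int.cast : ℤ → ℝ)) R c
        (B *ᵥ intCast' w + (B * Z.map (Int.cast : ℤ → ℝ)) *ᵥ c)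
      - rho (R * (B * Z.map (Int.cast : ℤ → ℝ))ᵀ)
            (B *ᵥ intCast' w + (B * Z.map (Int.cast : ℤ → ℝ)) *ᵥ c) /
          (∑' u : Fin n → ℤ,
            rho (R * (B * Z.map (Int.cast : ℤ → ℝ))ᵀ)
              (B *ᵥ intCast' u + (B * Z.map (Int.cast : ℤ → ℝ)) *ᵥ c))|

/-- Squared Euclidean norm. -/
noncomputable def nsq {k : ℕ} (x : Fin k → ℝ) : ℝ := x ⬝ᵥ x

lemma nsq_eq_sum {k : ℕ} (x : Fin k → ℝ) : nsq x = ∑ i, x i ^ 2 := by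
  simp [nsq, dotProduct, sq]

lemma nsq_nonneg {k : ℕ} (x : Fin k → ℝ) : 0 ≤ nsq x := by
  rw [nsq_eq_sum]; positivity

lemma nsq_eq_zero {k : ℕ} {x : Fin k → ℝ} : nsq x = 0 ↔ x = 0 := dotProduct_self_eq_zero

lemma nsq_add {k : ℕ} (x y : Fin k → ℝ) : nsq (x + y) = nsq x + 2 * (x ⬝ᵥ y) + nsq y := by
  simp only [nsq, add_dotProduct, dotProduct_add, dotProduct_comm y x]; ring

lemma nsq_smul {k : ℕ} (a : ℝ) (x : Fin k → ℝ) : nsq (a • x) = a ^ 2 * nsq x := by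
  simp only [nsq, smul_dotProduct, dotProduct_smul, smul_eq_mul]; ring

lemma nsq_neg {k : ℕ} (x : Fin k → ℝ) : nsq (-x) = nsq x := by
  simp [nsq]

lemma dotProduct_sq_le {k : ℕ} (x y : Fin k → ℝ) : (x ⬝ᵥ y) ^ 2 ≤ nsq x * nsq y := by
  rw [nsq_eq_sum, nsq_eq_sum]
  exact Finset.sum_mul_sq_le_sq_mul_sq _ _ _

lemma sqrt_nsq_add_le {k : ℕ} (x y : Fin k → ℝ) :
    √(nsq (x + y)) ≤ √(nsq x) + √(nsq y) := by
  apply Real.sqrt_le_iff.2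
  refine ⟨by positivity, ?_⟩
  have h1 : x ⬝ᵥ y ≤ √(nsq x) * √(nsq y) := by
    rw [← Real.sqrt_mul (nsq_nonneg x)]
    exact Real.le_sqrt_of_sq_le (dotProduct_sq_le x y)
  have := Real.sq_sqrt (nsq_nonneg x)
  have := Real.sq_sqrt (nsq_nonneg y)
  rw [nsq_add]; nlinarith

lemma enorm'_eq {k : ℕ} (x : Fin k → ℝ) : enorm' x = √(nsq x) := by
  rw [enorm', nsq_eq_sum]

lemma intCast'_add {k : ℕ} (v w : Fin k → ℤ) : intCast' (v + w) = intCast' v + intCast' w := by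
  ext; simp [intCast']

lemma intCast'_sub {k : ℕ} (v w : Fin k → ℤ) : intCast' (v - w) = intCast' v - intCast' w := by
  ext; simp [intCast']

lemma intCast'_neg {k : ℕ} (v : Fin k → ℤ) : intCast' (-v) = -intCast' v := by
  ext; simp [intCast']

lemma intCast'_smul {k : ℕ} (a : ℤ) (v : Fin k → ℤ) : intCast' (a • v) = (a : ℝ) • intCast' v := by
  ext; simp [intCast']

lemma intCast'_zero {k : ℕ} : intCast' (0 : Fin k → ℤ) = 0 := by
  ext; simp [intCast']

lemma intCast'_inj {k : ℕ} {v w : Fin k → ℤ} : intCast' v = intCast' w ↔ v = w := by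
  refine ⟨fun h => ?_, fun h => by rw [h]⟩
  ext i; have := congrFun h i; simpa [intCast'] using this

lemma intCast'_mulVec {k l : ℕ} (Z : Matrix (Fin k) (Fin l) ℤ) (v : Fin l → ℤ) :
    intCast' (Z *ᵥ v) = Z.map (Int.cast : ℤ → ℝ) *ᵥ intCast' v := by
  ext i; simp [intCast', Matrix.mulVec, dotProduct]

lemma intCast'_dotProduct {k : ℕ} (v w : Fin k → ℤ) :
    intCast' v ⬝ᵥ intCast' w = ((v ⬝ᵥ w : ℤ) : ℝ) := by
  simp [intCast', dotProduct]

lemma one_le_nsq_intCast' {k : ℕ} {v : Fin k → ℤ} (hv : v ≠ 0) : 1 ≤ nsq (intCast' v) := by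
  have h : nsq (intCast' v) ≠ 0 := by
    rw [Ne, nsq_eq_zero, ← intCast'_zero, intCast'_inj]; exact hv
  have h2 := nsq_nonneg (intCast' v)
  rw [nsq, intCast'_dotProduct] at *
  have h3 : (0 : ℤ) ≤ v ⬝ᵥ v := by exact_mod_cast h2
  have h4 : v ⬝ᵥ v ≠ 0 := by exact_mod_cast h
  exact_mod_cast (by omega : (1 : ℤ) ≤ v ⬝ᵥ v)

lemma rho_eq {k : ℕ} {S : Matrix (Fin k) (Fin k) ℝ} (x : Fin k → ℝ) :
    rho S x = Real.exp (-Real.pi * nsq ((Sᵀ)⁻¹ *ᵥ x)) := by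
  rw [rho, Matrix.mul_inv_rev, nsq, ← Matrix.mulVec_mulVec, Matrix.dotProduct_mulVec,
    ← Matrix.mulVec_transpose, Matrix.transpose_nonsing_inv]

lemma rho_pos {k l : ℕ} (S : Matrix (Fin k) (Fin l) ℝ) (x : Fin l → ℝ) : 0 < rho S x :=
  Real.exp_pos _

/-- Fubini for products over finitely many coordinates. -/
lemma ENNReal.tsum_prod_pi {ι : Type*} (k : ℕ) (f : Fin k → ι → ENNReal) :
    ∑' z : Fin k → ι, ∏ j, f j (z j) = ∏ j, ∑' x, f j x := by
  induction k with
  | zero => simp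
  | succ k ih =>
    rw [← (Fin.consEquiv (fun _ => ι)).tsum_eq, ENNReal.tsum_prod', Fin.prod_univ_succ]
    simp only [Fin.consEquiv, Equiv.coe_fn_mk, Fin.prod_univ_succ, Fin.cons_zero, Fin.cons_succ]
    simp_rw [ENNReal.tsum_mul_left, ENNReal.tsum_mul_right]
    rw [ih]

lemma natAbs_le_sq (u : ℤ) : (u.natAbs : ℝ) ≤ (u : ℝ) ^ 2 := by
  have : |u| ≤ u ^ 2 := by
    rw [← sq_abs u]
    nlinarith [abs_nonneg u, sq_nonneg (|u| - 1), Int.le_self_sq |u|]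
  rw [Nat.cast_natAbs]
  exact_mod_cast this

lemma hasSum_geom_int {r : ℝ} (h0 : 0 ≤ r) (h1 : r < 1) :
    HasSum (fun u : ℤ => r ^ u.natAbs) (1 + 2 * (r / (1 - r))) := by
  have h := hasSum_geometric_of_lt_one h0 h1
  have h2 := h.mul_left r
  have := HasSum.of_nat_of_neg_add_one (f := fun u : ℤ => r ^ u.natAbs)
    (m := (1 - r)⁻¹) (m' := r * (1 - r)⁻¹) (by simpa using h) (by
      refine h2.congr_fun ?_ |> fun h => h
      intro n
      have : (-((n : ℤ) + 1)).natAbs = n + 1 := by omega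
      simp only [this, pow_succ]; ring)
  convert this using 1
  have : 1 - r ≠ 0 := by linarith
  field_simp; ring

lemma summable_gauss_int {a : ℝ} (ha : 0 < a) :
    Summable (fun u : ℤ => Real.exp (-a * (u : ℝ) ^ 2)) := by
  refine Summable.of_nonneg_of_le (fun _ => (Real.exp_pos _).le) (fun u => ?_)
    (hasSum_geom_int (r := Real.exp (-a)) (Real.exp_pos _).le (by simpa using ha)).summable
  rw [← Real.exp_nat_mul]
  apply Real.exp_le_exp.2
  have := natAbs_le_sq u
  nlinarith

lemma tsum_gauss_int_le {a : ℝ} (ha : 0 < a) :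
    ∑' u : ℤ, Real.exp (-a * (u : ℝ) ^ 2) ≤
      1 + 2 * (Real.exp (-a) / (1 - Real.exp (-a))) := by
  have h := hasSum_geom_int (r := Real.exp (-a)) (Real.exp_pos _).le (by simpa using ha)
  rw [← h.tsum_eq]
  refine (summable_gauss_int ha).tsum_le_tsum (fun u => ?_) h.summable
  rw [← Real.exp_nat_mul]
  apply Real.exp_le_exp.2
  have := natAbs_le_sq u
  nlinarith

lemma tsum_gauss_pi_ennreal {k : ℕ} (a : ℝ) :
    ∑' z : Fin k → ℤ, ENNReal.ofReal (Real.exp (-a * nsq (intCast' z))) =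
      (∑' u : ℤ, ENNReal.ofReal (Real.exp (-a * (u : ℝ) ^ 2))) ^ k := by
  have := ENNReal.tsum_prod_pi k (fun _ (u : ℤ) => ENNReal.ofReal (Real.exp (-a * (u : ℝ) ^ 2)))
  simp only [Finset.prod_const, Finset.card_univ, Fintype.card_fin] at this
  rw [← this]
  congr 1; ext z
  rw [← ENNReal.ofReal_prod_of_nonneg (fun _ _ => (Real.exp_pos _).le), ← Real.exp_sum,
    ← Finset.mul_sum, nsq_eq_sum]
  rfl

lemma summable_of_tsum_ofReal_ne_top {ι : Type*} {f : ι → ℝ} (hf : ∀ i, 0 ≤ f i)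
    (h : ∑' i, ENNReal.ofReal (f i) ≠ ⊤) : Summable f := by
  have := ENNReal.summable_toReal h
  simpa [ENNReal.toReal_ofReal, hf] using this

lemma summable_gauss_pi {k : ℕ} {a : ℝ} (ha : 0 < a) :
    Summable (fun z : Fin k → ℤ => Real.exp (-a * nsq (intCast' z))) := by
  refine summable_of_tsum_ofReal_ne_top (fun _ => (Real.exp_pos _).le) ?_
  rw [tsum_gauss_pi_ennreal]
  exact ENNReal.pow_ne_top (summable_gauss_int ha).tsum_ofReal_ne_top

lemma tsum_gauss_pi {k : ℕ} {a : ℝ} (ha : 0 < a) :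
    ∑' z : Fin k → ℤ, Real.exp (-a * nsq (intCast' z)) =
      (∑' u : ℤ, Real.exp (-a * (u : ℝ) ^ 2)) ^ k := by
  have h := tsum_gauss_pi_ennreal (k := k) a
  rw [← ENNReal.ofReal_tsum_of_nonneg (fun _ => (Real.exp_pos _).le) (summable_gauss_pi ha),
    ← ENNReal.ofReal_tsum_of_nonneg (fun _ => (Real.exp_pos _).le) (summable_gauss_int ha),
    ← ENNReal.ofReal_pow (tsum_nonneg fun _ => (Real.exp_pos _).le)] at h
  rwa [ENNReal.ofReal_eq_ofReal_iff (tsum_nonneg fun _ => (Real.exp_pos _).le)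
    (pow_nonneg (tsum_nonneg fun _ => (Real.exp_pos _).le) _)] at h

/-- An invertible matrix does not contract norms by more than a constant factor. -/
lemma exists_le_nsq_mulVec {k : ℕ} {T : Matrix (Fin k) (Fin k) ℝ} (hT : IsUnit T.det) :
    ∃ α > 0, ∀ x, α * nsq x ≤ nsq (T *ᵥ x) := by
  set U := T⁻¹
  set C : ℝ := ∑ i, nsq (U i)
  have hC : 0 ≤ C := Finset.sum_nonneg fun _ _ => nsq_nonneg _
  have h1 : ∀ y, nsq (U *ᵥ y) ≤ C * nsq y := by
    intro y
    rw [nsq_eq_sum, Finset.sum_mul]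
    exact Finset.sum_le_sum fun i _ => dotProduct_sq_le _ _
  refine ⟨(C + 1)⁻¹, by positivity, fun x => ?_⟩
  have h2 := h1 (T *ᵥ x)
  rw [Matrix.mulVec_mulVec, Matrix.nonsing_inv_mul _ hT, Matrix.one_mulVec] at h2
  rw [inv_mul_le_iff₀ (by positivity)]
  nlinarith [nsq_nonneg (T *ᵥ x)]

lemma summable_gauss_shift {k : ℕ} {T : Matrix (Fin k) (Fin k) ℝ} (hT : IsUnit T.det)
    {a : ℝ} (ha : 0 < a) (x : Fin k → ℝ) :
    Summable (fun v : Fin k → ℤ => Real.exp (-a * nsq (T *ᵥ (intCast' v + x)))) := by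
  obtain ⟨α, hα, h⟩ := exists_le_nsq_mulVec hT
  refine Summable.of_nonneg_of_le (fun _ => (Real.exp_pos _).le) (fun v => ?_)
    ((summable_gauss_pi (k := k) (a := a * α / 2) (by positivity)).mul_left
      (Real.exp (a * α * nsq x)))
  rw [← Real.exp_add]
  apply Real.exp_le_exp.2
  have h1 := h (intCast' v + x)
  have h2 : nsq (intCast' v) ≤ 2 * nsq (intCast' v + x) + 2 * nsq x := by
    have h3 := nsq_nonneg (intCast' v + (2 : ℝ) • x)
    have h4 := nsq_add (intCast' v) x
    rw [nsq_add, nsq_smul, dotProduct_smul, smul_eq_mul] at h3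
    linarith
  have h5 : a * (α * nsq (intCast' v + x)) ≤ a * nsq (T *ᵥ (intCast' v + x)) := by gcongr
  have h6 : a * α * nsq (intCast' v) ≤ a * α * (2 * nsq (intCast' v + x) + 2 * nsq x) := by gcongr
  linarith

lemma tsum_cexp_gauss_bound {f : ℤ → ℂ} {q : ℝ} (hq0 : 0 ≤ q) (hq1 : q ≤ 1 / 3) (h0 : f 0 = 1)
    (hf : ∀ n, ‖f n‖ ≤ q ^ n.natAbs) : ‖∑' n, f n - 1‖ ≤ 3 * q := by
  have hg := hasSum_geom_int hq0 (by linarith : q < 1)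
  have hsf : Summable f := Summable.of_norm_bounded hg.summable hf
  have h1 : ∑' n, f n - 1 = ∑' n, (f n - if n = 0 then 1 else 0) := by
    rw [hsf.tsum_sub (hasSum_ite_eq (0 : ℤ) (1 : ℂ)).summable, tsum_ite_eq]
  have h2 : HasSum (fun n : ℤ => q ^ n.natAbs - if n = 0 then (1 : ℝ) else 0)
      (1 + 2 * (q / (1 - q)) - 1) := hg.sub (hasSum_ite_eq (0 : ℤ) (1 : ℝ))
  rw [h1]
  refine (tsum_of_norm_bounded h2 fun n => ?_).trans ?_
  · by_cases hn : n = 0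
    · simp [hn, h0]
    · simpa [hn] using hf n
  · have : q / (1 - q) ≤ 3 / 2 * q := by
      rw [div_le_iff₀ (by linarith)]; nlinarith
    linarith

/-- One-dimensional theta function estimate. -/
lemma theta_bounds {a : ℝ} (ha : 0 < a) (hδ : Real.exp (-Real.pi / a) ≤ 1 / 3) (x : ℝ) :
    |√a * ∑' j : ℤ, Real.exp (-Real.pi * a * ((j : ℝ) + x) ^ 2) - 1| ≤
      3 * Real.exp (-Real.pi / a) := by
  have h := Complex.tsum_exp_neg_quadratic (a := ((a⁻¹ : ℝ) : ℂ))
    (by rw [Complex.ofReal_re]; positivity) (-Complex.I * x)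
  have h1 : (1 : ℂ) / ((a⁻¹ : ℝ) : ℂ) ^ (1 / 2 : ℂ) = ((√a : ℝ) : ℂ) := by
    rw [show (1 / 2 : ℂ) = ((1 / 2 : ℝ) : ℂ) by push_cast; rfl,
      ← Complex.ofReal_cpow (by positivity), ← Real.sqrt_eq_rpow, Real.sqrt_inv]
    push_cast; simp
  have h2 : (∑' n : ℤ, Complex.exp (-Real.pi / ((a⁻¹ : ℝ) : ℂ) *
      ((n : ℂ) + Complex.I * (-Complex.I * x)) ^ 2)) =
      ((∑' j : ℤ, Real.exp (-Real.pi * a * ((j : ℝ) + x) ^ 2) : ℝ) : ℂ) := by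
    rw [Complex.ofReal_tsum]
    congr 1; ext n
    push_cast
    congr 1
    have : Complex.I * (-Complex.I * x) = x := by
      rw [← mul_assoc, mul_neg, Complex.I_mul_I]; ring
    rw [this]
    field_simp
  rw [h1, h2] at h
  have h3 := tsum_cexp_gauss_bound (f := fun n : ℤ => Complex.exp (-Real.pi * ((a⁻¹ : ℝ) : ℂ) *
    (n : ℂ) ^ 2 + 2 * Real.pi * (-Complex.I * x) * n)) (Real.exp_pos (-Real.pi / a)).le hδ
    (by simp) (fun n => by
      rw [Complex.norm_exp, ← Real.exp_nat_mul]
      apply Real.exp_le_exp.2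
      have h4 : (-Real.pi * ((a⁻¹ : ℝ) : ℂ) * (n : ℂ) ^ 2 +
          2 * Real.pi * (-Complex.I * x) * n) =
          ((-Real.pi * a⁻¹ * (n : ℝ) ^ 2 : ℝ) : ℂ) + ((-2 * Real.pi * x * n : ℝ) : ℂ) * Complex.I := by
        push_cast; ring
      rw [h4, Complex.add_re, Complex.ofReal_re, Complex.re_ofReal_mul, Complex.I_re, mul_zero,
        add_zero]
      have h5 := natAbs_le_sq n
      have h6 : 0 < Real.pi * a⁻¹ := by positivity
      have h7 : (-Real.pi / a) = -(Real.pi * a⁻¹) := by ring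
      rw [h7]; nlinarith)
  rw [h, ← Complex.ofReal_mul, ← Complex.ofReal_one, ← Complex.ofReal_sub, Complex.norm_real] at h3
  exact h3

/-- The Gaussian `exp(-π‖T(v + x)‖²)` on a shifted integer lattice. -/
noncomputable def gs {m : ℕ} (T : Matrix (Fin m) (Fin m) ℝ) (x : Fin m → ℝ) (v : Fin m → ℤ) : ℝ :=
  Real.exp (-Real.pi * nsq (T *ᵥ (intCast' v + x)))

/-- The Gaussian mass, under `exp(-π‖T(v + x)‖²)`, of the integer vectors `v` satisfying `p`. -/
noncomputable def gmass {m : ℕ} (T : Matrix (Fin m) (Fin m) ℝ) (p : (Fin m → ℤ) → Prop)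
    (x : Fin m → ℝ) : ENNReal :=
  ∑' v, if p v then ENNReal.ofReal (gs T x v) else 0

lemma gs_pos {m : ℕ} (T : Matrix (Fin m) (Fin m) ℝ) (x : Fin m → ℝ) (v : Fin m → ℤ) :
    0 < gs T x v := Real.exp_pos _

/-- Folding a sum over `ℤ^m` along the direction `b`. -/
lemma tsum_fold {m : ℕ} {b : Fin m → ℤ} (hb : b ≠ 0) (φ : (Fin m → ℤ) → ENNReal) :
    ∑' v, φ v = ∑' v, if (v ⬝ᵥ b) / (b ⬝ᵥ b) = 0 then ∑' j : ℤ, φ (v + j • b) else 0 := by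
  have hbb : b ⬝ᵥ b ≠ 0 := by simpa using hb
  have h1 : ∀ v : Fin m → ℤ, (if (v ⬝ᵥ b) / (b ⬝ᵥ b) = 0 then ∑' j : ℤ, φ (v + j • b) else 0) =
      ∑' j : ℤ, if (v ⬝ᵥ b) / (b ⬝ᵥ b) = 0 then φ (v + j • b) else 0 := by
    intro v; split_ifs <;> simp
  simp_rw [h1]
  rw [ENNReal.tsum_comm]
  have h2 : ∀ j : ℤ, (∑' v : Fin m → ℤ, if (v ⬝ᵥ b) / (b ⬝ᵥ b) = 0 then φ (v + j • b) else 0) =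
      ∑' v : Fin m → ℤ, if j = (v ⬝ᵥ b) / (b ⬝ᵥ b) then φ v else 0 := by
    intro j
    rw [← (Equiv.subRight (j • b)).tsum_eq]
    congr 1; ext v
    have : ((v - j • b) ⬝ᵥ b) / (b ⬝ᵥ b) = (v ⬝ᵥ b) / (b ⬝ᵥ b) - j := by
      rw [sub_dotProduct, smul_dotProduct, smul_eq_mul, Int.sub_mul_ediv_right _ _ hbb]
    simp only [Equiv.subRight_apply, this, sub_add_cancel, sub_eq_zero]
    simp only [eq_comm]
  simp_rw [h2]
  rw [ENNReal.tsum_comm]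
  congr 1; ext v
  simp

lemma gs_line {m : ℕ} (T : Matrix (Fin m) (Fin m) ℝ) (x : Fin m → ℝ) (v b : Fin m → ℤ)
    (ha : 0 < nsq (T *ᵥ intCast' b)) (j : ℤ) :
    gs T x (v + j • b) =
      Real.exp (-Real.pi * (nsq (T *ᵥ (intCast' v + x)) -
        (T *ᵥ (intCast' v + x) ⬝ᵥ T *ᵥ intCast' b) ^ 2 / nsq (T *ᵥ intCast' b))) *
      Real.exp (-Real.pi * nsq (T *ᵥ intCast' b) * ((j : ℝ) +
        (T *ᵥ (intCast' v + x) ⬝ᵥ T *ᵥ intCast' b) / nsq (T *ᵥ intCast' b)) ^ 2) := by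
  rw [gs, ← Real.exp_add]
  congr 1
  have : intCast' (v + j • b) + x = (intCast' v + x) + (j : ℝ) • intCast' b := by
    rw [intCast'_add, intCast'_smul]; abel
  rw [this, Matrix.mulVec_add, Matrix.mulVec_smul, nsq_add, nsq_smul, dotProduct_smul, smul_eq_mul]
  field_simp
  ring

lemma summable_theta {a : ℝ} (ha : 0 < a) (x : ℝ) :
    Summable fun j : ℤ => Real.exp (-Real.pi * a * ((j : ℝ) + x) ^ 2) := by
  have := summable_gauss_shift (k := 1) (T := 1) (by simp) (a := Real.pi * a) (by positivity)
    (fun _ => x)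
  rw [← (Equiv.funUnique (Fin 1) ℤ).symm.summable_iff] at this
  refine this.congr fun j => ?_
  simp [nsq_eq_sum, intCast']

lemma line_ratio {m : ℕ} (T : Matrix (Fin m) (Fin m) ℝ) (x : Fin m → ℝ) (v b : Fin m → ℤ)
    {η : ℝ} (ha : 0 < nsq (T *ᵥ intCast' b))
    (hη : Real.exp (-Real.pi / nsq (T *ᵥ intCast' b)) ≤ η) (hη3 : η ≤ 1 / 3) (t : ℝ) :
    ENNReal.ofReal (1 - 3 * η) * ∑' j : ℤ, ENNReal.ofReal (gs T x (v + j • b)) ≤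
      ENNReal.ofReal (1 + 3 * η) *
        ∑' j : ℤ, ENNReal.ofReal (gs T (x + t • intCast' b) (v + j • b)) := by
  set a := nsq (T *ᵥ intCast' b) with ha_def
  have e1 : T *ᵥ (intCast' v + (x + t • intCast' b)) =
      T *ᵥ (intCast' v + x) + t • T *ᵥ intCast' b := by
    rw [← add_assoc, Matrix.mulVec_add _ (intCast' v + x), Matrix.mulVec_smul]
  have key : ∀ s : ℝ, 1 - 3 * η ≤ √a * ∑' j : ℤ, Real.exp (-Real.pi * a * ((j : ℝ) + s) ^ 2) ∧
      √a * ∑' j : ℤ, Real.exp (-Real.pi * a * ((j : ℝ) + s) ^ 2) ≤ 1 + 3 * η := by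
    intro s
    have := abs_le.1 (theta_bounds ha (hη.trans hη3) s)
    constructor <;> linarith [this.1, this.2]
  simp_rw [gs_line T _ v b ha, e1, ← ha_def]
  set y := T *ᵥ (intCast' v + x)
  set d := T *ᵥ intCast' b
  have e2 : nsq (y + t • d) - ((y + t • d) ⬝ᵥ d) ^ 2 / a = nsq y - (y ⬝ᵥ d) ^ 2 / a := by
    rw [nsq_add, nsq_smul, dotProduct_smul, smul_eq_mul, add_dotProduct, smul_dotProduct,
      smul_eq_mul, show d ⬝ᵥ d = a from rfl, ← ha_def]
    field_simp; ring
  rw [e2]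
  set C := Real.exp (-Real.pi * (nsq y - (y ⬝ᵥ d) ^ 2 / a))
  have hC : 0 < C := Real.exp_pos _
  have e3 : ∀ s : ℝ, ∑' j : ℤ, ENNReal.ofReal (C * Real.exp (-Real.pi * a * ((j : ℝ) + s) ^ 2)) =
      ENNReal.ofReal (C * ∑' j : ℤ, Real.exp (-Real.pi * a * ((j : ℝ) + s) ^ 2)) := by
    intro s
    rw [← ENNReal.ofReal_tsum_of_nonneg (fun _ => by positivity)
      ((summable_theta ha s).mul_left C), tsum_mul_left]
  rw [e3, e3]
  have h3 : 0 ≤ 1 - 3 * η := by linarith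
  have hη0 : 0 < η := (Real.exp_pos _).trans_le hη
  rw [← ENNReal.ofReal_mul h3, ← ENNReal.ofReal_mul (by positivity)]
  apply ENNReal.ofReal_le_ofReal
  set u := ∑' j : ℤ, Real.exp (-Real.pi * a * ((j : ℝ) + y ⬝ᵥ d / a) ^ 2)
  set w := ∑' j : ℤ, Real.exp (-Real.pi * a * ((j : ℝ) + (y + t • d) ⬝ᵥ d / a) ^ 2)
  have hu : √a * u ≤ 1 + 3 * η := (key _).2
  have hw : 1 - 3 * η ≤ √a * w := (key _).1
  have hsa : 0 < √a := by positivity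
  have h4 : (1 - 3 * η) * (√a * u) ≤ (1 + 3 * η) * (√a * w) :=
    (mul_le_mul_of_nonneg_left hu h3).trans
      ((mul_comm _ _).le.trans (mul_le_mul_of_nonneg_left hw (by positivity)))
  have h5 : (1 - 3 * η) * u ≤ (1 + 3 * η) * w := by
    refine le_of_mul_le_mul_left ?_ hsa
    linarith
  calc (1 - 3 * η) * (C * u) = C * ((1 - 3 * η) * u) := by ring
    _ ≤ C * ((1 + 3 * η) * w) := by gcongr
    _ = _ := by ring

lemma gmass_ratio {m : ℕ} {T : Matrix (Fin m) (Fin m) ℝ} (hT : IsUnit T.det)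
    {p : (Fin m → ℤ) → Prop} (x : Fin m → ℝ) {b : Fin m → ℤ} {η : ℝ} (hη0 : 0 ≤ η)
    (hp : ∀ v (j : ℤ), p (v + j • b) ↔ p v)
    (hη : Real.exp (-Real.pi / nsq (T *ᵥ intCast' b)) ≤ η) (hη3 : η ≤ 1 / 3) (t : ℝ) :
    ENNReal.ofReal (1 - 3 * η) * gmass T p x ≤
      ENNReal.ofReal (1 + 3 * η) * gmass T p (x + t • intCast' b) := by
  by_cases hb : b = 0
  · subst hb
    simp only [intCast'_zero, smul_zero, add_zero]
    gcongr; linarith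
  have ha : 0 < nsq (T *ᵥ intCast' b) := by
    obtain ⟨α, hα, h⟩ := exists_le_nsq_mulVec hT
    have := h (intCast' b)
    nlinarith [one_le_nsq_intCast' hb]
  rw [gmass, gmass, tsum_fold hb fun v => if p v then ENNReal.ofReal (gs T x v) else 0,
    tsum_fold hb fun v => if p v then ENNReal.ofReal (gs T (x + t • intCast' b) v) else 0,
    ← ENNReal.tsum_mul_left, ← ENNReal.tsum_mul_left]
  refine ENNReal.tsum_le_tsum fun v => ?_
  simp_rw [hp]
  split_ifs
  · exact line_ratio T x v b ha hη hη3 t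
  all_goals simp

lemma gmass_ratio_finset {m : ℕ} {T : Matrix (Fin m) (Fin m) ℝ} (hT : IsUnit T.det)
    {p : (Fin m → ℤ) → Prop} {η : ℝ} (hη0 : 0 ≤ η) (hη3 : η ≤ 1 / 3)
    (s : Finset (Fin m → ℝ))
    (hs : ∀ u ∈ s, ∃ b : Fin m → ℤ, intCast' b = u ∧ (∀ v (j : ℤ), p (v + j • b) ↔ p v) ∧
      Real.exp (-Real.pi / nsq (T *ᵥ u)) ≤ η) (t : (Fin m → ℝ) → ℝ) (x : Fin m → ℝ) :
    ENNReal.ofReal (1 - 3 * η) ^ s.card * gmass T p x ≤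
      ENNReal.ofReal (1 + 3 * η) ^ s.card * gmass T p (x + ∑ u ∈ s, t u • u) := by
  induction s using Finset.induction_on with
  | empty => simp
  | insert a s ha ih =>
    obtain ⟨b, rfl, hp, hb⟩ := hs a (Finset.mem_insert_self _ _)
    have h1 := ih fun u hu => hs u (Finset.mem_insert_of_mem hu)
    have h2 := gmass_ratio hT (x + ∑ u ∈ s, t u • u) hη0 hp hb hη3 (t (intCast' b))
    rw [Finset.card_insert_of_notMem ha, Finset.sum_insert ha, pow_succ', pow_succ',
      add_comm (t _ • _), ← add_assoc, mul_assoc]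
    refine (mul_le_mul_right h1 _).trans ?_
    rw [mul_left_comm]
    refine (mul_le_mul_right h2 _).trans ?_
    rw [← mul_assoc, mul_comm (_ ^ _)]

/-- If `p` is invariant under integer vectors `G` that `T` makes short, then the mass of `p` is
nearly invariant under shifts in the real span of `G`. -/
lemma gmass_ratio_span {m : ℕ} {T : Matrix (Fin m) (Fin m) ℝ} (hT : IsUnit T.det)
    {p : (Fin m → ℤ) → Prop} {η : ℝ} (hη0 : 0 ≤ η) (hη3 : η ≤ 1 / 3)
    (G : Set (Fin m → ℤ))
    (hG : ∀ b ∈ G, (∀ v (j : ℤ), p (v + j • b) ↔ p v) ∧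
      Real.exp (-Real.pi / nsq (T *ᵥ intCast' b)) ≤ η) (x y : Fin m → ℝ)
    (hy : y ∈ Submodule.span ℝ (intCast' '' G)) :
    ENNReal.ofReal (1 - 3 * η) ^ m * gmass T p x ≤
      ENNReal.ofReal (1 + 3 * η) ^ m * gmass T p (x + y) := by
  obtain ⟨s, hsG, hspan, hli⟩ := exists_linearIndependent ℝ (intCast' '' G)
  have hfin : s.Finite := hli.setFinite
  set fs := hfin.toFinset
  have hfs : (fs : Set (Fin m → ℝ)) = s := hfin.coe_toFinset
  rw [← hspan, ← hfs, Submodule.mem_span_finset] at hy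
  obtain ⟨t, -, rfl⟩ := hy
  have hcard : fs.card ≤ m := by
    have : LinearIndependent ℝ ((↑) : fs → (Fin m → ℝ)) := by
      rw [← hfs] at hli; exact hli
    simpa using this.fintype_card_le_finrank
  have h := gmass_ratio_finset hT hη0 hη3 fs (p := p) (fun u hu => by
    obtain ⟨b, hb, rfl⟩ := hsG ((hfin.mem_toFinset).1 hu)
    exact ⟨b, rfl, hG b hb⟩) t x
  have hA : ENNReal.ofReal (1 - 3 * η) ≤ 1 := by
    rw [ENNReal.ofReal_le_one]; linarith
  have hB : 1 ≤ ENNReal.ofReal (1 + 3 * η) := by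
    rw [ENNReal.one_le_ofReal]; linarith
  obtain ⟨d, hd⟩ := Nat.exists_eq_add_of_le hcard
  have e1 : ∀ A : ENNReal, A ^ m = A ^ d * A ^ fs.card := fun A => by
    rw [← pow_add]; congr 1; omega
  rw [e1, e1, mul_assoc, mul_assoc]
  exact mul_le_mul' ((pow_le_one' hA d).trans (one_le_pow_of_one_le' hB d)) h

/-- Two nonnegative families that are proportional up to a factor in `[β⁻¹, β]` have normalizations
at total variation distance at most `(β² - 1) / 2`. -/
lemma half_tsum_abs_sub_le {ι : Type*} {f g : ι → ℝ} {β φ : ℝ} (hβ : 1 ≤ β) (hφ : 0 < φ)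
    (hg0 : ∀ i, 0 ≤ g i) (hf : Summable f) (hF : 0 < ∑' i, f i)
    (h1 : ∀ i, g i * φ ≤ β * f i) (h2 : ∀ i, f i ≤ β * (g i * φ)) :
    (1 / 2) * ∑' i, |f i / (∑' j, f j) - g i / ∑' j, g j| ≤ (β ^ 2 - 1) / 2 := by
  have hβ0 : 0 < β := by linarith
  have hg : Summable g := by
    refine Summable.of_nonneg_of_le hg0 (fun i => ?_) (hf.mul_left (β / φ))
    have := h1 i
    rw [div_mul_eq_mul_div, le_div_iff₀ hφ]; exact this
  set F := ∑' i, f i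
  set G := ∑' i, g i
  have hGF : G * φ ≤ β * F := by
    have := (hg.mul_right φ).tsum_le_tsum h1 (hf.mul_left β)
    rwa [tsum_mul_right, tsum_mul_left] at this
  have hFG : F ≤ β * (G * φ) := by
    have := hf.tsum_le_tsum h2 ((hg.mul_right φ).mul_left β)
    rwa [tsum_mul_left, tsum_mul_right] at this
  have hG : 0 < G := by
    have h3 : 0 < β * (G * φ) := hF.trans_le hFG
    have h4 : 0 < G * φ := (pos_iff_pos_of_mul_pos h3).1 hβ0
    exact pos_of_mul_pos_left h4 hφ.le
  have key : ∀ i, |f i / F - g i / G| ≤ (β ^ 2 - 1) * (g i / G) := by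
    intro i
    have e1 : f i / F ≤ β ^ 2 * (g i / G) := by
      rw [div_le_iff₀ hF, ← mul_div_assoc, div_mul_eq_mul_div, le_div_iff₀ hG]
      calc f i * G ≤ β * (g i * φ) * G := by gcongr; exact h2 i
        _ = β * g i * (G * φ) := by ring
        _ ≤ β * g i * (β * F) := by gcongr; exact mul_nonneg hβ0.le (hg0 i)
        _ = _ := by ring
    have e2 : g i / G ≤ β ^ 2 * (f i / F) := by
      rw [div_le_iff₀ hG, ← mul_div_assoc, div_mul_eq_mul_div, le_div_iff₀ hF]
      have hfi : 0 ≤ f i := by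
        have := (mul_nonneg (hg0 i) hφ.le).trans (h1 i)
        exact nonneg_of_mul_nonneg_right this hβ0
      calc g i * F ≤ g i * (β * (G * φ)) := mul_le_mul_of_nonneg_left hFG (hg0 i)
        _ = β * G * (g i * φ) := by ring
        _ ≤ β * G * (β * f i) := mul_le_mul_of_nonneg_left (h1 i) (by positivity)
        _ = _ := by ring
    have e3 : 0 ≤ g i / G := div_nonneg (hg0 i) hG.le
    rw [abs_le]
    refine ⟨?_, by linarith⟩
    have e4 : g i / G - f i / F ≤ (1 - (β ^ 2)⁻¹) * (g i / G) := by
      have : (β ^ 2)⁻¹ * (g i / G) ≤ f i / F := by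
        rw [inv_mul_le_iff₀ (by positivity)]; exact e2
      linarith
    have e5 : 1 - (β ^ 2)⁻¹ ≤ β ^ 2 - 1 := by
      have h6 : 1 ≤ β ^ 2 := one_le_pow₀ hβ
      have : (β ^ 2)⁻¹ * β ^ 2 = 1 := inv_mul_cancel₀ (by positivity)
      nlinarith [inv_pos.2 (by positivity : 0 < β ^ 2), sq_nonneg (β ^ 2 - 1)]
    nlinarith
  have hs : Summable fun i => (β ^ 2 - 1) * (g i / G) := (hg.div_const G).mul_left _
  have h3 : ∑' i, |f i / F - g i / G| ≤ ∑' i, (β ^ 2 - 1) * (g i / G) :=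
    (Summable.of_nonneg_of_le (fun _ => abs_nonneg _) key hs).tsum_le_tsum key hs
  rw [tsum_mul_left, tsum_div_const, div_self hG.ne', mul_one] at h3
  linarith

lemma rho_mul_transpose {k n : ℕ} (A : Matrix (Fin k) (Fin n) ℝ) {B : Matrix (Fin n) (Fin n) ℝ}
    (hB : IsUnit B.det) (x : Fin n → ℝ) : rho (A * Bᵀ) (B *ᵥ x) = rho A x := by
  rw [rho, rho]
  have e : (A * Bᵀ)ᵀ * (A * Bᵀ) = B * ((Aᵀ * A) * Bᵀ) := by
    rw [Matrix.transpose_mul, Matrix.transpose_transpose]; simp only [Matrix.mul_assoc]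
  rw [e, Matrix.mul_inv_rev, Matrix.mul_inv_rev, Matrix.dotProduct_mulVec, ← Matrix.vecMul_vecMul,
    ← Matrix.vecMul_vecMul, ← Matrix.dotProduct_mulVec, Matrix.mulVec_mulVec,
    Matrix.nonsing_inv_mul _ hB, Matrix.one_mulVec, ← Matrix.vecMul_transpose,
    Matrix.vecMul_vecMul, Matrix.vecMul_vecMul, ← Matrix.mul_assoc, Matrix.mul_nonsing_inv _ (by rwa [Matrix.det_transpose]),
    Matrix.one_mul, Matrix.dotProduct_mulVec]

lemma gmass_ne_top {m : ℕ} {T : Matrix (Fin m) (Fin m) ℝ} (hT : IsUnit T.det)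
    (p : (Fin m → ℤ) → Prop) (x : Fin m → ℝ) : gmass T p x ≠ ⊤ := by
  have h : Summable (gs T x) := by
    have := summable_gauss_shift hT Real.pi_pos x; exact this
  refine ne_top_of_le_ne_top h.tsum_ofReal_ne_top (ENNReal.tsum_le_tsum fun v => ?_)
  split_ifs <;> simp

lemma gmass_pos {m : ℕ} {T : Matrix (Fin m) (Fin m) ℝ}
    {p : (Fin m → ℤ) → Prop} (x : Fin m → ℝ) {v : Fin m → ℤ} (hv : p v) : 0 < gmass T p x := by
  refine lt_of_lt_of_le ?_ (ENNReal.le_tsum v)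
  rw [if_pos hv]; exact ENNReal.ofReal_pos.2 (gs_pos _ _ _)

lemma gmass_toReal {m : ℕ} {T : Matrix (Fin m) (Fin m) ℝ}
    (p : (Fin m → ℤ) → Prop) (x : Fin m → ℝ) :
    (gmass T p x).toReal = ∑' v, if p v then gs T x v else 0 := by
  rw [gmass, ENNReal.tsum_toReal_eq fun v => by split_ifs <;> simp]
  congr 1; ext v
  split_ifs <;> simp [(gs_pos _ _ _).le]

/-- Gram matrices of full-row-rank real matrices are invertible. -/
lemma isUnit_gram {n m : ℕ} {Z : Matrix (Fin n) (Fin m) ℝ} {R : Matrix (Fin m) (Fin m) ℝ}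
    (hR : IsUnit R.det) (hZ : ∀ y, ∃ x, Z *ᵥ x = y) :
    IsUnit ((R * Zᵀ)ᵀ * (R * Zᵀ)).det := by
  rw [← Matrix.isUnit_iff_isUnit_det, ← Matrix.mulVec_injective_iff_isUnit]
  have hinj : ∀ x, ((R * Zᵀ)ᵀ * (R * Zᵀ)) *ᵥ x = 0 → x = 0 := by
    intro x hx
    have h1 : nsq ((R * Zᵀ) *ᵥ x) = 0 := by
      rw [nsq, Matrix.dotProduct_mulVec, ← Matrix.mulVec_transpose, Matrix.mulVec_mulVec, hx,
        zero_dotProduct]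
    rw [nsq_eq_zero, ← Matrix.mulVec_mulVec] at h1
    have h2 : Zᵀ *ᵥ x = 0 := by
      have := congrArg (fun y => R⁻¹ *ᵥ y) h1
      simpa [Matrix.mulVec_mulVec, Matrix.nonsing_inv_mul_cancel_left _ _ hR] using this
    obtain ⟨y, hy⟩ := hZ x
    rw [← nsq_eq_zero, nsq]
    nth_rewrite 1 [← hy]
    rw [← Matrix.vecMul_transpose, ← Matrix.dotProduct_mulVec, h2, dotProduct_zero]
  intro x y hxy
  rw [← sub_eq_zero]
  apply hinj
  rw [Matrix.mulVec_sub]; exact sub_eq_zero.2 hxy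

lemma gmass_fibre {n m : ℕ} {R : Matrix (Fin m) (Fin m) ℝ} (hR : IsUnit R.det)
    (c : Fin m → ℝ) (Z : Matrix (Fin n) (Fin m) ℤ)
    (hsurj : ∀ y : Fin n → ℤ, ∃ v : Fin m → ℤ, Z *ᵥ v = y)
    (hsurjR : ∀ y, ∃ x, Z.map (Int.cast : ℤ → ℝ) *ᵥ x = y) (w : Fin n → ℤ) :
    ∃ k : Fin m → ℝ, Z.map (Int.cast : ℤ → ℝ) *ᵥ k = 0 ∧
      gmass (Rᵀ)⁻¹ (fun v => Z *ᵥ v = w) c =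
        ENNReal.ofReal (rho (R * (Z.map (Int.cast : ℤ → ℝ))ᵀ)
          (intCast' w + Z.map (Int.cast : ℤ → ℝ) *ᵥ c)) *
        gmass (Rᵀ)⁻¹ (fun v => Z *ᵥ v = 0) k := by
  obtain ⟨v0, hv0⟩ := hsurj w
  set Zr := Z.map (Int.cast : ℤ → ℝ) with hZr
  set A := R * Zrᵀ with hA
  set Gm := Aᵀ * A with hGm
  have hG : IsUnit Gm.det := isUnit_gram hR hsurjR
  set z := intCast' w + Zr *ᵥ c with hz
  set u := Gm⁻¹ *ᵥ z with hu
  set p := Rᵀ *ᵥ (A *ᵥ u) with hp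
  have hRT : IsUnit Rᵀ.det := by rwa [Matrix.det_transpose]
  have hTp : (Rᵀ)⁻¹ *ᵥ p = A *ᵥ u := by
    rw [hp, Matrix.mulVec_mulVec, Matrix.nonsing_inv_mul _ hRT, Matrix.one_mulVec]
  have hGu : Gm *ᵥ u = z := by
    rw [hu, Matrix.mulVec_mulVec, Matrix.mul_nonsing_inv _ hG, Matrix.one_mulVec]
  have hZp : Zr *ᵥ p = z := by
    rw [← hGu, hGm, hp, hA]
    simp only [Matrix.mulVec_mulVec, Matrix.transpose_mul, Matrix.transpose_transpose,
      Matrix.mul_assoc]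
  have hz2 : Zr *ᵥ (intCast' v0 + c) = z := by
    rw [Matrix.mulVec_add, hZr, ← intCast'_mulVec, hv0]
  have hk : Zr *ᵥ (intCast' v0 + c - p) = 0 := by
    rw [Matrix.mulVec_sub, hz2, hZp, sub_self]
  refine ⟨intCast' v0 + c - p, hk, ?_⟩
  rw [gmass, gmass, ← ENNReal.tsum_mul_left, ← (Equiv.addRight v0).tsum_eq]
  congr 1; ext v
  have e1 : Z *ᵥ (v + v0) = w ↔ Z *ᵥ v = 0 := by
    rw [Matrix.mulVec_add, hv0, add_eq_right]
  simp only [Equiv.coe_addRight, e1]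
  split_ifs with hv
  swap
  · simp
  rw [← ENNReal.ofReal_mul (rho_pos _ _).le]
  congr 1
  rw [gs, gs, rho, ← Real.exp_add, ← mul_add]
  congr 2
  have e2 : intCast' (v + v0) + c = (intCast' v + (intCast' v0 + c - p)) + p := by
    rw [intCast'_add]; abel
  have hq : Zr *ᵥ (intCast' v + (intCast' v0 + c - p)) = 0 := by
    rw [Matrix.mulVec_add, hk, hZr, ← intCast'_mulVec, hv, intCast'_zero, add_zero]
  set q := intCast' v + (intCast' v0 + c - p)
  rw [e2, Matrix.mulVec_add, nsq_add, hTp]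
  have e3 : (Rᵀ)⁻¹ *ᵥ q ⬝ᵥ A *ᵥ u = 0 := by
    rw [hA, ← Matrix.mulVec_mulVec, Matrix.dotProduct_mulVec _ R, ← Matrix.mulVec_transpose,
      Matrix.mulVec_mulVec, Matrix.mul_nonsing_inv _ hRT, Matrix.one_mulVec,
      Matrix.dotProduct_mulVec, ← Matrix.mulVec_transpose, Matrix.transpose_transpose, hq,
      zero_dotProduct]
  have e4 : nsq (A *ᵥ u) = z ⬝ᵥ Gm⁻¹ *ᵥ z := by
    rw [nsq, Matrix.dotProduct_mulVec, ← Matrix.mulVec_transpose, Matrix.mulVec_mulVec, hGu]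
  rw [e3, e4, mul_zero, add_zero, add_comm]

/-- Closeness to the discrete Gaussian when the kernel lattice of `Z` is generated, over `ℝ`, by
short integer vectors. -/
lemma statDistL_le {n m : ℕ} {ε : ℝ} {R : Matrix (Fin m) (Fin m) ℝ} (hR : IsUnit R.det)
    (c : Fin m → ℝ) {B : Matrix (Fin n) (Fin n) ℝ} (hB : IsUnit B.det)
    (Z : Matrix (Fin n) (Fin m) ℤ)
    (hsurj : ∀ y : Fin n → ℤ, ∃ v : Fin m → ℤ, Z *ᵥ v = y)
    {η : ℝ} (hη0 : 0 ≤ η) (hη3 : η < 1 / 3) (G : Set (Fin m → ℤ))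
    (hG : ∀ b ∈ G, Z *ᵥ b = 0 ∧ Real.exp (-Real.pi / nsq ((Rᵀ)⁻¹ *ᵥ intCast' b)) ≤ η)
    (hspan : ∀ y : Fin m → ℝ, Z.map (Int.cast : ℤ → ℝ) *ᵥ y = 0 →
      y ∈ Submodule.span ℝ (intCast' '' G))
    (hm : ((1 + 3 * η) / (1 - 3 * η)) ^ (2 * m) ≤ 1 + 4 * ε) :
    statDistL B Z R c ≤ 2 * ε := by
  set Zr := Z.map (Int.cast : ℤ → ℝ) with hZr
  set T := (Rᵀ)⁻¹ with hTdef
  have hT : IsUnit T.det := by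
    rw [hTdef, Matrix.isUnit_nonsing_inv_det_iff, Matrix.det_transpose]; exact hR
  set β := ((1 + 3 * η) / (1 - 3 * η)) ^ m with hβdef
  have h13 : 0 < 1 - 3 * η := by linarith
  have hβ1 : 1 ≤ β := one_le_pow₀ (by rw [le_div_iff₀ h13]; linarith)
  set φ := (gmass T (fun v => Z *ᵥ v = 0) 0).toReal
  have hφ : 0 < φ := ENNReal.toReal_pos (gmass_pos _ (v := 0) (by simp)).ne' (gmass_ne_top hT _ _)
  have hsurjR : ∀ y, ∃ x, Zr *ᵥ x = y := by
    intro y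
    choose v hv using fun i : Fin n => hsurj (Pi.single i 1)
    refine ⟨∑ i, y i • intCast' (v i), ?_⟩
    rw [Matrix.mulVec_sum]
    ext j
    simp only [Matrix.mulVec_smul, hZr, ← intCast'_mulVec, hv, Finset.sum_apply, Pi.smul_apply,
      intCast', smul_eq_mul]
    simp [Pi.single_apply]
  set f : (Fin n → ℤ) → ℝ := fun w => (gmass T (fun v => Z *ᵥ v = w) c).toReal with hf
  set g : (Fin n → ℤ) → ℝ := fun w => rho (R * Zrᵀ) (intCast' w + Zr *ᵥ c) with hg
  have hinv : ∀ b ∈ G, (∀ v (j : ℤ), Z *ᵥ (v + j • b) = 0 ↔ Z *ᵥ v = 0) ∧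
      Real.exp (-Real.pi / nsq (T *ᵥ intCast' b)) ≤ η := fun b hb =>
    ⟨fun v j => by rw [Matrix.mulVec_add, Matrix.mulVec_smul, (hG b hb).1, smul_zero, add_zero],
      (hG b hb).2⟩
  have hratio : ∀ x y : Fin m → ℝ, Zr *ᵥ y = 0 →
      (gmass T (fun v => Z *ᵥ v = 0) x).toReal ≤
        β * (gmass T (fun v => Z *ᵥ v = 0) (x + y)).toReal := by
    intro x y hy
    have := gmass_ratio_span (p := fun v => Z *ᵥ v = 0) hT hη0 hη3.le G hinv x y (hspan y hy)
    have h2 := ENNReal.toReal_mono (ENNReal.mul_ne_top (by simp) (gmass_ne_top hT _ _)) this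
    rw [ENNReal.toReal_mul, ENNReal.toReal_mul, ENNReal.toReal_pow, ENNReal.toReal_pow,
      ENNReal.toReal_ofReal h13.le, ENNReal.toReal_ofReal (by linarith)] at h2
    rw [hβdef, div_pow, div_mul_eq_mul_div, le_div_iff₀ (by positivity)]
    linarith
  have hfib : ∀ w, ∃ k, Zr *ᵥ k = 0 ∧
      f w = g w * (gmass T (fun v => Z *ᵥ v = 0) k).toReal := by
    intro w
    obtain ⟨k, hk, h⟩ := gmass_fibre hR c Z hsurj hsurjR w
    refine ⟨k, hk, ?_⟩
    rw [hf]
    simp only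
    rw [h, ENNReal.toReal_mul, ENNReal.toReal_ofReal (rho_pos _ _).le]
  have hg0 : ∀ w, 0 < g w := fun w => rho_pos _ _
  have h1 : ∀ w, g w * φ ≤ β * f w := by
    intro w
    obtain ⟨k, hk, h⟩ := hfib w
    have := hratio 0 k hk
    rw [zero_add] at this
    rw [h]
    nlinarith [mul_le_mul_of_nonneg_left this (hg0 w).le]
  have h2 : ∀ w, f w ≤ β * (g w * φ) := by
    intro w
    obtain ⟨k, hk, h⟩ := hfib w
    have := hratio k (-k) (by rw [Matrix.mulVec_neg, hk, neg_zero])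
    rw [add_neg_cancel] at this
    rw [h]
    nlinarith [mul_le_mul_of_nonneg_left this (hg0 w).le]
  have htot : ∑' w, gmass T (fun v => Z *ᵥ v = w) c = gmass T (fun _ => True) c := by
    simp only [gmass]
    rw [ENNReal.tsum_comm]
    congr 1; ext v
    exact (tsum_eq_single (Z *ᵥ v) fun w hw => if_neg (Ne.symm hw)).trans (by simp)
  have hfs : Summable f := ENNReal.summable_toReal (by rw [htot]; exact gmass_ne_top hT _ _)
  have hFtot : ∑' w, f w = ∑' v : Fin m → ℤ, rho R (intCast' v + c) := by
    rw [hf, ← ENNReal.tsum_toReal_eq fun w => gmass_ne_top hT _ _, htot, gmass_toReal]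
    simp only [if_true, rho_eq, gs, hTdef]
  have hF : 0 < ∑' w, f w := by
    rw [hf, ← ENNReal.tsum_toReal_eq fun w => gmass_ne_top hT _ _, htot]
    exact ENNReal.toReal_pos (gmass_pos _ (v := 0) trivial).ne' (gmass_ne_top hT _ _)
  have hmain := half_tsum_abs_sub_le hβ1 hφ (fun w => (hg0 w).le) hfs hF h1 h2
  have hβ2 : β ^ 2 ≤ 1 + 4 * ε := by rw [hβdef, ← pow_mul, mul_comm m 2]; exact hm
  refine le_trans (le_of_eq ?_) (hmain.trans (by linarith))
  have hrho : ∀ w : Fin n → ℤ, rho (R * (B * Zr)ᵀ) (B *ᵥ intCast' w + (B * Zr) *ᵥ c) = g w := by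
    intro w
    rw [Matrix.transpose_mul, ← Matrix.mul_assoc, ← Matrix.mulVec_mulVec, ← Matrix.mulVec_add,
      rho_mul_transpose _ hB]
  have hBinj : ∀ x y, B *ᵥ x = B *ᵥ y ↔ x = y := fun x y =>
    (Matrix.mulVec_injective_iff_isUnit.2 ((Matrix.isUnit_iff_isUnit_det _).2 hB)).eq_iff
  have hE : ∀ w : Fin n → ℤ, Edist (B * Zr) R c (B *ᵥ intCast' w + (B * Zr) *ᵥ c) =
      f w / ∑' w, f w := by
    intro w
    rw [Edist, hFtot, hf]
    simp only [gmass_toReal]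
    congr 2
    ext v
    have : (B * Zr) *ᵥ (intCast' v + c) = B *ᵥ intCast' w + (B * Zr) *ᵥ c ↔ Z *ᵥ v = w := by
      rw [Matrix.mulVec_add, add_left_inj, ← Matrix.mulVec_mulVec, hBinj, hZr, ← intCast'_mulVec,
        intCast'_inj]
    simp only [this, rho_eq, gs, hTdef]
    split_ifs <;> rfl
  rw [statDistL]
  simp only [← hZr, hE, hrho]

open MeasureTheory in
/-- The half-open unit cube with lower corner `a`. -/
def unitBox {n : ℕ} (a : Fin n → ℝ) : Set (Fin n → ℝ) := {x | ∀ i, x i ∈ Set.Ioc (a i) (a i + 1)}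

lemma measurableSet_unitBox {n : ℕ} (a : Fin n → ℝ) : MeasurableSet (unitBox a) :=
  MeasurableSet.univ_pi' fun _ => measurableSet_Ioc

lemma iUnion_unitBox {n : ℕ} : ⋃ u : Fin n → ℤ, unitBox (intCast' u) = Set.univ := by
  refine Set.eq_univ_of_forall fun x => Set.mem_iUnion.2 ⟨fun i => ⌈x i⌉ - 1, fun i => ?_⟩
  have h1 := Int.le_ceil (x i)
  have h2 := Int.ceil_lt_add_one (x i)
  simp only [intCast', Int.cast_sub, Int.cast_one, Set.mem_Ioc]
  constructor <;> linarith

lemma pairwise_disjoint_unitBox {n : ℕ} :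
    Pairwise (Function.onFun Disjoint fun u : Fin n → ℤ => unitBox (intCast' u)) := by
  intro u v huv
  refine Set.disjoint_left.2 fun x hx hy => huv ?_
  ext i
  have h1 := hx i
  have h2 := hy i
  simp only [intCast', Set.mem_Ioc] at h1 h2
  have h3 : (u i : ℝ) < v i + 1 := by linarith [h1.1, h2.2]
  have h4 : (v i : ℝ) < u i + 1 := by linarith [h2.1, h1.2]
  have h5 : u i < v i + 1 := by exact_mod_cast h3
  have h6 : v i < u i + 1 := by exact_mod_cast h4
  omega

open MeasureTheory in
lemma setIntegral_unitBox_shift {n : ℕ} {E : Type*} [NormedAddCommGroup E] [NormedSpace ℝ E]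
    (h : (Fin n → ℝ) → E) (u : Fin n → ℤ) :
    ∫ x in unitBox 0, h (x + intCast' u) = ∫ x in unitBox (intCast' u), h x := by
  have := (measurePreserving_add_right (volume : Measure (Fin n → ℝ)) (intCast' u)).setIntegral_preimage_emb
    (MeasurableEquiv.addRight (intCast' u)).measurableEmbedding h (unitBox (intCast' u))
  rw [← this]
  congr 2
  ext x
  simp only [unitBox, Set.mem_ofPred_eq, Set.mem_preimage, Pi.add_apply, Pi.zero_apply, Set.mem_Ioc]
  refine forall_congr' fun i => ?_
  constructor <;> rintro ⟨h1, h2⟩ <;> constructor <;> linarith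

open MeasureTheory in
/-- Unfolding an integral over `ℝⁿ` to the unit cube. -/
lemma integral_unitBox_tsum {n : ℕ} {h : (Fin n → ℝ) → ℂ} (hh : Integrable h) :
    ∫ x in unitBox 0, ∑' u : Fin n → ℤ, h (x + intCast' u) = ∫ x, h x := by
  have hS : ∀ {E : Type} [NormedAddCommGroup E] [NormedSpace ℝ E] {g : (Fin n → ℝ) → E},
      Integrable g → HasSum (fun u : Fin n → ℤ => ∫ x in unitBox 0, g (x + intCast' u))
        (∫ x, g x) := by
    intro E _ _ g hg
    have := hasSum_integral_iUnion (μ := volume) (f := g)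
      (fun u : Fin n → ℤ => measurableSet_unitBox (intCast' u)) pairwise_disjoint_unitBox
      hg.integrableOn
    rw [iUnion_unitBox, Measure.restrict_univ] at this
    simpa only [setIntegral_unitBox_shift] using this
  have h1 := hasSum_integral_of_summable_integral_norm (μ := volume.restrict (unitBox 0))
    (F := fun (u : Fin n → ℤ) x => h (x + intCast' u))
    (fun u => ((hh.comp_add_right (intCast' u)).integrableOn))
    (hS hh.norm).summable
  exact h1.unique (hS hh)

open MeasureTheory in
lemma gauss_fourier {n : ℕ} {S : Matrix (Fin n) (Fin n) ℝ} (hS : IsUnit S.det) (z : Fin n → ℝ) :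
    Integrable (fun x : Fin n → ℝ => Complex.exp (-2 * Real.pi * Complex.I * (z ⬝ᵥ x : ℝ)) *
      (Real.exp (-Real.pi * nsq (S *ᵥ x)) : ℂ)) ∧
    ∫ x : Fin n → ℝ, Complex.exp (-2 * Real.pi * Complex.I * (z ⬝ᵥ x : ℝ)) *
      (Real.exp (-Real.pi * nsq (S *ᵥ x)) : ℂ) = ((|S.det|⁻¹ * rho S z : ℝ) : ℂ) := by
  set ξ := (Sᵀ)⁻¹ *ᵥ z with hξ
  set φ : (Fin n → ℝ) → ℂ := fun y => Complex.exp (-(Real.pi : ℂ) * ∑ i, (y i : ℂ) ^ 2 +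
    ∑ i, (-2 * Real.pi * Complex.I * ξ i) * y i) with hφ
  have hpi : 0 < (Real.pi : ℂ).re := by simpa using Real.pi_pos
  have e1 : (fun x : Fin n → ℝ => Complex.exp (-2 * Real.pi * Complex.I * (z ⬝ᵥ x : ℝ)) *
      (Real.exp (-Real.pi * nsq (S *ᵥ x)) : ℂ)) = φ ∘ (Matrix.toLin' S) := by
    ext x
    rw [Function.comp_apply, hφ, Matrix.toLin'_apply, Complex.ofReal_exp, ← Complex.exp_add]
    congr 1
    have h1 : z ⬝ᵥ x = ξ ⬝ᵥ S *ᵥ x := by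
      rw [hξ, Matrix.dotProduct_mulVec, ← Matrix.mulVec_transpose, Matrix.mulVec_mulVec,
        Matrix.mul_nonsing_inv _ (by rwa [Matrix.det_transpose]), Matrix.one_mulVec]
    rw [h1, nsq_eq_sum, dotProduct]
    push_cast
    rw [Finset.mul_sum, add_comm]
    congr 1
    exact Finset.sum_congr rfl fun i _ => by ring
  have hdet : S.det ≠ 0 := hS.ne_zero
  have hmap := Real.map_matrix_volume_pi_eq_smul_volume_pi hdet
  have hmeas : Measurable (Matrix.toLin' S) := (LinearMap.continuous_of_finiteDimensional _).measurable
  have hφi : Integrable φ := GaussianFourier.integrable_cexp_neg_mul_sum_add hpi _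
  have hφm : Integrable φ (Measure.map (Matrix.toLin' S) volume) := by
    rw [hmap]; exact hφi.smul_measure (by simp)
  rw [e1]
  refine ⟨hφm.comp_measurable hmeas, ?_⟩
  have h2 := integral_map hmeas.aemeasurable hφm.aestronglyMeasurable
  simp only [Function.comp_def]
  rw [← h2, hmap, integral_smul_measure, hφ, GaussianFourier.integral_cexp_neg_mul_sum_add hpi,
    div_self (by exact_mod_cast Real.pi_ne_zero), Complex.one_cpow, one_mul, rho_eq, ← hξ,
    ENNReal.toReal_ofReal (abs_nonneg _), abs_inv, nsq_eq_sum]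
  rw [Complex.real_smul]
  push_cast
  congr 2
  rw [Finset.mul_sum, Finset.sum_div]
  refine Finset.sum_congr rfl fun i _ => ?_
  have : (Real.pi : ℂ) ≠ 0 := by exact_mod_cast Real.pi_ne_zero
  field_simp
  rw [Complex.I_sq]; ring

/-- The periodization of a Gaussian. -/
noncomputable def perGauss {n : ℕ} (S : Matrix (Fin n) (Fin n) ℝ) (x : Fin n → ℝ) : ℝ :=
  ∑' u, gs S x u

lemma summable_gs {n : ℕ} {S : Matrix (Fin n) (Fin n) ℝ} (hS : IsUnit S.det) (x : Fin n → ℝ) :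
    Summable (gs S x) := summable_gauss_shift hS Real.pi_pos x

lemma perGauss_add_intCast' {n : ℕ} (S : Matrix (Fin n) (Fin n) ℝ) (x : Fin n → ℝ)
    (w : Fin n → ℤ) : perGauss S (x + intCast' w) = perGauss S x := by
  rw [perGauss, perGauss, ← (Equiv.addRight w).tsum_eq (gs S x)]
  congr 1; ext u
  simp only [gs, Equiv.coe_addRight, intCast'_add]
  congr 4; abel

lemma continuous_perGauss {n : ℕ} {S : Matrix (Fin n) (Fin n) ℝ} (hS : IsUnit S.det) :
    Continuous (perGauss S) := by
  obtain ⟨α, hα, h⟩ := exists_le_nsq_mulVec hS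
  have hc : Continuous fun x : Fin n → ℝ => nsq x := by
    simp only [nsq_eq_sum]; fun_prop
  refine continuous_iff_continuousAt.2 fun x0 => ?_
  set r := nsq x0 + 1
  have hopen : IsOpen {x : Fin n → ℝ | nsq x < r} := isOpen_lt hc continuous_const
  refine ContinuousOn.continuousAt (s := {x : Fin n → ℝ | nsq x < r}) ?_
    (hopen.mem_nhds (by simp [r]))
  refine continuousOn_tsum (u := fun v => Real.exp (Real.pi * α * r) *
    Real.exp (-(Real.pi * α / 2) * nsq (intCast' v))) (fun v => ?_)
    ((summable_gauss_pi (by positivity)).mul_left _) (fun v x hx => ?_)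
  · apply Continuous.continuousOn
    have : Continuous fun x : Fin n → ℝ => S *ᵥ (intCast' v + x) := by
      apply Continuous.matrix_mulVec <;> fun_prop
    exact Real.continuous_exp.comp (continuous_const.mul (hc.comp this))
  · rw [Real.norm_of_nonneg (gs_pos _ _ _).le, gs, ← Real.exp_add]
    apply Real.exp_le_exp.2
    have h1 := h (intCast' v + x)
    have hx : nsq x < r := hx
    have h2 : nsq (intCast' v) ≤ 2 * nsq (intCast' v + x) + 2 * nsq x := by
      have h3 := nsq_nonneg (intCast' v + (2 : ℝ) • x)
      have h4 := nsq_add (intCast' v) x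
      rw [nsq_add, nsq_smul, dotProduct_smul, smul_eq_mul] at h3
      linarith
    have hp := Real.pi_pos
    have h5 : Real.pi * (α * nsq (intCast' v + x)) ≤ Real.pi * nsq (S *ᵥ (intCast' v + x)) := by
      gcongr
    have h6 : Real.pi * α * nsq (intCast' v) ≤
      Real.pi * α * (2 * nsq (intCast' v + x) + 2 * r) := by gcongr; linarith
    linarith

lemma rho_eq_gs {n : ℕ} (S : Matrix (Fin n) (Fin n) ℝ) (z : Fin n → ℤ) :
    rho S (intCast' z) = gs (Sᵀ)⁻¹ 0 z := by
  rw [rho_eq, gs, add_zero]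

lemma summable_rho {n : ℕ} {S : Matrix (Fin n) (Fin n) ℝ} (hS : IsUnit S.det) :
    Summable fun z : Fin n → ℤ => rho S (intCast' z) := by
  simp only [rho_eq_gs]
  exact summable_gs (by
    rw [Matrix.isUnit_nonsing_inv_det_iff, Matrix.det_transpose]; exact hS) 0

lemma mFourier_coe {n : ℕ} (z : Fin n → ℤ) (x : Fin n → ℝ) :
    UnitAddTorus.mFourier z (fun i => (x i : UnitAddCircle)) =
      Complex.exp (2 * Real.pi * Complex.I * (intCast' z ⬝ᵥ x : ℝ)) := by
  simp only [UnitAddTorus.mFourier, ContinuousMap.coe_mk, fourier_coe_apply]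
  rw [← Complex.exp_sum]
  congr 1
  simp only [dotProduct, intCast']
  push_cast
  rw [Finset.mul_sum]
  exact Finset.sum_congr rfl fun i _ => by ring

/-- Poisson summation for Gaussians on `ℤⁿ`. -/
lemma poisson_gauss {n : ℕ} {S : Matrix (Fin n) (Fin n) ℝ} (hS : IsUnit S.det) (θ : Fin n → ℝ) :
    HasSum (fun z : Fin n → ℤ => ((rho S (intCast' z) : ℝ) : ℂ) *
      Complex.exp (2 * Real.pi * Complex.I * (intCast' z ⬝ᵥ θ : ℝ)))
      ((|S.det| * perGauss S θ : ℝ) : ℂ) := by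
  set π : (Fin n → ℝ) → UnitAddTorus (Fin n) := fun x i => (x i : UnitAddCircle) with hπ
  have hq : IsOpenQuotientMap π :=
    IsOpenQuotientMap.piMap fun _ => QuotientAddGroup.isOpenQuotientMap_mk
  set F0 : C(Fin n → ℝ, ℂ) := ⟨fun x => ((perGauss S x : ℝ) : ℂ),
    Complex.continuous_ofReal.comp (continuous_perGauss hS)⟩ with hF0
  have hfac : Function.FactorsThrough F0 π := by
    intro x y hxy
    have : ∀ i, ∃ w : ℤ, x i = y i + w := fun i => by
      have h1 : ((x i : ℝ) : UnitAddCircle) = (y i : ℝ) := congrFun hxy i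
      rw [← sub_eq_zero, ← AddCircle.coe_sub, AddCircle.coe_eq_zero_iff] at h1
      obtain ⟨w, hw⟩ := h1
      exact ⟨w, by rw [zsmul_eq_mul, mul_one] at hw; linarith⟩
    choose w hw using this
    have : x = y + intCast' w := by ext i; simp [hw, intCast']
    rw [this]
    simp only [hF0, ContinuousMap.coe_mk, perGauss_add_intCast']
  set πc : C(Fin n → ℝ, UnitAddTorus (Fin n)) := ⟨π, hq.continuous⟩
  have hqc : Topology.IsQuotientMap πc := hq.isQuotientMap
  set F := hqc.lift F0 hfac with hF
  have hFc : ∀ x, F (π x) = (perGauss S x : ℝ) := fun x =>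
    congrFun (congrArg DFunLike.coe (hqc.lift_comp F0 hfac)) x
  have hcoeff : ∀ z : Fin n → ℤ, UnitAddTorus.mFourierCoeff F z =
      ((|S.det|⁻¹ * rho S (intCast' z) : ℝ) : ℂ) := by
    intro z
    rw [UnitAddTorus.mFourierCoeff_eq_integral F z 0, ← (gauss_fourier hS (intCast' z)).2,
      ← integral_unitBox_tsum (gauss_fourier hS (intCast' z)).1]
    change ∫ x in unitBox (0 : Fin n → ℝ), _ = _
    congr 1
    ext x
    rw [mFourier_coe, show F (fun i => (x i : UnitAddCircle)) = _ from hFc x, perGauss,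
      Complex.ofReal_tsum, smul_eq_mul, ← tsum_mul_left]
    congr 1; ext u
    congr 1
    · rw [dotProduct_add, intCast'_neg, neg_dotProduct, intCast'_dotProduct]
      push_cast
      rw [mul_add, Complex.exp_add, show Complex.exp (-2 * Real.pi * Complex.I * ((z ⬝ᵥ u : ℤ) : ℂ)) = 1 by
        rw [Complex.exp_eq_one_iff]; exact ⟨-(z ⬝ᵥ u), by push_cast; ring⟩, mul_one]
      congr 1; ring
    · rw [gs, add_comm]
  have hsum : Summable (UnitAddTorus.mFourierCoeff F) := by
    rw [funext hcoeff]
    exact Complex.ofRealCLM.summable ((summable_rho hS).mul_left _)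
  have h := UnitAddTorus.hasSum_mFourier_series_apply_of_summable hsum (π θ)
  rw [hFc] at h
  have h2 := h.mul_left ((|S.det| : ℝ) : ℂ)
  have hd : (|S.det| : ℝ) ≠ 0 := abs_ne_zero.2 hS.ne_zero
  have hd' : ((|S.det| : ℝ) : ℂ) ≠ 0 := by exact_mod_cast hd
  rw [← Complex.ofReal_mul] at h2
  refine h2.congr_fun ?_ |> fun h => h
  intro z
  rw [hcoeff, hπ, mFourier_coe, smul_eq_mul]
  push_cast
  field_simp

lemma hasSum_rho_cos {n : ℕ} {S : Matrix (Fin n) (Fin n) ℝ} (hS : IsUnit S.det)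
    (θ : Fin n → ℝ) :
    HasSum (fun z : Fin n → ℤ => rho S (intCast' z) * Real.cos (2 * Real.pi * (intCast' z ⬝ᵥ θ)))
      (|S.det| * perGauss S θ) := by
  have h := Complex.hasSum_re (poisson_gauss hS θ)
  rw [Complex.ofReal_re] at h
  refine h.congr_fun ?_ |> fun h => h
  intro z
  rw [Complex.re_ofReal_mul,
    show (2 * Real.pi * Complex.I * (intCast' z ⬝ᵥ θ : ℝ) : ℂ) =
      ((2 * Real.pi * (intCast' z ⬝ᵥ θ) : ℝ) : ℂ) * Complex.I by push_cast; ring,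
    Complex.exp_ofReal_mul_I_re]

lemma hasSum_rho {n : ℕ} {S : Matrix (Fin n) (Fin n) ℝ} (hS : IsUnit S.det) :
    HasSum (fun z : Fin n → ℤ => rho S (intCast' z)) (|S.det| * perGauss S 0) := by
  simpa using hasSum_rho_cos hS 0

lemma perGauss_le_zero {n : ℕ} {S : Matrix (Fin n) (Fin n) ℝ} (hS : IsUnit S.det)
    (θ : Fin n → ℝ) : perGauss S θ ≤ perGauss S 0 := by
  have h := hasSum_le (fun z => ?_) (hasSum_rho_cos hS θ) (hasSum_rho hS)
  · exact le_of_mul_le_mul_left h (abs_pos.2 hS.ne_zero)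
  · exact mul_le_of_le_one_right (rho_pos _ _).le (Real.cos_le_one _)

lemma one_le_perGauss_zero {n : ℕ} {S : Matrix (Fin n) (Fin n) ℝ} (hS : IsUnit S.det) :
    1 ≤ perGauss S 0 := by
  have := (summable_gs hS 0).le_tsum 0 (fun _ _ => (gs_pos _ _ _).le)
  rw [perGauss]
  refine le_trans (le_of_eq ?_) this
  simp [gs, intCast'_zero, nsq]

lemma isUnit_det_smul {n : ℕ} {S : Matrix (Fin n) (Fin n) ℝ} (hS : IsUnit S.det) {a : ℝ}
    (ha : a ≠ 0) : IsUnit (a • S).det := by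
  rw [Matrix.det_smul]
  exact (IsUnit.mk0 _ (pow_ne_zero _ ha)).mul hS

lemma tsum_rho_pos {n : ℕ} {S : Matrix (Fin n) (Fin n) ℝ} (hS : IsUnit S.det) :
    0 < ∑' z : Fin n → ℤ, rho S (intCast' z) :=
  (summable_rho hS).tsum_pos (fun _ => (rho_pos _ _).le) 0 (rho_pos _ _)

/-- Characteristic function bound at points that are far from the integer lattice. -/
lemma tsum_rho_cos_le {n : ℕ} {S : Matrix (Fin n) (Fin n) ℝ} (hS : IsUnit S.det) {s : ℝ}
    (hs0 : 0 < s) (hs : ∀ x, s * nsq x ≤ nsq (S *ᵥ x))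
    (hns : 1000 * n * Real.exp (-(Real.pi / 2) * s) ≤ 1)
    (hn : 1 ≤ n) {θ : Fin n → ℝ} (hθ : ∀ u : Fin n → ℤ, 1 ≤ nsq (S *ᵥ (intCast' u + θ))) :
    ∑' z : Fin n → ℤ, rho S (intCast' z) * Real.cos (2 * Real.pi * (intCast' z ⬝ᵥ θ)) ≤
      1 / 4 * ∑' z : Fin n → ℤ, rho S (intCast' z) := by
  rw [(hasSum_rho_cos hS θ).tsum_eq, (hasSum_rho hS).tsum_eq]
  have hpi := Real.pi_pos
  have hpi3 := Real.pi_gt_three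
  set S' := (√2)⁻¹ • S
  have hS' : IsUnit S'.det := isUnit_det_smul hS (by positivity)
  have hgs' : ∀ x v, gs S' x v = Real.exp (-(Real.pi / 2) * nsq (S *ᵥ (intCast' v + x))) := by
    intro x v
    rw [gs, Matrix.smul_mulVec, nsq_smul, inv_pow, Real.sq_sqrt (by norm_num)]
    congr 1; ring
  have h1 : perGauss S θ ≤ Real.exp (-(Real.pi / 2)) * perGauss S' θ := by
    rw [perGauss, perGauss, ← tsum_mul_left]
    refine (summable_gs hS θ).tsum_le_tsum (fun v => ?_) ((summable_gs hS' θ).mul_left _)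
    rw [hgs', gs, ← Real.exp_add]
    apply Real.exp_le_exp.2
    nlinarith [hθ v]
  have h2 := perGauss_le_zero hS' θ
  set q := Real.exp (-(Real.pi / 2) * s)
  have hq0 : 0 < q := Real.exp_pos _
  have hn1 : (1 : ℝ) ≤ n := by exact_mod_cast hn
  have hq : q ≤ 1 / 1000 := by nlinarith
  have h3 : perGauss S' 0 ≤ (1 + 3 * q) ^ n := by
    have h4 : perGauss S' 0 ≤ ∑' v : Fin n → ℤ, Real.exp (-(Real.pi / 2 * s) * nsq (intCast' v)) := by
      rw [perGauss]
      refine (summable_gs hS' 0).tsum_le_tsum (fun v => ?_) (summable_gauss_pi (by positivity))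
      rw [hgs', add_zero]
      apply Real.exp_le_exp.2
      have := hs (intCast' v)
      nlinarith
    refine h4.trans ?_
    rw [tsum_gauss_pi (by positivity)]
    refine pow_le_pow_left₀ (tsum_nonneg fun _ => (Real.exp_pos _).le) ?_ n
    refine (tsum_gauss_int_le (by positivity)).trans ?_
    rw [← neg_mul]
    have : q / (1 - q) ≤ 3 / 2 * q := by
      rw [div_le_iff₀ (by linarith)]; nlinarith
    linarith
  have h5 : (1 + 3 * q) ^ n ≤ Real.exp (1 / 100) := by
    have : 1 + 3 * q ≤ Real.exp (3 * q) := by linarith [Real.add_one_le_exp (3 * q)]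
    refine (pow_le_pow_left₀ (by positivity) this n).trans ?_
    rw [← Real.exp_nat_mul]
    apply Real.exp_le_exp.2
    nlinarith
  have h6 : Real.exp (-(Real.pi / 2)) * Real.exp (1 / 100) ≤ 1 / 4 := by
    rw [← Real.exp_add]
    have h7 : Real.exp (-(Real.pi / 2) + 1 / 100) ≤ Real.exp (-(1.49 : ℝ)) :=
      Real.exp_le_exp.2 (by linarith)
    refine h7.trans ?_
    rw [Real.exp_neg, inv_le_comm₀ (Real.exp_pos _) (by norm_num)]
    have h8 := Real.exp_one_gt_d9
    have h9 : Real.exp 1.49 = Real.exp 1 * Real.exp 0.49 := by rw [← Real.exp_add]; norm_num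
    have h10 := Real.add_one_le_exp (0.49 : ℝ)
    rw [h9]
    nlinarith
  have h11 : perGauss S θ ≤ 1 / 4 := by
    calc perGauss S θ ≤ Real.exp (-(Real.pi / 2)) * Real.exp (1 / 100) :=
          h1.trans (mul_le_mul_of_nonneg_left (h2.trans (h3.trans h5)) (Real.exp_pos _).le)
      _ ≤ _ := h6
  have h12 := one_le_perGauss_zero hS
  have h13 := abs_nonneg S.det
  nlinarith

lemma tsum_rho_two_smul_le {n : ℕ} {S : Matrix (Fin n) (Fin n) ℝ} (hS : IsUnit S.det) :
    ∑' z : Fin n → ℤ, rho ((2 : ℝ) • S) (intCast' z) ≤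
      2 ^ n * ∑' z : Fin n → ℤ, rho S (intCast' z) := by
  have hS2 : IsUnit ((2 : ℝ) • S).det := isUnit_det_smul hS (by norm_num)
  rw [(hasSum_rho hS2).tsum_eq, (hasSum_rho hS).tsum_eq, Matrix.det_smul, abs_mul, mul_assoc,
    Fintype.card_fin, abs_of_pos (by positivity)]
  gcongr
  refine (summable_gs hS2 0).tsum_le_tsum (fun v => ?_) (summable_gs hS 0)
  rw [gs, gs, Matrix.smul_mulVec, nsq_smul]
  apply Real.exp_le_exp.2
  nlinarith [mul_nonneg Real.pi_pos.le (nsq_nonneg (S *ᵥ (intCast' v + 0)))]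

lemma rho_two_smul {n : ℕ} {S : Matrix (Fin n) (Fin n) ℝ} (hS : IsUnit S.det) (x : Fin n → ℝ) :
    rho ((2 : ℝ) • S) x = Real.exp (-(Real.pi / 4) * nsq ((Sᵀ)⁻¹ *ᵥ x)) := by
  rw [rho_eq, Matrix.transpose_smul]
  have : ((2 : ℝ) • Sᵀ)⁻¹ = (2⁻¹ : ℝ) • (Sᵀ)⁻¹ := by
    apply Matrix.inv_eq_right_inv
    rw [Matrix.smul_mul, Matrix.mul_smul, smul_smul,
      Matrix.mul_nonsing_inv _ (by rwa [Matrix.det_transpose])]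
    norm_num
  rw [this, Matrix.smul_mulVec, nsq_smul]
  congr 1; ring

/-- The discrete Gaussian distribution on `ℤⁿ` in the coordinates of the lattice basis. -/
noncomputable def dgauss {n : ℕ} (S : Matrix (Fin n) (Fin n) ℝ) (z : Fin n → ℤ) : ℝ :=
  rho S (intCast' z) / ∑' y : Fin n → ℤ, rho S (intCast' y)

/-- The squared norm `‖S⁻ᵀ y‖²` of an integer vector. -/
noncomputable def snorm {n : ℕ} (S : Matrix (Fin n) (Fin n) ℝ) (y : Fin n → ℤ) : ℝ :=
  nsq ((Sᵀ)⁻¹ *ᵥ intCast' y)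

lemma dgauss_nonneg {n : ℕ} {S : Matrix (Fin n) (Fin n) ℝ} (z : Fin n → ℤ) :
    0 ≤ dgauss S z :=
  div_nonneg (rho_pos _ _).le (tsum_nonneg fun _ => (rho_pos _ _).le)

lemma hasSum_dgauss {n : ℕ} {S : Matrix (Fin n) (Fin n) ℝ} (hS : IsUnit S.det) :
    HasSum (dgauss S) 1 := by
  have := (summable_rho hS).hasSum.div_const (∑' y : Fin n → ℤ, rho S (intCast' y))
  rwa [div_self (tsum_rho_pos hS).ne'] at this

/-- Tail bound for the discrete Gaussian. -/
lemma tsum_dgauss_tail_le {n : ℕ} {S : Matrix (Fin n) (Fin n) ℝ} (hS : IsUnit S.det) {t : ℝ} :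
    ∑' z : Fin n → ℤ, ENNReal.ofReal (if t < snorm S z then dgauss S z else 0) ≤
      ENNReal.ofReal (2 ^ n * Real.exp (-(3 * Real.pi / 4) * t)) := by
  have hS2 : IsUnit ((2 : ℝ) • S).det := isUnit_det_smul hS (by norm_num)
  set D := ∑' y : Fin n → ℤ, rho S (intCast' y) with hD
  have hD0 : 0 < D := tsum_rho_pos hS
  have hsum := (summable_rho hS2).mul_left (Real.exp (-(3 * Real.pi / 4) * t) / D)
  have h1 : ∀ z : Fin n → ℤ, (if t < snorm S z then dgauss S z else 0) ≤
      Real.exp (-(3 * Real.pi / 4) * t) / D * rho ((2 : ℝ) • S) (intCast' z) := by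
    intro z
    split_ifs with h
    · rw [dgauss, ← hD, rho_two_smul hS, rho_eq, div_mul_eq_mul_div, ← Real.exp_add]
      refine div_le_div_of_nonneg_right (Real.exp_le_exp.2 ?_) hD0.le
      rw [snorm] at h
      nlinarith [Real.pi_pos]
    · have := rho_pos ((2 : ℝ) • S) (intCast' z)
      positivity
  refine (ENNReal.tsum_le_tsum fun z => ENNReal.ofReal_le_ofReal (h1 z)).trans ?_
  rw [← ENNReal.ofReal_tsum_of_nonneg (fun z => by
    have := rho_pos ((2 : ℝ) • S) (intCast' z); positivity) hsum, tsum_mul_left]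
  apply ENNReal.ofReal_le_ofReal
  rw [div_mul_eq_mul_div, div_le_iff₀ hD0]
  have := tsum_rho_two_smul_le hS
  have h3 := Real.exp_pos (-(3 * Real.pi / 4) * t)
  nlinarith

lemma tsum_dgauss_cos_le {n : ℕ} {S : Matrix (Fin n) (Fin n) ℝ} (hS : IsUnit S.det) {s : ℝ}
    (hs0 : 0 < s) (hs : ∀ x, s * nsq x ≤ nsq (S *ᵥ x))
    (hns : 1000 * n * Real.exp (-(Real.pi / 2) * s) ≤ 1)
    (hn : 1 ≤ n) {θ : Fin n → ℝ} (hθ : ∀ u : Fin n → ℤ, 1 ≤ nsq (S *ᵥ (intCast' u + θ))) :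
    ∑' z : Fin n → ℤ, ENNReal.ofReal (dgauss S z *
      ((1 + Real.cos (2 * Real.pi * (intCast' z ⬝ᵥ θ))) / 2)) ≤ ENNReal.ofReal (5 / 8) := by
  set D := ∑' y : Fin n → ℤ, rho S (intCast' y) with hD
  have hD0 : 0 < D := tsum_rho_pos hS
  have h1 := tsum_rho_cos_le hS hs0 hs hns hn hθ
  have hc := hasSum_rho_cos hS θ
  rw [hc.tsum_eq] at h1
  have h2 := (((hasSum_dgauss hS).add (hc.div_const D)).div_const 2)
  have h3 : ∀ z : Fin n → ℤ, dgauss S z * ((1 + Real.cos (2 * Real.pi * (intCast' z ⬝ᵥ θ))) / 2) =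
      (dgauss S z + rho S (intCast' z) * Real.cos (2 * Real.pi * (intCast' z ⬝ᵥ θ)) / D) / 2 := by
    intro z; rw [dgauss, ← hD]; ring
  have h4 : ∀ z : Fin n → ℤ, 0 ≤
      dgauss S z * ((1 + Real.cos (2 * Real.pi * (intCast' z ⬝ᵥ θ))) / 2) := fun z =>
    mul_nonneg (dgauss_nonneg z) (by linarith [Real.neg_one_le_cos (2 * Real.pi * (intCast' z ⬝ᵥ θ))])
  rw [← ENNReal.ofReal_tsum_of_nonneg h4 (by simp_rw [h3]; exact h2.summable)]
  apply ENNReal.ofReal_le_ofReal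
  simp_rw [h3]
  rw [h2.tsum_eq]
  have : |S.det| * perGauss S θ / D ≤ 1 / 4 := by
    rw [div_le_iff₀ hD0]; exact h1
  linarith

/-- The additive character `x ↦ exp(2πix)`. -/
noncomputable def echar (x : ℝ) : ℂ := Complex.exp ((2 * Real.pi * x : ℝ) * Complex.I)

lemma echar_add (x y : ℝ) : echar (x + y) = echar x * echar y := by
  rw [echar, echar, echar, ← Complex.exp_add]; congr 1; push_cast; ring

lemma echar_sum {ι : Type*} (s : Finset ι) (f : ι → ℝ) :
    echar (∑ i ∈ s, f i) = ∏ i ∈ s, echar (f i) := by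
  simp only [echar]
  rw [← Complex.exp_sum, Finset.mul_sum]; push_cast; rw [Finset.sum_mul]

lemma echar_nat_mul (a : ℕ) (x : ℝ) : echar (a * x) = echar x ^ a := by
  rw [echar, echar, ← Complex.exp_nat_mul]; congr 1; push_cast; ring

lemma echar_neg (x : ℝ) : echar (-x) = starRingEnd ℂ (echar x) := by
  rw [echar, echar, ← Complex.exp_conj, map_mul, Complex.conj_ofReal, Complex.conj_I]
  congr 1; push_cast; ring

lemma echar_re (x : ℝ) : (echar x).re = Real.cos (2 * Real.pi * x) := by
  rw [echar, Complex.exp_ofReal_mul_I_re]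

lemma echar_eq_one_iff {x : ℝ} : echar x = 1 ↔ ∃ k : ℤ, x = k := by
  rw [echar, Complex.exp_eq_one_iff]
  have hpi := Real.pi_ne_zero
  refine exists_congr fun k => ?_
  rw [show (k : ℂ) * (2 * Real.pi * Complex.I) = ((2 * Real.pi * k : ℝ) : ℂ) * Complex.I by
    push_cast; ring, mul_left_inj' Complex.I_ne_zero, Complex.ofReal_inj]
  constructor
  · intro h; exact mul_left_cancel₀ (by positivity) h
  · rintro rfl; rfl

lemma normSq_echar_sub (x : ℝ) : Complex.normSq (1 + echar x) = 2 + 2 * Real.cos (2 * Real.pi * x) := by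
  rw [Complex.normSq_apply, Complex.add_re, Complex.add_im, echar_re, echar,
    Complex.exp_ofReal_mul_I_im, Complex.one_re, Complex.one_im]
  nlinarith [Real.sin_sq_add_cos_sq (2 * Real.pi * x)]

lemma sum_echar_eq_zero {q : ℕ} (hq : 0 < q) {w : ℤ} (hw : ¬ (q : ℤ) ∣ w) :
    ∑ a : Fin q, echar ((a : ℕ) / (q : ℝ) * w) = 0 := by
  have hq' : (q : ℝ) ≠ 0 := by positivity
  have h1 : echar (w / q) ≠ 1 := by
    rw [Ne, echar_eq_one_iff]
    rintro ⟨k, hk⟩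
    rw [div_eq_iff hq'] at hk
    exact hw ⟨k, by rw [mul_comm]; exact_mod_cast hk⟩
  have h2 : echar (w / q) ^ q = 1 := by
    rw [← echar_nat_mul, echar_eq_one_iff]; exact ⟨w, by field_simp⟩
  rw [Fin.sum_univ_eq_sum_range (fun a => echar ((a : ℝ) / (q : ℝ) * w))]
  simp only [show ∀ a : ℕ, echar ((a : ℝ) / (q : ℝ) * w) = echar (w / q) ^ a from fun a => by
    rw [← echar_nat_mul]; congr 1; ring]
  rw [geom_sum_eq h1, h2, sub_self, zero_div]

/-- The point `t / q` of the torus grid. -/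
noncomputable def gridPt {n q : ℕ} (t : Fin n → Fin q) : Fin n → ℝ := fun i => (t i : ℕ) / (q : ℝ)

lemma sum_echar_grid_eq_zero {n q : ℕ} (hq : 0 < q) {w : Fin n → ℤ} {i₀ : Fin n}
    (hw : ¬ (q : ℤ) ∣ w i₀) : ∑ t : Fin n → Fin q, echar (intCast' w ⬝ᵥ gridPt t) = 0 := by
  have := Finset.prod_univ_sum (fun _ : Fin n => (Finset.univ : Finset (Fin q)))
    (fun i a => echar ((a : ℕ) / (q : ℝ) * w i))
  rw [Finset.prod_eq_zero (Finset.mem_univ i₀) (sum_echar_eq_zero hq hw),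
    Fintype.piFinset_univ] at this
  rw [this]
  refine Finset.sum_congr rfl fun t _ => ?_
  rw [← echar_sum]
  congr 1
  simp [dotProduct, gridPt, intCast', mul_comm]

/-- The (unnormalised) Fejér kernel `|∑_{a<L} e(ax)|²`. -/
noncomputable def fejer (L : ℕ) (x : ℝ) : ℝ :=
  Complex.normSq (∑ a ∈ Finset.range L, echar x ^ a)

lemma fejer_nonneg (L : ℕ) (x : ℝ) : 0 ≤ fejer L x := Complex.normSq_nonneg _

lemma fejer_two_pow (I : ℕ) (x : ℝ) :
    fejer (2 ^ I) x = ∏ i ∈ Finset.range I, (2 + 2 * Real.cos (2 * Real.pi * (2 ^ i * x))) := by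
  have h : ∀ z : ℂ, ∑ a ∈ Finset.range (2 ^ I), z ^ a = ∏ i ∈ Finset.range I, (1 + z ^ 2 ^ i) := by
    intro z
    induction I with
    | zero => simp
    | succ I ih =>
      rw [Finset.prod_range_succ, ← ih, pow_succ, mul_two, Finset.sum_range_add, mul_add, mul_one,
        Finset.sum_mul]
      congr 1
      exact Finset.sum_congr rfl fun a _ => by rw [pow_add, mul_comm]
  rw [fejer, h, map_prod]
  refine Finset.prod_congr rfl fun i _ => ?_
  rw [← normSq_echar_sub, ← echar_nat_mul]; push_cast; rfl

lemma fejer_two_pow_le {I i : ℕ} (hi : i < I) (x : ℝ) :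
    fejer (2 ^ I) x ≤ (2 ^ I) ^ 2 * ((1 + Real.cos (2 * Real.pi * (2 ^ i * x))) / 2) := by
  have hi' : i ∈ Finset.range I := Finset.mem_range.2 hi
  rw [fejer_two_pow, ← Finset.mul_prod_erase _ _ hi']
  have h1 : ∏ j ∈ (Finset.range I).erase i, (2 + 2 * Real.cos (2 * Real.pi * (2 ^ j * x))) ≤
      4 ^ (I - 1) := by
    refine (Finset.prod_le_prod (fun j _ => ?_) (fun j _ => ?_ : ∀ j ∈ _, _ ≤ (4 : ℝ))).trans_eq ?_
    · linarith [Real.neg_one_le_cos (2 * Real.pi * (2 ^ j * x))]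
    · linarith [Real.cos_le_one (2 * Real.pi * (2 ^ j * x))]
    · rw [Finset.prod_const, Finset.card_erase_of_mem hi', Finset.card_range]
  have h2 : ((2 : ℝ) ^ I) ^ 2 = 4 * 4 ^ (I - 1) := by
    rw [← pow_succ', Nat.sub_add_cancel (by omega), ← pow_mul, mul_comm, pow_mul]; norm_num
  rw [h2]
  have h3 : 0 ≤ 2 + 2 * Real.cos (2 * Real.pi * (2 ^ i * x)) := by
    linarith [Real.neg_one_le_cos (2 * Real.pi * (2 ^ i * x))]
  calc _ ≤ (2 + 2 * Real.cos (2 * Real.pi * (2 ^ i * x))) * 4 ^ (I - 1) :=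
        mul_le_mul_of_nonneg_left h1 h3
    _ = _ := by ring

/-- A point of `ℤⁿ` is a small combination of the columns `Z_j`, `j ∈ K`, as soon as the Fourier
mass away from its "good" frequencies is small. -/
lemma exists_hit {n m : ℕ} {Z : Matrix (Fin n) (Fin m) ℤ} {K : Finset (Fin m)} {L q N : ℕ}
    (hL : 0 < L) (hq : K.card * (L * N) + N < q)
    (hZ : ∀ i, ∀ j ∈ K, |Z i j| ≤ N) (far : Finset (Fin n → Fin q))
    (hfar : ∑ t ∈ far, ∏ j ∈ K, fejer L (intCast' (fun i => Z i j) ⬝ᵥ gridPt t) <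
      ((L : ℝ) ^ 2) ^ K.card / 3)
    {y : Fin n → ℤ} (hy : ∀ i, |y i| ≤ N)
    (hcos : ∀ t, t ∉ far → 1 / 2 ≤ Real.cos (2 * Real.pi * (intCast' y ⬝ᵥ gridPt t))) :
    ∃ v : Fin m → ℤ, Z *ᵥ v = y ∧ (∀ j, |v j| ≤ L) ∧ ∀ j ∉ K, v j = 0 := by
  by_contra! hno
  set W : (Fin n → Fin q) → ℝ :=
    fun t => ∏ j ∈ K, fejer L (intCast' (fun i => Z i j) ⬝ᵥ gridPt t) with hW
  set A : Finset (Fin m → ℕ) :=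
    Fintype.piFinset (fun j => if j ∈ K then Finset.range L else {0}) with hA
  have hq0 : 0 < q := by omega
  set F : (Fin n → Fin q) → ℂ :=
    fun t => ∑ x ∈ A, echar (intCast' (Z *ᵥ (fun j => (x j : ℤ))) ⬝ᵥ gridPt t) with hF
  have hFW : ∀ t, Complex.normSq (F t) = W t := by
    intro t
    have h1 : ∀ x : Fin m → ℕ, echar (intCast' (Z *ᵥ (fun j => (x j : ℤ))) ⬝ᵥ gridPt t) =
        ∏ j, echar (intCast' (fun i => Z i j) ⬝ᵥ gridPt t) ^ x j := by
      intro x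
      simp only [← echar_nat_mul]
      rw [← echar_sum]
      congr 1
      simp only [dotProduct, intCast', Matrix.mulVec, Int.cast_sum, Int.cast_mul, Int.cast_natCast,
        Finset.sum_mul, Finset.mul_sum]
      rw [Finset.sum_comm]
      exact Finset.sum_congr rfl fun j _ => Finset.sum_congr rfl fun i _ => by ring
    simp only [hF, h1, hA]
    rw [← Finset.prod_univ_sum (f := fun j a => echar (intCast' (fun i => Z i j) ⬝ᵥ gridPt t) ^ a),
      map_prod, hW, ← Finset.prod_subset (Finset.subset_univ K)]
    · exact Finset.prod_congr rfl fun j hj => by rw [if_pos hj, fejer]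
    · intro j _ hj; simp [hj]
  have hzero : ∑ t, (W t : ℂ) * echar (-(intCast' y ⬝ᵥ gridPt t)) = 0 := by
    have h2 : ∀ t, (W t : ℂ) * echar (-(intCast' y ⬝ᵥ gridPt t)) = ∑ x ∈ A, ∑ x' ∈ A,
        echar (intCast' (Z *ᵥ ((fun j => (x j : ℤ)) - (fun j => (x' j : ℤ))) - y) ⬝ᵥ gridPt t) := by
      intro t
      rw [← hFW, Complex.normSq_eq_conj_mul_self, mul_comm (starRingEnd ℂ _), hF]
      simp only [map_sum, ← echar_neg]
      rw [Finset.sum_mul_sum, Finset.sum_mul]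
      refine Finset.sum_congr rfl fun x _ => ?_
      rw [Finset.sum_mul]
      refine Finset.sum_congr rfl fun x' _ => ?_
      rw [← echar_add, ← echar_add]
      congr 1
      rw [Matrix.mulVec_sub, intCast'_sub, intCast'_sub, sub_dotProduct, sub_dotProduct]
      ring
    simp only [h2]
    rw [Finset.sum_comm]
    refine Finset.sum_eq_zero fun x hx => ?_
    rw [Finset.sum_comm]
    refine Finset.sum_eq_zero fun x' hx' => ?_
    set v : Fin m → ℤ := (fun j => (x j : ℤ)) - (fun j => (x' j : ℤ)) with hv
    have hvK : ∀ j ∉ K, v j = 0 := by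
      intro j hj
      have h1 := Fintype.mem_piFinset.1 hx j
      have h2 := Fintype.mem_piFinset.1 hx' j
      simp only [hj, if_false, Finset.mem_singleton] at h1 h2
      simp [hv, h1, h2]
    have hvL : ∀ j, |v j| ≤ L := by
      intro j
      by_cases hj : j ∈ K
      · have h1 := Fintype.mem_piFinset.1 hx j
        have h2 := Fintype.mem_piFinset.1 hx' j
        simp only [hj, if_true, Finset.mem_range] at h1 h2
        simp only [hv, Pi.sub_apply, abs_le]; omega
      · simp [hvK j hj]
    have hne : Z *ᵥ v ≠ y := fun h => by
      obtain ⟨j, hj, hj'⟩ := hno v h hvL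
      exact hj' (hvK j hj)
    obtain ⟨i, hi⟩ := Function.ne_iff.1 hne
    refine sum_echar_grid_eq_zero hq0 (i₀ := i) fun hdvd => hi ?_
    have hb : |(Z *ᵥ v) i| ≤ K.card * (L * N) := by
      have : (Z *ᵥ v) i = ∑ j ∈ K, Z i j * v j := by
        rw [Matrix.mulVec, dotProduct, ← Finset.sum_subset (Finset.subset_univ K)]
        intro j _ hj; simp [hvK j hj]
      rw [this]
      refine (Finset.abs_sum_le_sum_abs _ _).trans ?_
      refine (Finset.sum_le_card_nsmul _ _ ((L : ℤ) * N) fun j hj => ?_).trans_eq (by simp)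
      rw [abs_mul, mul_comm]
      exact mul_le_mul (hvL j) (hZ i j hj) (abs_nonneg _) (by positivity)
    have hd := Int.eq_zero_of_abs_lt_dvd hdvd (by
      rw [Pi.sub_apply]
      have hq' : (K.card * (L * N) + N : ℤ) < q := by exact_mod_cast hq
      exact (abs_sub _ _).trans_lt (by linarith [hy i]))
    exact sub_eq_zero.1 hd
  have hre : ∑ t, W t * Real.cos (2 * Real.pi * (intCast' y ⬝ᵥ gridPt t)) = 0 := by
    have := congrArg Complex.re hzero
    rw [Complex.re_sum] at this
    simpa [Complex.re_ofReal_mul, echar_re] using this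
  have hW0 : ∀ t, 0 ≤ W t := fun t => Finset.prod_nonneg fun j _ => fejer_nonneg _ _
  have hall : ((L : ℝ) ^ 2) ^ K.card ≤ ∑ t, W t := by
    refine le_trans (le_of_eq ?_)
      (Finset.single_le_sum (fun t _ => hW0 t) (Finset.mem_univ (fun _ => ⟨0, hq0⟩)))
    have : gridPt (fun _ : Fin n => (⟨0, hq0⟩ : Fin q)) = 0 := by ext; simp [gridPt]
    simp only [hW, this, dotProduct_zero]
    rw [Finset.prod_const]
    congr 1
    have h1 : echar 0 = 1 := echar_eq_one_iff.2 ⟨0, by simp⟩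
    simp [fejer, h1, Complex.normSq_natCast, sq]
  have hsplit : ∑ t, W t * Real.cos (2 * Real.pi * (intCast' y ⬝ᵥ gridPt t)) ≥
      ∑ t, W t * (1 / 2) - 3 / 2 * ∑ t ∈ far, W t := by
    have : 3 / 2 * ∑ t ∈ far, W t = ∑ t, if t ∈ far then 3 / 2 * W t else 0 := by
      rw [Finset.mul_sum, Finset.sum_ite_mem, Finset.univ_inter]
    rw [this, ← Finset.sum_sub_distrib]
    refine Finset.sum_le_sum fun t _ => ?_
    by_cases ht : t ∈ far
    · rw [if_pos ht]
      nlinarith [hW0 t, Real.neg_one_le_cos (2 * Real.pi * (intCast' y ⬝ᵥ gridPt t))]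
    · rw [if_neg ht, sub_zero]
      exact mul_le_mul_of_nonneg_left (hcos t ht) (hW0 t)
  rw [hre, ← Finset.sum_mul] at hsplit
  linarith

lemma sqrt_nsq_smul {k : ℕ} (a : ℝ) (x : Fin k → ℝ) : √(nsq (a • x)) = |a| * √(nsq x) := by
  rw [nsq_smul, Real.sqrt_mul (sq_nonneg a), Real.sqrt_sq_eq_abs]

/-- The Euclidean norm of an integer vector. -/
noncomputable def vnorm {k : ℕ} (v : Fin k → ℤ) : ℝ := √(nsq (intCast' v))

lemma vnorm_add_le {k : ℕ} (v w : Fin k → ℤ) : vnorm (v + w) ≤ vnorm v + vnorm w := by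
  rw [vnorm, intCast'_add]; exact sqrt_nsq_add_le _ _

lemma vnorm_smul {k : ℕ} (a : ℤ) (v : Fin k → ℤ) : vnorm (a • v) = |(a : ℝ)| * vnorm v := by
  rw [vnorm, intCast'_smul, sqrt_nsq_smul, vnorm]

lemma vnorm_two_smul_add_le {k : ℕ} (v w : Fin k → ℤ) :
    vnorm ((2 : ℤ) • v + w) ≤ 2 * vnorm v + vnorm w := by
  refine (vnorm_add_le _ _).trans_eq ?_
  rw [vnorm_smul]; norm_num

lemma vnorm_neg {k : ℕ} (v : Fin k → ℤ) : vnorm (-v) = vnorm v := by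
  rw [vnorm, intCast'_neg, nsq_neg, vnorm]

lemma vnorm_sub_le {k : ℕ} (v w : Fin k → ℤ) : vnorm (v - w) ≤ vnorm v + vnorm w := by
  rw [sub_eq_add_neg, ← vnorm_neg w]; exact vnorm_add_le _ _

lemma vnorm_single {k : ℕ} (j : Fin k) : vnorm (Pi.single j 1) = 1 := by
  rw [vnorm, nsq, intCast'_dotProduct]; simp

lemma sqrt_snorm_add_le {n : ℕ} (S : Matrix (Fin n) (Fin n) ℝ) (x y : Fin n → ℤ) :
    √(snorm S (x + y)) ≤ √(snorm S x) + √(snorm S y) := by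
  rw [snorm, intCast'_add, Matrix.mulVec_add]; exact sqrt_nsq_add_le _ _

lemma sqrt_snorm_smul {n : ℕ} (S : Matrix (Fin n) (Fin n) ℝ) (a : ℤ) (x : Fin n → ℤ) :
    √(snorm S (a • x)) = |(a : ℝ)| * √(snorm S x) := by
  rw [snorm, intCast'_smul, Matrix.mulVec_smul, sqrt_nsq_smul, snorm]

/-- `x = 2 x' + r` with `x'` the truncated half of `x`. -/
lemma eq_two_smul_tdiv_add {n : ℕ} (x : Fin n → ℤ) :
    x = (2 : ℤ) • (fun i => (x i).tdiv 2) + fun i => (x i).tmod 2 := by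
  ext i; simp [Int.mul_tdiv_add_tmod]

lemma abs_tmod_two_le (a : ℤ) : |a.tmod 2| ≤ 1 := by
  have := Int.natAbs_tmod a 2
  have h2 : a.natAbs % (2 : ℤ).natAbs < 2 := Nat.mod_lt _ (by norm_num)
  rw [abs_le]
  omega

/-- If all short integer vectors `y` are short combinations of the columns of `Z`, a functional
vanishing on the short vectors of `ker Z` factors through `Z`. -/
lemma exists_eq_of_hits {n m : ℕ} {S : Matrix (Fin n) (Fin n) ℝ} {Z : Matrix (Fin n) (Fin m) ℤ}
    {ρ ρ' a₀ l : ℝ} {t : ℕ} (ha₀ : 0 ≤ a₀)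
    (hsmall : ∀ r : Fin n → ℤ, (∀ i, |r i| ≤ 1) → √(snorm S r) ≤ ρ / 2)
    (hhit : ∀ y : Fin n → ℤ, √(snorm S y) ≤ ρ → ∃ v, Z *ᵥ v = y ∧ vnorm v ≤ a₀)
    (hcol : ∀ j, √(snorm S (fun i => Z i j)) ≤ ρ') (ht : ρ' ≤ (2 ^ t + 1) * ρ / 2)
    (hl4 : 4 * a₀ ≤ l) (hl : 1 + (2 ^ (t + 1) - 1) * a₀ ≤ l)
    {w : Fin m → ℝ} (hw : ∀ b : Fin m → ℤ, Z *ᵥ b = 0 → vnorm b ≤ l → w ⬝ᵥ intCast' b = 0) :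
    ∃ a : Fin n → ℝ, ∀ j, w j = a ⬝ᵥ intCast' (fun i => Z i j) := by
  have hρ : 0 ≤ ρ := by
    have := (Real.sqrt_nonneg _).trans (hsmall 0 (by simp))
    linarith
  have hsmall' : ∀ r : Fin n → ℤ, (∀ i, |r i| ≤ 1) → √(snorm S r) ≤ ρ :=
    fun r hr => (hsmall r hr).trans (by linarith)
  have hhalf : ∀ (x : Fin n → ℤ) (c : ℝ), √(snorm S x) ≤ c →
      √(snorm S (fun i => (x i).tdiv 2)) ≤ (c + ρ / 2) / 2 := by
    intro x c hx
    have h1 : (2 : ℤ) • (fun i => (x i).tdiv 2) = x + (-1 : ℤ) • (fun i => (x i).tmod 2) := by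
      nth_rewrite 2 [eq_two_smul_tdiv_add x]
      simp
    have h2 := sqrt_snorm_smul S 2 (fun i => (x i).tdiv 2)
    rw [h1] at h2
    have h3 := sqrt_snorm_add_le S x ((-1 : ℤ) • (fun i => (x i).tmod 2))
    rw [sqrt_snorm_smul, h2] at h3
    have h4 := hsmall (fun i => (x i).tmod 2) fun i => abs_tmod_two_le _
    norm_num at h3
    linarith
  have hrep : ∀ i : Fin n, ∃ v, Z *ᵥ v = Pi.single i 1 ∧ vnorm v ≤ a₀ := by
    intro i
    refine hhit _ (hsmall' _ fun j => ?_)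
    by_cases h : j = i
    · subst h; simp
    · simp [h]
  choose e he hea using hrep
  set a : Fin n → ℝ := fun i => w ⬝ᵥ intCast' (e i) with ha
  -- short vectors with entries in `{-1, 0, 1}`
  have hone : ∀ (s : Finset (Fin n)) (y : Fin n → ℤ), (∀ i, |y i| ≤ 1) → (∀ i ∉ s, y i = 0) →
      ∀ v, Z *ᵥ v = y → vnorm v ≤ a₀ → w ⬝ᵥ intCast' v = a ⬝ᵥ intCast' y := by
    intro s
    induction s using Finset.induction_on with
    | empty =>
      intro y _ hy v hv hva
      have : y = 0 := funext fun i => hy i (by simp)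
      subst this
      rw [hw v hv (by linarith), intCast'_zero, dotProduct_zero]
    | insert i s _ ih =>
      intro y hy hys v hv hva
      set y' := Function.update y i 0 with hy'
      have hyy : y = y' + y i • Pi.single i 1 := by
        ext j; by_cases h : j = i
        · subst h; simp [hy']
        · simp [hy', h]
      have hy1 : ∀ j, |y' j| ≤ 1 := by
        intro j; by_cases h : j = i
        · subst h; simp [hy']
        · simpa [hy', h] using hy j
      obtain ⟨v', hv', hva'⟩ := hhit y' (hsmall' _ hy1)
      have h1 := ih y' hy1 (by
        intro j hj; by_cases h : j = i
        · subst h; simp [hy']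
        · simpa [hy', h] using hys j (by simp [h, hj])) v' hv' hva'
      have hb := hw (v - (v' + y i • e i)) (by
        rw [Matrix.mulVec_sub, Matrix.mulVec_add, Matrix.mulVec_smul, hv, hv', he, ← hyy,
          sub_self]) (by
        have h2 : |((y i : ℤ) : ℝ)| ≤ 1 := by exact_mod_cast hy i
        have h3 := mul_le_mul h2 (hea i) (Real.sqrt_nonneg _) zero_le_one
        have h4 := vnorm_sub_le v (v' + y i • e i)
        have h5 := vnorm_add_le v' (y i • e i)
        rw [vnorm_smul] at h5
        unfold vnorm at *
        linarith)
      rw [intCast'_sub, intCast'_add, intCast'_smul, dotProduct_sub, dotProduct_add,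
        dotProduct_smul, h1] at hb
      have hai : w ⬝ᵥ intCast' (e i) = a ⬝ᵥ intCast' (Pi.single i 1) := by
        simp [intCast', ha, dotProduct, Pi.single_apply]
      rw [hyy, intCast'_add, intCast'_smul, dotProduct_add, dotProduct_smul, ← hai]
      simp only [smul_eq_mul] at hb ⊢
      linarith
  have hshort : ∀ (N : ℕ) (y : Fin n → ℤ), ∑ i, (y i).natAbs ≤ N → √(snorm S y) ≤ ρ →
      ∀ v, Z *ᵥ v = y → vnorm v ≤ a₀ → w ⬝ᵥ intCast' v = a ⬝ᵥ intCast' y := by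
    intro N
    induction N with
    | zero =>
      intro y hy _ v hv hva
      refine hone ∅ y (fun i => ?_) (fun i _ => ?_) v hv hva <;>
        · have := Finset.single_le_sum (fun i _ => Nat.zero_le (y i).natAbs) (Finset.mem_univ i)
          have h0 : y i = 0 := by omega
          simp [h0]
    | succ N ih =>
      intro y hy hyρ v hv hva
      by_cases hy0 : y = 0
      · exact hone ∅ y (by simp [hy0]) (by simp [hy0]) v hv hva
      obtain ⟨i₀, hi₀⟩ := Function.ne_iff.1 hy0
      rw [Pi.zero_apply] at hi₀
      have hdiv : ∀ a : ℤ, (a.tdiv 2).natAbs = a.natAbs / 2 := fun a => Int.natAbs_tdiv a 2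
      have hlt : ∑ i, ((y i).tdiv 2).natAbs < ∑ i, (y i).natAbs :=
        Finset.sum_lt_sum (fun i _ => by rw [hdiv]; omega)
          ⟨i₀, Finset.mem_univ _, by rw [hdiv]; omega⟩
      have hy'ρ := (hhalf y ρ hyρ).trans (by linarith : _ ≤ ρ)
      obtain ⟨v', hv', hva'⟩ := hhit _ hy'ρ
      have h1 := ih _ (by omega) hy'ρ v' hv' hva'
      have hr : ∀ i, |(fun i => (y i).tmod 2) i| ≤ 1 := fun i => abs_tmod_two_le _
      obtain ⟨vr, hvr, hvar⟩ := hhit _ (hsmall' _ hr)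
      have h2 := hone Finset.univ _ hr (by simp) vr hvr hvar
      have hb := hw (v - ((2 : ℤ) • v' + vr)) (by
        rw [Matrix.mulVec_sub, Matrix.mulVec_add, Matrix.mulVec_smul, hv, hv', hvr,
          ← eq_two_smul_tdiv_add, sub_self]) (by
        have h4 := vnorm_sub_le v ((2 : ℤ) • v' + vr)
        have h5 := vnorm_two_smul_add_le v' vr
        linarith)
      rw [intCast'_sub, intCast'_add, intCast'_smul, dotProduct_sub, dotProduct_add,
        dotProduct_smul, h1, h2] at hb
      rw [eq_two_smul_tdiv_add y, intCast'_add, intCast'_smul, dotProduct_add, dotProduct_smul]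
      linarith
  have hchain : ∀ (t : ℕ) (x : Fin n → ℤ), √(snorm S x) ≤ (2 ^ t + 1) * ρ / 2 →
      ∃ v, Z *ᵥ v = x ∧ vnorm v ≤ (2 ^ (t + 1) - 1) * a₀ ∧
        w ⬝ᵥ intCast' v = a ⬝ᵥ intCast' x := by
    intro t
    induction t with
    | zero =>
      intro x hx
      have hx' : √(snorm S x) ≤ ρ := by norm_num at hx; linarith
      obtain ⟨v, hv, hva⟩ := hhit x hx'
      exact ⟨v, hv, by norm_num; exact hva, hshort _ x le_rfl hx' v hv hva⟩
    | succ t ih =>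
      intro x hx
      obtain ⟨v', hv', hva', hw'⟩ := ih _ ((hhalf x _ hx).trans (by rw [pow_succ]; linarith))
      have hr : ∀ i, |(fun i => (x i).tmod 2) i| ≤ 1 := fun i => abs_tmod_two_le _
      obtain ⟨vr, hvr, hvar⟩ := hhit _ (hsmall' _ hr)
      have h2 := hone Finset.univ _ hr (by simp) vr hvr hvar
      refine ⟨(2 : ℤ) • v' + vr, ?_, ?_, ?_⟩
      · rw [Matrix.mulVec_add, Matrix.mulVec_smul, hv', hvr, ← eq_two_smul_tdiv_add]
      · have h5 := vnorm_two_smul_add_le v' vr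
        have h6 : ((2 : ℝ) ^ (t + 1 + 1) - 1) * a₀ = 2 * ((2 ^ (t + 1) - 1) * a₀) + a₀ := by ring
        rw [h6]; linarith
      · rw [intCast'_add, intCast'_smul, dotProduct_add, dotProduct_smul, hw', h2]
        nth_rewrite 3 [eq_two_smul_tdiv_add x]
        rw [intCast'_add, intCast'_smul, dotProduct_add, dotProduct_smul]
  refine ⟨a, fun j => ?_⟩
  obtain ⟨v, hv, hva, hwv⟩ := hchain t _ ((hcol j).trans ht)
  have hb := hw (Pi.single j 1 - v) (by
    rw [Matrix.mulVec_sub, hv, Matrix.mulVec_single_one, sub_eq_zero]; rfl) (by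
    have := vnorm_sub_le (Pi.single j 1) v
    rw [vnorm_single] at this
    linarith)
  rw [intCast'_sub, dotProduct_sub, hwv] at hb
  have : w ⬝ᵥ intCast' (Pi.single j 1) = w j := by
    simp [intCast', dotProduct, Pi.single_apply]
  linarith

lemma surjective_of_hits {n m : ℕ} {Z : Matrix (Fin n) (Fin m) ℤ}
    (h : ∀ i : Fin n, ∃ v, Z *ᵥ v = Pi.single i 1) (y : Fin n → ℤ) : ∃ v, Z *ᵥ v = y := by
  choose e he using h
  refine ⟨∑ i, y i • e i, ?_⟩
  rw [Matrix.mulVec_sum]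
  simp only [Matrix.mulVec_smul, he]
  exact (pi_eq_sum_univ' y).symm

/-- The short kernel vectors span the kernel. -/
lemma mem_span_of_hits {n m : ℕ} {S : Matrix (Fin n) (Fin n) ℝ} {Z : Matrix (Fin n) (Fin m) ℤ}
    {ρ ρ' a₀ l : ℝ} {t : ℕ} (ha₀ : 0 ≤ a₀)
    (hsmall : ∀ r : Fin n → ℤ, (∀ i, |r i| ≤ 1) → √(snorm S r) ≤ ρ / 2)
    (hhit : ∀ y : Fin n → ℤ, √(snorm S y) ≤ ρ → ∃ v, Z *ᵥ v = y ∧ vnorm v ≤ a₀)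
    (hcol : ∀ j, √(snorm S (fun i => Z i j)) ≤ ρ') (ht : ρ' ≤ (2 ^ t + 1) * ρ / 2)
    (hl4 : 4 * a₀ ≤ l) (hl : 1 + (2 ^ (t + 1) - 1) * a₀ ≤ l)
    {y : Fin m → ℝ} (hy : Z.map (Int.cast : ℤ → ℝ) *ᵥ y = 0) :
    y ∈ Submodule.span ℝ (intCast' '' {b : Fin m → ℤ | Z *ᵥ b = 0 ∧ vnorm b ≤ l}) := by
  by_contra hmem
  obtain ⟨f, hfy, hf⟩ := Submodule.exists_le_ker_of_notMem hmem
  set w : Fin m → ℝ := fun j => f (Pi.single j 1) with hwdef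
  have hfw : ∀ x, f x = w ⬝ᵥ x := by
    intro x
    conv_lhs => rw [pi_eq_sum_univ' x]
    simp [hwdef, dotProduct, mul_comm]
  obtain ⟨a, ha⟩ := exists_eq_of_hits ha₀ hsmall hhit hcol ht hl4 hl (w := w) (by
    intro b hb hbl
    rw [← hfw]
    exact hf (Submodule.subset_span ⟨b, ⟨hb, hbl⟩, rfl⟩))
  apply hfy
  rw [hfw, show w = a ᵥ* Z.map (Int.cast : ℤ → ℝ) from funext ha, ← Matrix.dotProduct_mulVec, hy,
    dotProduct_zero]

lemma dotProduct_sq_le_snorm {n : ℕ} {S : Matrix (Fin n) (Fin n) ℝ} (hS : IsUnit S.det)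
    (y : Fin n → ℤ) (θ : Fin n → ℝ) :
    (intCast' y ⬝ᵥ θ) ^ 2 ≤ snorm S y * nsq (S *ᵥ θ) := by
  have : intCast' y ⬝ᵥ θ = ((Sᵀ)⁻¹ *ᵥ intCast' y) ⬝ᵥ (S *ᵥ θ) := by
    rw [Matrix.dotProduct_mulVec, ← Matrix.mulVec_transpose, Matrix.mulVec_mulVec,
      Matrix.mul_nonsing_inv _ (by rwa [Matrix.det_transpose]), Matrix.one_mulVec]
  rw [this]
  exact dotProduct_sq_le _ _

/-- If all the doublings of `θ` are close to the integer lattice then so is `θ`. -/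
lemma half_le_cos_of_near {n : ℕ} {S : Matrix (Fin n) (Fin n) ℝ} (hS : IsUnit S.det) {s : ℝ}
    (hs9 : 9 ≤ s) (hs : ∀ x, s * nsq x ≤ nsq (S *ᵥ x)) {I : ℕ} {θ : Fin n → ℝ}
    (hnear : ∀ i ≤ I, ∃ u : Fin n → ℤ, nsq (S *ᵥ (intCast' u + (2 : ℝ) ^ i • θ)) < 1)
    {y : Fin n → ℤ} (hy : 36 * snorm S y ≤ (2 ^ I) ^ 2) :
    1 / 2 ≤ Real.cos (2 * Real.pi * (intCast' y ⬝ᵥ θ)) := by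
  have key : ∃ u : Fin n → ℤ, ∀ i ≤ I,
      nsq (S *ᵥ ((2 : ℝ) ^ i • (intCast' u + θ))) < 1 := by
    obtain ⟨u, hu⟩ := hnear 0 (Nat.zero_le _)
    refine ⟨u, fun i => ?_⟩
    induction i with
    | zero => intro _; simpa using hu
    | succ i ih =>
      intro hi
      have h1 := ih (by omega)
      obtain ⟨u', hu'⟩ := hnear (i + 1) hi
      have h2 : u' = (2 : ℤ) ^ (i + 1) • u := by
        by_contra hne
        have h3 := one_le_nsq_intCast' (sub_ne_zero.2 hne)
        have h4 := hs (intCast' (u' - (2 : ℤ) ^ (i + 1) • u))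
        have h5 : intCast' (u' - (2 : ℤ) ^ (i + 1) • u) =
            (intCast' u' + (2 : ℝ) ^ (i + 1) • θ) + (-2 : ℝ) • (2 : ℝ) ^ i • (intCast' u + θ) := by
          rw [intCast'_sub, intCast'_smul]; ext j; simp; ring
        have h6 := sqrt_nsq_add_le (S *ᵥ (intCast' u' + (2 : ℝ) ^ (i + 1) • θ))
          (S *ᵥ ((-2 : ℝ) • (2 : ℝ) ^ i • (intCast' u + θ)))
        rw [← Matrix.mulVec_add, ← h5, Matrix.mulVec_smul S (-2 : ℝ), sqrt_nsq_smul] at h6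
        have h7 : 3 ≤ √(nsq (S *ᵥ intCast' (u' - (2 : ℤ) ^ (i + 1) • u))) := by
          apply Real.le_sqrt_of_sq_le; nlinarith
        have h8 : √(nsq (S *ᵥ (intCast' u' + (2 : ℝ) ^ (i + 1) • θ))) < 1 := by
          rwa [Real.sqrt_lt' one_pos, one_pow]
        have h9 : √(nsq (S *ᵥ (2 : ℝ) ^ i • (intCast' u + θ))) < 1 := by
          rwa [Real.sqrt_lt' one_pos, one_pow]
        rw [show |(-2 : ℝ)| = 2 by norm_num] at h6
        linarith
      rw [h2, intCast'_smul] at hu'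
      rw [smul_add]
      push_cast at hu'
      exact hu'
  obtain ⟨u, hu⟩ := key
  have h1 := hu I le_rfl
  rw [Matrix.mulVec_smul, nsq_smul] at h1
  have h2 := dotProduct_sq_le_snorm hS y (intCast' u + θ)
  set x := intCast' y ⬝ᵥ (intCast' u + θ) with hx
  have h3 : x ^ 2 ≤ (1 / 6) ^ 2 := by
    nlinarith [mul_le_mul_of_nonneg_right hy (nsq_nonneg (S *ᵥ (intCast' u + θ)))]
  have h4 := abs_le_of_sq_le_sq' h3 (by norm_num)
  have h5 : 2 * Real.pi * (intCast' y ⬝ᵥ θ) = 2 * Real.pi * x - (y ⬝ᵥ u : ℤ) * (2 * Real.pi) := by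
    rw [hx, dotProduct_add, ← intCast'_dotProduct]; ring
  rw [h5, Real.cos_sub_int_mul_two_pi, ← Real.cos_abs, ← Real.cos_pi_div_three]
  have hpi := Real.pi_pos
  apply Real.cos_le_cos_of_nonneg_of_le_pi (abs_nonneg _) (by linarith)
  rw [abs_mul, abs_of_pos (by positivity)]
  have := abs_le.2 h4
  nlinarith

lemma mul_nsq_inv_transpose_le {n : ℕ} {S : Matrix (Fin n) (Fin n) ℝ} (hS : IsUnit S.det) {s : ℝ}
    (hs0 : 0 ≤ s) (hs : ∀ x, s * nsq x ≤ nsq (S *ᵥ x)) (y : Fin n → ℝ) :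
    s * nsq ((Sᵀ)⁻¹ *ᵥ y) ≤ nsq y := by
  set z := (Sᵀ)⁻¹ *ᵥ y with hz
  set x := S⁻¹ *ᵥ z with hx
  have h1 : S *ᵥ x = z := by
    rw [hx, Matrix.mulVec_mulVec, Matrix.mul_nonsing_inv _ hS, Matrix.one_mulVec]
  have h2 : nsq z = y ⬝ᵥ x := by
    rw [nsq]; nth_rewrite 2 [← h1]
    rw [Matrix.dotProduct_mulVec, ← Matrix.mulVec_transpose, hz, Matrix.mulVec_mulVec,
      Matrix.mul_nonsing_inv _ (by rwa [Matrix.det_transpose]), Matrix.one_mulVec]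
  have h3 := dotProduct_sq_le y x
  rw [← h2] at h3
  have h4 := hs x
  rw [h1] at h4
  rcases (nsq_nonneg z).eq_or_lt with h | h
  · rw [← h, mul_zero]; exact nsq_nonneg _
  · refine le_of_mul_le_mul_right ?_ h
    nlinarith [mul_le_mul_of_nonneg_left h4 (nsq_nonneg y), mul_le_mul_of_nonneg_left h3 hs0]

lemma nsq_intCast'_le {n : ℕ} {v : Fin n → ℤ} {K : Finset (Fin n)} {L : ℕ}
    (hv : ∀ j, |v j| ≤ L) (hK : ∀ j ∉ K, v j = 0) : nsq (intCast' v) ≤ K.card * (L : ℝ) ^ 2 := by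
  rw [nsq_eq_sum, ← Finset.sum_subset (Finset.subset_univ K)]
  · refine (Finset.sum_le_card_nsmul _ _ ((L : ℝ) ^ 2) fun j _ => ?_).trans_eq (by simp)
    have h : |(v j : ℝ)| ≤ (L : ℝ) := by exact_mod_cast hv j
    rw [intCast', ← sq_abs]
    exact pow_le_pow_left₀ (abs_nonneg _) h 2
  · intro j _ hj; simp [intCast', hK j hj]

lemma sq_le_snorm_mul {n : ℕ} {S : Matrix (Fin n) (Fin n) ℝ} (hS : IsUnit S.det) {s₁ : ℝ}
    (hs₁ : ∀ x, nsq (S *ᵥ x) ≤ s₁ * nsq x) (y : Fin n → ℤ) (i : Fin n) :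
    (y i : ℝ) ^ 2 ≤ snorm S y * s₁ := by
  have h1 := dotProduct_sq_le_snorm hS y (Pi.single i 1)
  have h2 := hs₁ (Pi.single i 1)
  have h3 : nsq (Pi.single i (1 : ℝ)) = 1 := by simp [nsq]
  rw [dotProduct_single, mul_one] at h1
  rw [h3, mul_one] at h2
  exact h1.trans (mul_le_mul_of_nonneg_left h2 (nsq_nonneg _))

/-- Frequencies one of whose first `I` doublings stays away from the integer lattice. -/
noncomputable def farSet {n : ℕ} (S : Matrix (Fin n) (Fin n) ℝ) (q I : ℕ) :
    Finset (Fin n → Fin q) :=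
  Finset.univ.filter fun t => ∃ i ≤ I, ∀ u : Fin n → ℤ,
    1 ≤ nsq (S *ᵥ (intCast' u + (2 : ℝ) ^ i • gridPt t))

/-- The Fourier mass at the far frequencies. -/
noncomputable def farMass {n m : ℕ} (S : Matrix (Fin n) (Fin n) ℝ) (K : Finset (Fin m))
    (q I : ℕ) (z : Fin m → Fin n → ℤ) : ℝ :=
  ∑ t ∈ farSet S q I, ∏ j ∈ K, fejer (2 ^ (I + 1)) (intCast' (z j) ⬝ᵥ gridPt t)

lemma exists_hit_of_farMass_lt {n m : ℕ} {S : Matrix (Fin n) (Fin n) ℝ} (hS : IsUnit S.det)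
    {s s₁ : ℝ} (hs9 : 9 ≤ s) (hs : ∀ x, s * nsq x ≤ nsq (S *ᵥ x))
    (hs₁ : ∀ x, nsq (S *ᵥ x) ≤ s₁ * nsq x) (hs₁0 : 0 ≤ s₁)
    {Z : Matrix (Fin n) (Fin m) ℤ} {K : Finset (Fin m)} {ρ : ℝ}
    (hcol : ∀ j ∈ K, snorm S (fun i => Z i j) ≤ ρ ^ 2) {I N q : ℕ} (hI : 36 * ρ ^ 2 ≤ (2 ^ I) ^ 2)
    (hN : ρ ^ 2 * s₁ ≤ (N : ℝ) ^ 2) (hq : K.card * (2 ^ (I + 1) * N) + N < q)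
    (hfar : farMass S K q I (fun j i => Z i j) < (((2 : ℝ) ^ (I + 1)) ^ 2) ^ K.card / 3)
    {y : Fin n → ℤ} (hy : snorm S y ≤ ρ ^ 2) :
    ∃ v : Fin m → ℤ, Z *ᵥ v = y ∧ vnorm v ≤ √(K.card * (2 ^ (I + 1)) ^ 2) := by
  have hbd : ∀ y : Fin n → ℤ, snorm S y ≤ ρ ^ 2 → ∀ i, |y i| ≤ N := by
    intro y hy i
    have h1 := (sq_le_snorm_mul hS hs₁ y i).trans
      ((mul_le_mul_of_nonneg_right hy hs₁0).trans hN)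
    have h2 := abs_le_of_sq_le_sq h1 (Nat.cast_nonneg _)
    exact_mod_cast h2
  obtain ⟨v, hv, hvL, hvK⟩ := exists_hit (Z := Z) (K := K) (L := 2 ^ (I + 1)) (q := q) (N := N)
    (by positivity) hq (fun i j hj => hbd _ (hcol j hj) i) (farSet S q I)
    (by push_cast; exact hfar) (hbd y hy) (by
      intro t ht
      simp only [farSet, Finset.mem_filter, Finset.mem_univ, true_and, not_exists, not_and,
        not_forall, not_le] at ht
      exact half_le_cos_of_near hS hs9 hs ht (by linarith))
  refine ⟨v, hv, Real.sqrt_le_sqrt ?_⟩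
  have := nsq_intCast'_le hvL hvK
  push_cast at this
  exact this

lemma statDistL_le_of_farMass_lt {n m : ℕ} {S : Matrix (Fin n) (Fin n) ℝ} (hS : IsUnit S.det)
    {s s₁ : ℝ} (hs9 : 9 ≤ s) (hs : ∀ x, s * nsq x ≤ nsq (S *ᵥ x))
    (hs₁ : ∀ x, nsq (S *ᵥ x) ≤ s₁ * nsq x) (hs₁0 : 0 ≤ s₁)
    {Z : Matrix (Fin n) (Fin m) ℤ} {K : Finset (Fin m)} {ρ ρ' : ℝ} (hρ0 : 0 ≤ ρ) (hρ'0 : 0 ≤ ρ')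
    (hcol : ∀ j ∈ K, snorm S (fun i => Z i j) ≤ ρ ^ 2)
    (hcol' : ∀ j, snorm S (fun i => Z i j) ≤ ρ' ^ 2) {I N q t : ℕ}
    (hI : 36 * ρ ^ 2 ≤ (2 ^ I) ^ 2)
    (hN : ρ ^ 2 * s₁ ≤ (N : ℝ) ^ 2) (hq : K.card * (2 ^ (I + 1) * N) + N < q)
    (hfar : farMass S K q I (fun j i => Z i j) < (((2 : ℝ) ^ (I + 1)) ^ 2) ^ K.card / 3)
    (hsmall : 4 * n ≤ s * ρ ^ 2) (ht : ρ' ≤ (2 ^ t + 1) * ρ / 2) {a₀ l : ℝ}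
    (ha₀ : a₀ = √(K.card * (2 ^ (I + 1)) ^ 2)) (hl0 : 0 < l)
    (hl4 : 4 * a₀ ≤ l) (hl : 1 + (2 ^ (t + 1) - 1) * a₀ ≤ l)
    {R : Matrix (Fin m) (Fin m) ℝ} (hR : IsUnit R.det) {r η ε : ℝ} (hr0 : 0 < r)
    (hr : ∀ x, r * nsq x ≤ nsq (R *ᵥ x)) (hη : Real.exp (-Real.pi * (r / l ^ 2)) ≤ η)
    (hη3 : η < 1 / 3) (hm : ((1 + 3 * η) / (1 - 3 * η)) ^ (2 * m) ≤ 1 + 4 * ε)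
    {B : Matrix (Fin n) (Fin n) ℝ} (hB : IsUnit B.det) (c : Fin m → ℝ) :
    statDistL B Z R c ≤ 2 * ε := by
  have hsqrt : ∀ y, √(snorm S y) ≤ ρ → snorm S y ≤ ρ ^ 2 := fun y h => (Real.sqrt_le_left hρ0).1 h
  have hhit : ∀ y : Fin n → ℤ, √(snorm S y) ≤ ρ → ∃ v, Z *ᵥ v = y ∧ vnorm v ≤ a₀ := fun y hy =>
    ha₀ ▸ exists_hit_of_farMass_lt hS hs9 hs hs₁ hs₁0 hcol hI hN hq hfar (hsqrt y hy)
  have hsmall' : ∀ r : Fin n → ℤ, (∀ i, |r i| ≤ 1) → √(snorm S r) ≤ ρ / 2 := by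
    intro r hr
    refine (Real.sqrt_le_left (by positivity)).2 ?_
    have h1 := mul_nsq_inv_transpose_le hS (by linarith) hs (intCast' r)
    have h2 := nsq_intCast'_le (K := Finset.univ) (L := 1) (v := r) (by simpa using hr) (by simp)
    simp only [Finset.card_univ, Fintype.card_fin, Nat.cast_one, one_pow, mul_one] at h2
    refine le_of_mul_le_mul_left ?_ (by linarith : 0 < s)
    rw [snorm]
    nlinarith
  refine statDistL_le hR c hB Z (surjective_of_hits fun i => ?_) ((Real.exp_pos _).le.trans hη) hη3
    {b | Z *ᵥ b = 0 ∧ vnorm b ≤ l ∧ b ≠ 0} ?_ ?_ hm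
  · obtain ⟨v, hv, _⟩ := hhit (Pi.single i 1) ((hsmall' _ fun j => by
      by_cases h : j = i
      · subst h; simp
      · simp [h]).trans (by linarith))
    exact ⟨v, hv⟩
  · rintro b ⟨hb, hbl, hb0⟩
    refine ⟨hb, le_trans (Real.exp_le_exp.2 ?_) hη⟩
    have h1 := mul_nsq_inv_transpose_le hR hr0.le hr (intCast' b)
    have h2 : nsq (intCast' b) ≤ l ^ 2 := (Real.sqrt_le_left hl0.le).1 hbl
    have h3 : 0 < nsq ((Rᵀ)⁻¹ *ᵥ intCast' b) := by
      refine lt_of_le_of_ne (nsq_nonneg _) (Ne.symm fun h => hb0 ?_)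
      have h4 := nsq_eq_zero.1 h
      have h5 : intCast' b = Rᵀ *ᵥ ((Rᵀ)⁻¹ *ᵥ intCast' b) := by
        rw [Matrix.mulVec_mulVec, Matrix.mul_nonsing_inv _ (by rwa [Matrix.det_transpose]),
          Matrix.one_mulVec]
      rw [h4, Matrix.mulVec_zero, ← intCast'_zero, intCast'_inj] at h5
      exact h5
    have h6 : r / l ^ 2 ≤ 1 / nsq ((Rᵀ)⁻¹ *ᵥ intCast' b) := by
      rw [div_le_div_iff₀ (by positivity) h3]; linarith
    rw [div_eq_mul_one_div]
    nlinarith [Real.pi_pos]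
  · intro y hy
    refine Submodule.span_le.2 ?_ (mem_span_of_hits (ρ' := ρ') (ha₀ ▸ Real.sqrt_nonneg _) hsmall'
      hhit (fun j => (Real.sqrt_le_left hρ'0).2 (hcol' j)) ht hl4 hl hy)
    rintro _ ⟨b, ⟨hb, hbl⟩, rfl⟩
    by_cases hb0 : b = 0
    · rw [hb0, intCast'_zero]; exact Submodule.zero_mem _
    · exact Submodule.subset_span ⟨b, ⟨hb, hbl, hb0⟩, rfl⟩

lemma tsum_dgauss_prod {n m : ℕ} {S : Matrix (Fin n) (Fin n) ℝ} (hS : IsUnit S.det)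
    (J : Finset (Fin m)) (g : Fin m → (Fin n → ℤ) → ENNReal) :
    ∑' z : Fin m → Fin n → ℤ, (∏ j, ENNReal.ofReal (dgauss S (z j))) * ∏ j ∈ J, g j (z j) =
      ∏ j ∈ J, ∑' y, ENNReal.ofReal (dgauss S y) * g j y := by
  have h1 : ∑' y, ENNReal.ofReal (dgauss S y) = 1 := by
    rw [← ENNReal.ofReal_tsum_of_nonneg dgauss_nonneg (hasSum_dgauss hS).summable,
      (hasSum_dgauss hS).tsum_eq, ENNReal.ofReal_one]
  have h2 := ENNReal.tsum_prod_pi m (fun j y =>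
    ENNReal.ofReal (dgauss S y) * if j ∈ J then g j y else 1)
  simp only [Finset.prod_mul_distrib] at h2
  simp only [Finset.prod_ite_mem, Finset.univ_inter] at h2
  rw [h2, ← Finset.prod_subset (Finset.subset_univ J)]
  · exact Finset.prod_congr rfl fun j hj => by simp [hj]
  · intro j _ hj; simp [hj, h1]

lemma tsum_dgauss_fejer_le {n : ℕ} {S : Matrix (Fin n) (Fin n) ℝ} (hS : IsUnit S.det) {s : ℝ}
    (hs0 : 0 < s) (hs : ∀ x, s * nsq x ≤ nsq (S *ᵥ x))
    (hns : 1000 * n * Real.exp (-(Real.pi / 2) * s) ≤ 1) (hn : 1 ≤ n) {q I : ℕ}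
    {t : Fin n → Fin q} (ht : t ∈ farSet S q I) :
    ∑' y : Fin n → ℤ, ENNReal.ofReal (dgauss S y) *
        ENNReal.ofReal (fejer (2 ^ (I + 1)) (intCast' y ⬝ᵥ gridPt t)) ≤
      ENNReal.ofReal (((2 : ℝ) ^ (I + 1)) ^ 2 * (5 / 8)) := by
  simp only [farSet, Finset.mem_filter, Finset.mem_univ, true_and] at ht
  obtain ⟨i, hi, hu⟩ := ht
  have h := tsum_dgauss_cos_le hS hs0 hs hns hn hu
  rw [ENNReal.ofReal_mul (by positivity)]
  refine le_trans ?_ (mul_le_mul_right h (ENNReal.ofReal (((2 : ℝ) ^ (I + 1)) ^ 2)))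
  rw [← ENNReal.tsum_mul_left]
  refine ENNReal.tsum_le_tsum fun y => ?_
  rw [← ENNReal.ofReal_mul (dgauss_nonneg _), ← ENNReal.ofReal_mul (by positivity)]
  refine ENNReal.ofReal_le_ofReal ?_
  have h1 := fejer_two_pow_le (show i < I + 1 by omega) (intCast' y ⬝ᵥ gridPt t)
  rw [dotProduct_smul, smul_eq_mul]
  calc _ ≤ dgauss S y * _ := mul_le_mul_of_nonneg_left h1 (dgauss_nonneg _)
    _ = _ := by ring

/-- Union bound for the failure events. -/
lemma one_sub_le_tsum_dgauss {n m : ℕ} {S : Matrix (Fin n) (Fin n) ℝ} (hS : IsUnit S.det) {s : ℝ}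
    (hs0 : 0 < s) (hs : ∀ x, s * nsq x ≤ nsq (S *ᵥ x))
    (hns : 1000 * n * Real.exp (-(Real.pi / 2) * s) ≤ 1) (hn : 1 ≤ n) {q I : ℕ}
    {K : Finset (Fin m)} {ρ ρ' δ : ℝ}
    (hδ : m * (2 ^ n * Real.exp (-(3 * Real.pi / 4) * ρ' ^ 2)) +
      K.card * (2 ^ n * Real.exp (-(3 * Real.pi / 4) * ρ ^ 2)) +
      q ^ n * (3 * (5 / 8) ^ K.card) ≤ δ)
    {A : (Fin m → Fin n → ℤ) → Prop}
    (hA : ∀ z, (∀ j ∈ K, snorm S (z j) ≤ ρ ^ 2) → (∀ j, snorm S (z j) ≤ ρ' ^ 2) →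
      farMass S K q I z < (((2 : ℝ) ^ (I + 1)) ^ 2) ^ K.card / 3 → A z) :
    1 - δ ≤ ∑' z, if A z then ∏ j, dgauss S (z j) else 0 := by
  set P : (Fin m → Fin n → ℤ) → ENNReal := fun z => ∏ j, ENNReal.ofReal (dgauss S (z j)) with hP
  set D : ℝ := ((2 : ℝ) ^ (I + 1)) ^ 2 with hD
  have hD0 : 0 < D := by positivity
  have hp0 : ∀ z : Fin m → Fin n → ℤ, 0 ≤ ∏ j, dgauss S (z j) :=
    fun z => Finset.prod_nonneg fun j _ => dgauss_nonneg _
  have hPp : ∀ z, P z = ENNReal.ofReal (∏ j, dgauss S (z j)) := fun z =>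
    (ENNReal.ofReal_prod_of_nonneg fun j _ => dgauss_nonneg _).symm
  have hP1 : ∑' z, P z = 1 := by
    have := tsum_dgauss_prod (m := m) hS ∅ (fun _ _ => 1)
    simpa using this
  have htail : ∀ (j : Fin m) (t : ℝ), ∑' z, P z * (if t < snorm S (z j) then 1 else 0) ≤
      ENNReal.ofReal (2 ^ n * Real.exp (-(3 * Real.pi / 4) * t)) := by
    intro j t
    have h := tsum_dgauss_prod hS {j} (fun _ y => if t < snorm S y then 1 else 0)
    simp only [Finset.prod_singleton] at h
    rw [h]
    refine le_trans (le_of_eq (tsum_congr fun y => ?_)) (tsum_dgauss_tail_le hS)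
    split_ifs <;> simp
  have hfar : ∑' z, P z * ENNReal.ofReal (farMass S K q I z * (3 / D ^ K.card)) ≤
      ENNReal.ofReal (q ^ n * (3 * (5 / 8) ^ K.card)) := by
    have h1 : ∀ z, P z * ENNReal.ofReal (farMass S K q I z * (3 / D ^ K.card)) =
        (∑ t ∈ farSet S q I, P z * ∏ j ∈ K, ENNReal.ofReal
          (fejer (2 ^ (I + 1)) (intCast' (z j) ⬝ᵥ gridPt t))) *
            ENNReal.ofReal (3 / D ^ K.card) := by
      intro z
      rw [farMass, ENNReal.ofReal_mul (Finset.sum_nonneg fun t _ => Finset.prod_nonneg fun j _ =>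
        fejer_nonneg _ _), ← mul_assoc, ENNReal.ofReal_sum_of_nonneg
          (fun t _ => Finset.prod_nonneg fun j _ => fejer_nonneg _ _), Finset.mul_sum]
      congr 1
      exact Finset.sum_congr rfl fun t _ => by
        rw [ENNReal.ofReal_prod_of_nonneg fun j _ => fejer_nonneg _ _]
    simp only [h1]
    rw [ENNReal.tsum_mul_right, Summable.tsum_finsetSum (fun _ _ => ENNReal.summable)]
    have h2 : ∀ t ∈ farSet S q I, ∑' z, P z * ∏ j ∈ K, ENNReal.ofReal
          (fejer (2 ^ (I + 1)) (intCast' (z j) ⬝ᵥ gridPt t)) ≤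
        ENNReal.ofReal ((D * (5 / 8)) ^ K.card) := by
      intro t ht
      rw [tsum_dgauss_prod hS K
        (fun _ y => ENNReal.ofReal (fejer (2 ^ (I + 1)) (intCast' y ⬝ᵥ gridPt t))),
        ENNReal.ofReal_pow (by positivity)]
      exact Finset.prod_le_pow_card _ _ _ fun j _ => tsum_dgauss_fejer_le hS hs0 hs hns hn ht
    refine (mul_le_mul_left (Finset.sum_le_card_nsmul _ _ _ h2) _).trans ?_
    have h3 : (farSet S q I).card ≤ q ^ n := by
      refine (Finset.card_le_univ _).trans_eq ?_
      simp
    rw [nsmul_eq_mul, ← ENNReal.ofReal_natCast, ← ENNReal.ofReal_mul (by positivity),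
      ← ENNReal.ofReal_mul (by positivity)]
    refine ENNReal.ofReal_le_ofReal ?_
    have h4 : ((farSet S q I).card : ℝ) ≤ q ^ n := by exact_mod_cast h3
    calc _ = ((farSet S q I).card : ℝ) * (3 * (5 / 8) ^ K.card) := by
          rw [mul_pow]; field_simp
      _ ≤ _ := mul_le_mul_of_nonneg_right h4 (by positivity)
  have hbad : ∑' z, (if A z then 0 else P z) ≤ ENNReal.ofReal δ := by
    have h1 : ∀ z, (if A z then 0 else P z) ≤
        ∑ j : Fin m, P z * (if ρ' ^ 2 < snorm S (z j) then 1 else 0) +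
        ∑ j ∈ K, P z * (if ρ ^ 2 < snorm S (z j) then 1 else 0) +
        P z * ENNReal.ofReal (farMass S K q I z * (3 / D ^ K.card)) := by
      intro z
      by_cases hz : A z
      · simp [hz]
      rw [if_neg hz]
      by_cases h1 : ∀ j, snorm S (z j) ≤ ρ' ^ 2
      · by_cases h2 : ∀ j ∈ K, snorm S (z j) ≤ ρ ^ 2
        · have h3 : D ^ K.card / 3 ≤ farMass S K q I z := not_lt.1 fun h => hz (hA z h2 h1 h)
          refine le_trans ?_ le_add_self
          refine le_mul_of_one_le_right' (ENNReal.one_le_ofReal.2 ?_)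
          rw [div_le_iff₀ (by norm_num)] at h3
          rw [mul_div_assoc', le_div_iff₀ (by positivity)]
          linarith
        · push Not at h2
          obtain ⟨j, hj, h⟩ := h2
          refine le_trans ?_ le_self_add
          refine le_trans ?_ le_add_self
          refine le_trans (le_of_eq ?_) (Finset.single_le_sum (fun _ _ => zero_le) hj)
          simp [h]
      · push Not at h1
        obtain ⟨j, h⟩ := h1
        refine le_trans ?_ le_self_add
        refine le_trans ?_ le_self_add
        refine le_trans (le_of_eq ?_)
          (Finset.single_le_sum (fun _ _ => zero_le) (Finset.mem_univ j))
        simp [h]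
    refine (ENNReal.tsum_le_tsum h1).trans ?_
    rw [ENNReal.tsum_add, ENNReal.tsum_add, Summable.tsum_finsetSum (fun _ _ => ENNReal.summable),
      Summable.tsum_finsetSum (fun _ _ => ENNReal.summable)]
    refine (add_le_add (add_le_add (Finset.sum_le_card_nsmul _ _ _ fun j _ => htail j _)
      (Finset.sum_le_card_nsmul _ _ _ fun j _ => htail j _)) hfar).trans ?_
    rw [nsmul_eq_mul, nsmul_eq_mul, Finset.card_univ, Fintype.card_fin, ← ENNReal.ofReal_natCast m,
      ← ENNReal.ofReal_natCast K.card, ← ENNReal.ofReal_mul (by positivity),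
      ← ENNReal.ofReal_mul (by positivity), ← ENNReal.ofReal_add (by positivity) (by positivity),
      ← ENNReal.ofReal_add (by positivity) (by positivity)]
    exact ENNReal.ofReal_le_ofReal hδ
  have hδ0 : 0 ≤ δ := le_trans (by positivity) hδ
  have hif : ∀ z, 0 ≤ if A z then ∏ j, dgauss S (z j) else 0 := by
    intro z; split_ifs; exacts [hp0 z, le_rfl]
  have htot : ∑' z, ENNReal.ofReal (if A z then ∏ j, dgauss S (z j) else 0) +
      ∑' z, (if A z then 0 else P z) = 1 := by
    rw [← ENNReal.tsum_add, ← hP1]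
    refine tsum_congr fun z => ?_
    rw [hPp]
    split_ifs <;> simp
  have hfin : ∑' z, ENNReal.ofReal (if A z then ∏ j, dgauss S (z j) else 0) ≠ ⊤ :=
    ne_top_of_le_ne_top ENNReal.one_ne_top (le_self_add.trans_eq htot)
  rw [← ENNReal.ofReal_tsum_of_nonneg hif (summable_of_tsum_ofReal_ne_top hif hfin)] at htot
  have h2 := htot.symm.le.trans (add_le_add_right hbad _)
  rw [← ENNReal.ofReal_add (tsum_nonneg hif) hδ0, ENNReal.one_le_ofReal] at h2
  linarith

lemma mul_exp_tail_le (n : ℕ) {x : ℝ} (hx : 2 ≤ x) :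
    x * (2 ^ n * Real.exp (-(3 * Real.pi / 4) * (n + Real.logb 2 x))) ≤ ((2 : ℝ) ^ n)⁻¹ / 4 := by
  have hl : 0 < Real.log 2 := Real.log_pos (by norm_num)
  have h2n : (1 : ℝ) ≤ 2 ^ n := one_le_pow₀ (by norm_num)
  have hlog : Real.log (2 ^ n * x) = (n + Real.logb 2 x) * Real.log 2 := by
    rw [Real.log_mul (by positivity) (by positivity), Real.log_pow, Real.logb]; field_simp
  have h0 : 0 ≤ n + Real.logb 2 x := by
    have := Real.logb_nonneg (b := 2) (by norm_num) (by linarith : 1 ≤ x)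
    positivity
  have h1 : Real.exp (-(3 * Real.pi / 4) * (n + Real.logb 2 x)) ≤ ((2 ^ n * x) ^ 3)⁻¹ := by
    rw [← Real.exp_log (by positivity : 0 < ((2 ^ n * x) ^ 3)⁻¹), Real.exp_le_exp, Real.log_inv,
      Real.log_pow, hlog]
    have := Real.log_two_lt_d9
    have := Real.pi_gt_three
    push_cast
    nlinarith
  calc _ ≤ x * (2 ^ n * ((2 ^ n * x) ^ 3)⁻¹) := by gcongr
    _ = ((2 : ℝ) ^ n)⁻¹ / (2 ^ n * x ^ 2) := by field_simp
    _ ≤ _ := by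
      refine div_le_div_of_nonneg_left (by positivity) (by norm_num) ?_
      nlinarith

lemma pow_far_le {n k q : ℕ} {u : ℝ} (hn : 1 ≤ n) (hu : 1024 ≤ u) (hq : (q : ℝ) ≤ u ^ 6)
    (hk : 29 * n * Real.logb 2 u ≤ k) :
    (q : ℝ) ^ n * (3 * (5 / 8) ^ k) ≤ ((2 : ℝ) ^ n)⁻¹ / 2 := by
  have hl : 0 < Real.log 2 := Real.log_pos (by norm_num)
  have hn' : (1 : ℝ) ≤ n := by exact_mod_cast hn
  have hU : 10 ≤ Real.logb 2 u := by
    rw [Real.le_logb_iff_rpow_le (by norm_num) (by linarith)]; norm_num; linarith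
  have hlogu : Real.log u = Real.logb 2 u * Real.log 2 := by rw [Real.logb]; field_simp
  have h1 : ((5 : ℝ) / 8) ^ k ≤ Real.exp (-(2 / 3) * Real.log 2 * k) := by
    have h2 : Real.log (5 / 8) ≤ -(2 / 3) * Real.log 2 := by
      have h3 : Real.log ((5 / 8) ^ 3) ≤ Real.log (4⁻¹) := Real.log_le_log (by norm_num) (by norm_num)
      rw [Real.log_pow, Real.log_inv, show (4 : ℝ) = 2 ^ 2 by norm_num, Real.log_pow] at h3
      push_cast at h3; linarith
    rw [← Real.exp_log (by positivity : 0 < ((5 : ℝ) / 8) ^ k), Real.exp_le_exp, Real.log_pow]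
    nlinarith [Nat.cast_nonneg (α := ℝ) k]
  have h4 : (q : ℝ) ^ n ≤ Real.exp (6 * n * (Real.logb 2 u * Real.log 2)) := by
    refine (pow_le_pow_left₀ (Nat.cast_nonneg _) hq n).trans_eq ?_
    rw [← hlogu, ← pow_mul, ← Real.exp_log (by positivity : 0 < u ^ (6 * n)), Real.log_pow]
    push_cast; rfl
  have h5 : (3 : ℝ) ≤ Real.exp (2 * Real.log 2) := by
    rw [show 2 * Real.log 2 = Real.log (2 ^ 2) by rw [Real.log_pow]; norm_num,
      Real.exp_log (by norm_num)]; norm_num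
  have h6 : ((2 : ℝ) ^ n)⁻¹ / 2 = Real.exp (-((n + 1) * Real.log 2)) := by
    rw [Real.exp_neg, show ((n : ℝ) + 1) * Real.log 2 = Real.log (2 ^ (n + 1)) by
      rw [Real.log_pow]; push_cast; ring, Real.exp_log (by positivity), pow_succ, mul_inv]
    ring
  rw [h6]
  calc _ ≤ Real.exp (6 * n * (Real.logb 2 u * Real.log 2)) * (Real.exp (2 * Real.log 2) *
        Real.exp (-(2 / 3) * Real.log 2 * k)) := by gcongr
    _ = Real.exp (Real.log 2 * (6 * n * Real.logb 2 u + 2 - 2 / 3 * k)) := by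
      rw [← Real.exp_add, ← Real.exp_add]; congr 1; ring
    _ ≤ _ := by
      rw [Real.exp_le_exp]
      have h7 : 6 * n * Real.logb 2 u + 2 - 2 / 3 * k ≤ -((n : ℝ) + 1) := by
        have h8 : (n : ℝ) * 10 ≤ n * Real.logb 2 u := by gcongr
        linarith
      linarith [mul_le_mul_of_nonneg_left h7 hl.le]

lemma ratio_pow_le {m : ℕ} (hm : 0 < m) {ε : ℝ} (hε0 : 0 < ε) (hε : ε < 1 / 1000) :
    ((1 + 3 * (ε / (6 * m))) / (1 - 3 * (ε / (6 * m)))) ^ (2 * m) ≤ 1 + 4 * ε := by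
  have hm' : (1 : ℝ) ≤ m := by exact_mod_cast hm
  set x := 3 * (ε / (6 * m)) with hx
  have hx0 : 0 ≤ x := by positivity
  have hxm : 2 * m * x = ε := by rw [hx]; field_simp; ring
  have hx1 : x ≤ 1 / 1000 := by nlinarith
  have h1 : (1 + x) / (1 - x) ≤ Real.exp (3 * x) := by
    refine le_trans ?_ (Real.add_one_le_exp (3 * x))
    rw [div_le_iff₀ (by linarith)]; nlinarith
  have h0 : 0 ≤ (1 + x) / (1 - x) := div_nonneg (by linarith) (by linarith)
  refine (pow_le_pow_left₀ h0 h1 _).trans ?_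
  rw [← Real.exp_nat_mul]
  push_cast
  rw [show 2 * (m : ℝ) * (3 * x) = 3 * ε by rw [← hxm]; ring]
  have h2 := Real.abs_exp_sub_one_sub_id_le (x := 3 * ε) (by rw [abs_of_pos] <;> linarith)
  have h3 := (abs_le.1 h2).2
  nlinarith

lemma nsq_bounds {n : ℕ} {S : Matrix (Fin n) (Fin n) ℝ} {σ : ℝ} (hσ0 : 0 ≤ σ)
    (h : ∀ x : Fin n → ℝ, σ * enorm' x ≤ enorm' (S *ᵥ x)) (x : Fin n → ℝ) :
    σ ^ 2 * nsq x ≤ nsq (S *ᵥ x) := by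
  have h1 := h x
  rw [enorm'_eq, enorm'_eq] at h1
  have h2 := pow_le_pow_left₀ (by positivity) h1 2
  rwa [mul_pow, Real.sq_sqrt (nsq_nonneg _), Real.sq_sqrt (nsq_nonneg _)] at h2

lemma nsq_mulVec_le {n : ℕ} {S : Matrix (Fin n) (Fin n) ℝ} {σ : ℝ}
    (h : ∀ x : Fin n → ℝ, enorm' (S *ᵥ x) ≤ σ * enorm' x) (x : Fin n → ℝ) :
    nsq (S *ᵥ x) ≤ σ ^ 2 * nsq x := by
  have h1 := h x
  rw [enorm'_eq, enorm'_eq] at h1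
  have h2 := pow_le_pow_left₀ (by positivity) h1 2
  rwa [mul_pow, Real.sq_sqrt (nsq_nonneg _), Real.sq_sqrt (nsq_nonneg _)] at h2

lemma logb_two_le {x : ℝ} (hx : 1 ≤ x) : Real.logb 2 x ≤ 2 * √x := by
  have h1 := Real.log_two_gt_d9
  have h2 := Real.log_le_sub_one_of_pos (Real.sqrt_pos.2 (by linarith : 0 < x))
  rw [Real.log_sqrt (by linarith)] at h2
  have h3 := Real.log_le_sub_one_of_pos (by positivity : 0 < √x / 2)
  rw [Real.log_div (by positivity) (by norm_num), Real.log_sqrt (by linarith)] at h3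
  rw [Real.logb, div_le_iff₀ (by linarith)]
  have h4 : 1 ≤ √x := Real.one_le_sqrt.2 hx
  nlinarith [Real.log_two_lt_d9]

/-- The grid size stays polynomial in `u = n σ₁`. -/
lemma grid_size_le {n k N I : ℕ} {σ u ρ : ℝ} (hn : 100 ≤ n) (hσ : 17 ≤ σ) (hu : u = n * σ)
    (hk : (k : ℝ) ≤ 30 * n * Real.logb 2 u) (hρ : ρ ^ 2 ≤ n + k)
    (hN : (N : ℝ) ≤ σ * ρ + 1) (hI : (2 : ℝ) ^ (I + 1) ≤ 24 * ρ) :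
    ((k * (2 ^ (I + 1) * N) + N + 1 : ℕ) : ℝ) ≤ u ^ 6 := by
  have hn' : (100 : ℝ) ≤ n := by exact_mod_cast hn
  have hu1 : 1700 ≤ u := by rw [hu]; nlinarith
  have hun : 17 * n ≤ u := by rw [hu]; nlinarith
  have huσ : 100 * σ ≤ u := by rw [hu]; nlinarith
  have hlog : Real.logb 2 u ≤ u := by
    have h1 := logb_two_le (by linarith : 1 ≤ u)
    have h2 : 2 ≤ √u := Real.le_sqrt_of_sq_le (by linarith)
    nlinarith [Real.sq_sqrt (by linarith : 0 ≤ u)]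
  have hk2 : (k : ℝ) ≤ 2 * u ^ 2 := by
    refine hk.trans ?_
    nlinarith
  have hρu : ρ ≤ 2 * u := by
    refine le_of_sq_le_sq ?_ (by linarith)
    nlinarith
  have hNu : (N : ℝ) ≤ u ^ 2 / 10 := by
    refine hN.trans ?_
    nlinarith
  push_cast
  have h1 : (2 : ℝ) ^ (I + 1) * N ≤ (48 * u) * (u ^ 2 / 10) :=
    mul_le_mul (by linarith) hNu (by positivity) (by positivity)
  have h2 : (k : ℝ) * (2 ^ (I + 1) * N) ≤ 2 * u ^ 2 * ((48 * u) * (u ^ 2 / 10)) :=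
    mul_le_mul hk2 h1 (by positivity) (by positivity)
  have h3 : u ^ 2 ≤ u ^ 5 := pow_le_pow_right₀ (by linarith) (by norm_num)
  have h4 : 1 ≤ u ^ 5 := one_le_pow₀ (by linarith)
  have h5 : 1700 * u ^ 5 ≤ u ^ 6 := by
    rw [pow_succ u 5]; nlinarith
  nlinarith

lemma least_singular_bounds {n : ℕ} (hn : 100 ≤ n) {ε σ : ℝ} (hε0 : 0 < ε) (hε : ε < 1 / 1000)
    (hσ : 9 * √(Real.log (2 * n * (1 + 1 / ε)) / Real.pi) ≤ σ) :
    17 ≤ σ ∧ 1000 * n * Real.exp (-(Real.pi / 2) * σ ^ 2) ≤ 1 := by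
  have hn' : (100 : ℝ) ≤ n := by exact_mod_cast hn
  have hε1 : 1000 ≤ 1 / ε := by rw [le_div_iff₀ hε0]; linarith
  have hx : 1000 * n ≤ 2 * n * (1 + 1 / ε) := by nlinarith
  have hx' : 200200 ≤ 2 * n * (1 + 1 / ε) := by nlinarith
  set x := 2 * n * (1 + 1 / ε)
  have hx0 : 0 < x := by linarith
  have hT : 12 ≤ Real.log x := by
    rw [Real.le_log_iff_exp_le hx0]
    refine le_trans ?_ hx'
    have h1 := pow_le_pow_left₀ (Real.exp_pos 1).le Real.exp_one_lt_d9.le 12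
    rw [← Real.exp_nat_mul] at h1
    norm_num at h1 ⊢
    linarith
  have hsq : 81 * (Real.log x / Real.pi) ≤ σ ^ 2 := by
    have h1 := pow_le_pow_left₀ (by positivity) hσ 2
    rw [mul_pow, Real.sq_sqrt (by positivity)] at h1
    linarith
  have hπ := Real.pi_pos
  have hσ0 : 0 ≤ σ := le_trans (by positivity) hσ
  have hsqπ : 81 * Real.log x ≤ Real.pi * σ ^ 2 := by
    have h1 := mul_le_mul_of_nonneg_left hsq hπ.le
    rwa [show Real.pi * (81 * (Real.log x / Real.pi)) = 81 * Real.log x by field_simp] at h1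
  constructor
  · refine le_of_sq_le_sq ?_ hσ0
    have := Real.pi_lt_d2
    nlinarith
  · have h1 : Real.exp (-(Real.pi / 2) * σ ^ 2) ≤ x⁻¹ := by
      rw [← Real.exp_log hx0, ← Real.exp_neg, Real.exp_le_exp]
      nlinarith
    calc _ ≤ x * x⁻¹ := by gcongr
      _ = 1 := mul_inv_cancel₀ hx0.ne'

lemma least_le_largest {n : ℕ} (hn : 0 < n) {S : Matrix (Fin n) (Fin n) ℝ} {σ₁ σ : ℝ}
    (h₁ : ∀ x : Fin n → ℝ, enorm' (S *ᵥ x) ≤ σ₁ * enorm' x)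
    (h : ∀ x : Fin n → ℝ, σ * enorm' x ≤ enorm' (S *ᵥ x)) : σ ≤ σ₁ := by
  have h2 := (h (Pi.single ⟨0, hn⟩ 1)).trans (h₁ (Pi.single ⟨0, hn⟩ 1))
  have h3 : enorm' (Pi.single (⟨0, hn⟩ : Fin n) (1 : ℝ)) = 1 := by
    rw [enorm'_eq, nsq]; simp
  simpa [h3] using h2

/-- The Gaussian mass bound at the shortest dual vectors of the kernel lattice. -/
lemma exp_neg_ratio_le {n m k : ℕ} {ε σ σm ρ' : ℝ} (hn : 100 ≤ n) (hm : 30000 ≤ m) (hε0 : 0 < ε)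
    (hε : ε < 1 / 1000) (hσ : 17 ≤ σ) (hk0 : 0 < k) (hk : (k : ℝ) ≤ 30 * n * Real.logb 2 (n * σ))
    (hρ' : ρ' ^ 2 = n + Real.logb 2 m)
    (hσm : 10 * n * σ * Real.logb 2 m * √(Real.logb 2 (1 / ε) * Real.logb 2 (n * σ)) ≤ σm) :
    0 < σm ∧ Real.exp (-Real.pi * (σm ^ 2 / (200 * ρ' * √k) ^ 2)) ≤ ε / (6 * m) := by
  have hn' : (100 : ℝ) ≤ n := by exact_mod_cast hn
  have hm' : (30000 : ℝ) ≤ m := by exact_mod_cast hm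
  have hk0' : (0 : ℝ) < k := by exact_mod_cast hk0
  have hΛ : 10 ≤ Real.logb 2 (n * σ) := by
    rw [Real.le_logb_iff_rpow_le (by norm_num) (by nlinarith)]; norm_num; nlinarith
  have hM : 14 ≤ Real.logb 2 m := by
    rw [Real.le_logb_iff_rpow_le (by norm_num) (by linarith)]; norm_num; linarith
  have hε1 : 1000 ≤ 1 / ε := by rw [le_div_iff₀ hε0]; linarith
  have hE : 9 ≤ Real.logb 2 (1 / ε) := by
    rw [Real.le_logb_iff_rpow_le (by norm_num) (by linarith)]
    exact le_trans (by norm_num) hε1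
  have hl : 0 < Real.log 2 := Real.log_pos (by norm_num)
  have hlm : Real.log m = Real.logb 2 m * Real.log 2 := by rw [Real.logb]; field_simp
  have hlε : Real.log ε = -(Real.logb 2 (1 / ε) * Real.log 2) := by
    rw [Real.logb, one_div, Real.log_inv]; field_simp
  set Λ := Real.logb 2 (n * σ)
  set M := Real.logb 2 m
  set E := Real.logb 2 (1 / ε)
  have hσm0 : 0 < σm := lt_of_lt_of_le (by positivity) hσm
  refine ⟨hσm0, ?_⟩
  have hsq : 100 * n ^ 2 * σ ^ 2 * M ^ 2 * (E * Λ) ≤ σm ^ 2 := by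
    have h1 := pow_le_pow_left₀ (by positivity) hσm 2
    rw [mul_pow, Real.sq_sqrt (by positivity)] at h1
    linarith
  have hsq' : 28900 * (n ^ 2 * M ^ 2 * (E * Λ)) ≤ σm ^ 2 := by
    have h1 : (17 : ℝ) ^ 2 ≤ σ ^ 2 := by gcongr
    have h2 : (0 : ℝ) ≤ n ^ 2 * M ^ 2 * (E * Λ) := by positivity
    nlinarith [mul_le_mul_of_nonneg_right h1 h2]
  have hl2 : (200 * ρ' * √k) ^ 2 = 40000 * (n + M) * k := by
    rw [mul_pow, mul_pow, hρ', Real.sq_sqrt hk0'.le]; ring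
  have hnM : n + M ≤ 0.0815 * (n * M) := by nlinarith
  have hl3 : 40000 * (n + M) * k ≤ 97800 * (n ^ 2 * M * Λ) := by
    calc 40000 * (n + M) * k ≤ 40000 * (0.0815 * (n * M)) * (30 * n * Λ) := by gcongr
      _ = _ := by ring
  have hratio : M * E / 4 ≤ σm ^ 2 / (200 * ρ' * √k) ^ 2 := by
    rw [hl2, le_div_iff₀ (by positivity)]
    calc M * E / 4 * (40000 * (n + M) * k) ≤ M * E / 4 * (97800 * (n ^ 2 * M * Λ)) := by gcongr
      _ = 24450 * (n ^ 2 * M ^ 2 * (E * Λ)) := by ring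
      _ ≤ 28900 * (n ^ 2 * M ^ 2 * (E * Λ)) := by gcongr; norm_num
      _ ≤ _ := hsq'
  have h6 : Real.log 6 ≤ 3 := by
    rw [Real.log_le_iff_le_exp (by norm_num)]
    have := Real.add_one_le_exp (1 : ℝ)
    have h1 := pow_le_pow_left₀ (by norm_num) this 3
    rw [← Real.exp_nat_mul] at h1
    norm_num at h1 ⊢
    linarith
  rw [← Real.le_log_iff_exp_le (by positivity), Real.log_div hε0.ne' (by positivity),
    Real.log_mul (by norm_num) (by positivity), hlm, hlε]
  have hl1 : Real.log 2 ≤ 1 := by linarith [Real.log_two_lt_d9]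
  have h7 : 0.75 * (M * E) ≤ Real.pi * (σm ^ 2 / (200 * ρ' * √k) ^ 2) := by
    calc 0.75 * (M * E) = 3 * (M * E / 4) := by ring
      _ ≤ _ := by gcongr; exact Real.pi_gt_three.le
  have h8 : M * Real.log 2 ≤ M * 1 := by gcongr
  have h9 : E * Real.log 2 ≤ E * 1 := by gcongr
  nlinarith

lemma tsum_matrix_eq {n m : ℕ} (f : Matrix (Fin n) (Fin m) ℤ → ℝ) :
    ∑' Z, f Z = ∑' z : Fin m → Fin n → ℤ, f (fun i j => z j i) :=
  ((Equiv.piComm fun (_ : Fin m) (_ : Fin n) => ℤ).tsum_eq f).symm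

/-- the extension of Theorem 5.1 discussed at the end of Section 5.  Let
`m > n ≥ 100`, `ε ∈ (0, 1/1000)`, `R ∈ ℝ^{m×m}` invertible, `c ∈ ℝ^m`, `S, B ∈ ℝ^{n×n}`
invertible, `L = Bℤ^n`, `M = SBᵀ`, and draw the `m` columns of `X` independently from
`D_{L,M}` (so `X = B·Z` with the columns `z_j ∈ ℤ^n` of `Z` drawn with probabilities
`ρ_M(Bz_j)/ρ_M(L)`).  If `m ≥ 30·n·log₂(σ₁(S)·n)`,
`σ_m(R) ≥ 10·n·σ₁(S)·log₂(m)·√(log₂(1/ε)·log₂(n·σ₁(S)))` and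
`σ_n(S) ≥ 9·√(ln(2n(1+1/ε))/π)`, then with probability at least `1 − 2^{−n}` over `X`,
`Δ(E_{X,R,c}, D_{L + Xc, RXᵀ}) ≤ 2ε`. -/
theorem statement16 {n m : ℕ} (hn : 100 ≤ n) (hm : n < m)
    (ε : ℝ) (hε0 : 0 < ε) (hε : ε < 1 / 1000)
    (R : Matrix (Fin m) (Fin m) ℝ) (hR : IsUnit R.det) (c : Fin m → ℝ)
    (S : Matrix (Fin n) (Fin n) ℝ) (hS : IsUnit S.det)
    (B : Matrix (Fin n) (Fin n) ℝ) (hB : IsUnit B.det)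
    (σ1 σn σm : ℝ)
    (hσ1 : ∀ x : Fin n → ℝ, enorm' (S *ᵥ x) ≤ σ1 * enorm' x)
    (hσn : ∀ x : Fin n → ℝ, σn * enorm' x ≤ enorm' (S *ᵥ x))
    (hσm : ∀ x : Fin m → ℝ, σm * enorm' x ≤ enorm' (R *ᵥ x))
    (hmB : (m : ℝ) ≥ 30 * n * Real.logb 2 (σ1 * n))
    (hσmB : σm ≥ 10 * n * σ1 * Real.logb 2 m *
        Real.sqrt (Real.logb 2 (1 / ε) * Real.logb 2 (n * σ1)))
    (hσnB : σn ≥ 9 * Real.sqrt (Real.log (2 * n * (1 + 1 / ε)) / Real.pi)) :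
    (∑' Z : Matrix (Fin n) (Fin m) ℤ,
        if statDistL B Z R c ≤ 2 * ε then
          ∏ j : Fin m,
            (rho (S * Bᵀ) (B *ᵥ intCast' (fun i => Z i j)) /
              ∑' y : Fin n → ℤ, rho (S * Bᵀ) (B *ᵥ intCast' y))
        else 0)
      ≥ 1 - (2 : ℝ) ^ (-(n : ℤ)) := by
  have hn' : (100 : ℝ) ≤ n := by exact_mod_cast hn
  obtain ⟨hσn17, hns⟩ := least_singular_bounds hn hε0 hε hσnB
  have hσ17 : 17 ≤ σ1 := hσn17.trans (least_le_largest (by omega) hσ1 hσn)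
  have hσsq : 289 ≤ σn ^ 2 := by nlinarith
  rw [mul_comm σ1] at hmB
  have hu : 1700 ≤ n * σ1 := by nlinarith
  have hΛ : 10 ≤ Real.logb 2 (n * σ1) := by
    rw [Real.le_logb_iff_rpow_le (by norm_num) (by linarith)]; norm_num; linarith
  have hnΛ : 1000 ≤ n * Real.logb 2 (n * σ1) := by nlinarith
  have hm' : (30000 : ℝ) ≤ m := by linarith
  have hm3 : 30000 ≤ m := by exact_mod_cast hm'
  set k := ⌊30 * n * Real.logb 2 (n * σ1)⌋₊ with hkdef
  have hk : (k : ℝ) ≤ 30 * n * Real.logb 2 (n * σ1) := Nat.floor_le (by positivity)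
  have hk' : 29 * n * Real.logb 2 (n * σ1) ≤ k := by
    have := Nat.lt_floor_add_one (30 * n * Real.logb 2 (n * σ1))
    linarith
  have hk2 : (2 : ℝ) ≤ k := by linarith
  have hk0 : 0 < k := by rw [← Nat.cast_pos (α := ℝ)]; linarith
  have hkm : (k : ℝ) ≤ m := hk.trans hmB
  obtain ⟨K, -, hK⟩ := Finset.exists_subset_card_eq (s := (Finset.univ : Finset (Fin m)))
    (show k ≤ _ by rw [Finset.card_fin]; exact_mod_cast hkm)
  have hlk : 0 ≤ Real.logb 2 k := Real.logb_nonneg (by norm_num) (by linarith)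
  have hlkm : Real.logb 2 k ≤ Real.logb 2 m :=
    Real.logb_le_logb_of_le (by norm_num) (by linarith) hkm
  have hlkk : Real.logb 2 k ≤ k := by
    rw [Real.logb_le_iff_le_rpow (by norm_num) (by linarith), Real.rpow_natCast]
    exact_mod_cast Nat.lt_two_pow_self.le
  obtain ⟨ρ, hρdef⟩ : ∃ ρ, ρ = √(n + Real.logb 2 k) := ⟨_, rfl⟩
  obtain ⟨ρ', hρ'def⟩ : ∃ ρ', ρ' = √(n + Real.logb 2 m) := ⟨_, rfl⟩
  have hρsq : ρ ^ 2 = n + Real.logb 2 k := by rw [hρdef, Real.sq_sqrt (by positivity)]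
  have hρ'sq : ρ' ^ 2 = n + Real.logb 2 m := by rw [hρ'def, Real.sq_sqrt (by linarith)]
  have hρ1 : 1 ≤ ρ := by rw [hρdef, Real.one_le_sqrt]; linarith
  have hρρ' : ρ ≤ ρ' := by rw [hρdef, hρ'def]; gcongr
  have hρ0 : 0 < ρ := by linarith
  obtain ⟨i, hi, hi'⟩ := exists_nat_pow_near (show 1 ≤ 6 * ρ by linarith) (one_lt_two (α := ℝ))
  obtain ⟨t, ht, ht'⟩ := exists_nat_pow_near
    (show 1 ≤ 2 * ρ' / ρ by rw [le_div_iff₀ hρ0]; linarith) (one_lt_two (α := ℝ))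
  rw [le_div_iff₀ hρ0] at ht
  rw [div_lt_iff₀ hρ0] at ht'
  set I := i + 1 with hI
  have hI2 : (2 : ℝ) ^ (I + 1) ≤ 24 * ρ := by rw [hI, pow_succ, pow_succ]; linarith
  set N := ⌈σ1 * ρ⌉₊ with hN
  have hN1 : σ1 * ρ ≤ N := Nat.le_ceil _
  have hN2 : (N : ℝ) ≤ σ1 * ρ + 1 := (Nat.ceil_lt_add_one (by positivity)).le
  set q := k * (2 ^ (I + 1) * N) + N + 1 with hqdef
  have hq : (q : ℝ) ≤ (n * σ1) ^ 6 :=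
    grid_size_le hn hσ17 rfl hk (by rw [hρsq]; linarith) hN2 hI2
  have hsqk : 1 ≤ √(k : ℝ) := Real.one_le_sqrt.2 (by linarith)
  have ha₀ : 2 ^ (I + 1) * √(k : ℝ) = √(k * (2 ^ (I + 1)) ^ 2) := by
    rw [Real.sqrt_mul (by positivity), Real.sqrt_sq (by positivity), mul_comm]
  have ha₀le : 2 ^ (I + 1) * √(k : ℝ) ≤ 24 * ρ * √k := by gcongr
  have hρ'0 : 0 < ρ' := by linarith
  have hsmall : 4 * n ≤ σn ^ 2 * ρ ^ 2 := by
    calc (4 * n : ℝ) ≤ 289 * ρ ^ 2 := by rw [hρsq]; linarith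
      _ ≤ _ := by gcongr
  have hl4 : 4 * (2 ^ (I + 1) * √(k : ℝ)) ≤ 200 * ρ' * √k := by
    calc _ ≤ 4 * (24 * ρ * √(k : ℝ)) := by gcongr
      _ ≤ 4 * (24 * ρ' * √(k : ℝ)) := by gcongr
      _ ≤ _ := by nlinarith only [hsqk, hρ'0]
  have hl : 1 + (2 ^ (t + 1 + 1) - 1) * (2 ^ (I + 1) * √(k : ℝ)) ≤ 200 * ρ' * √k := by
    have h1 : (2 : ℝ) ^ (t + 1 + 1) * (2 ^ (I + 1) * √(k : ℝ)) ≤ 192 * (ρ' * √k) := by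
      calc _ ≤ (2 : ℝ) ^ (t + 1 + 1) * (24 * ρ * √k) := by gcongr
        _ = 96 * (2 ^ t * ρ * √k) := by ring
        _ ≤ 96 * (2 * ρ' * √k) := by gcongr
        _ = _ := by ring
    have h2 : 1 ≤ ρ' * √k := one_le_mul_of_one_le_of_one_le (hρ1.trans hρρ') hsqk
    have h3 : 0 ≤ 2 ^ (I + 1) * √(k : ℝ) := by positivity
    rw [sub_mul]
    linarith
  obtain ⟨hσm0, hη⟩ := exp_neg_ratio_le hn hm3 hε0 hε hσ17 hk0 hk hρ'sq hσmB
  have key : ∀ z : Fin m → Fin n → ℤ, (∀ j ∈ K, snorm S (z j) ≤ ρ ^ 2) →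
      (∀ j, snorm S (z j) ≤ ρ' ^ 2) → farMass S K q I z < (((2 : ℝ) ^ (I + 1)) ^ 2) ^ K.card / 3 →
      statDistL B (fun i j => z j i) R c ≤ 2 * ε := by
    intro z hz hz' hfar
    have hη3 : ε / (6 * m) < 1 / 3 := by rw [div_lt_iff₀ (by positivity)]; linarith
    refine statDistL_le_of_farMass_lt hS (s := σn ^ 2) (s₁ := σ1 ^ 2) (by linarith)
      (nsq_bounds (by linarith) hσn) (nsq_mulVec_le hσ1) (by positivity) (K := K) (ρ := ρ)
      (ρ' := ρ') hρ0.le (by linarith) hz hz' (I := I) (N := N) (q := q) (t := t + 1) ?_ ?_ ?_ hfar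
      hsmall ?_ (a₀ := 2 ^ (I + 1) * √k) ?_ (l := 200 * ρ' * √k) (by positivity) hl4 hl hR
      (r := σm ^ 2) (η := ε / (6 * m)) (by positivity) (nsq_bounds hσm0.le hσm) hη hη3
      (ratio_pow_le (by omega) hε0 hε) hB c
    · rw [show 36 * ρ ^ 2 = (6 * ρ) ^ 2 by ring]; gcongr
    · rw [← mul_pow, mul_comm]; gcongr
    · rw [hK]; omega
    · linarith
    · rw [hK]; exact ha₀
  have hδ : m * (2 ^ n * Real.exp (-(3 * Real.pi / 4) * ρ' ^ 2)) +
      K.card * (2 ^ n * Real.exp (-(3 * Real.pi / 4) * ρ ^ 2)) + q ^ n * (3 * (5 / 8) ^ K.card) ≤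
      ((2 : ℝ) ^ n)⁻¹ := by
    rw [hρsq, hρ'sq, hK]
    have h1 := mul_exp_tail_le n (show (2 : ℝ) ≤ m by linarith)
    have h2 := mul_exp_tail_le n hk2
    have h3 := pow_far_le (by omega) (by linarith) hq hk'
    linarith
  have hmain := one_sub_le_tsum_dgauss hS (by positivity) (nsq_bounds (by linarith) hσn) hns
    (by omega) hδ (A := fun z => statDistL B (fun i j => z j i) R c ≤ 2 * ε) key
  rw [tsum_matrix_eq, zpow_neg, zpow_natCast]
  simp only [rho_mul_transpose S hB]
  exact hmain
end
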